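/- arXiv:2108.02364 — 2 statements merged into one kernel-verified Lean document; each statement's English description precedes it below -/
import Mathlib

section
/- Let t ≥ 3 and n ≥ t+1, and let G* attain the maximum spectral radius among all n-vertex connected K_{1,t}-minor free graphs. Then G* is isomorphic to \overline{H_{1,t}} if n = t+1, and G* is isomorphic to S^{n−t}(K_t) if n ≥ t+2. -/
open SimpleGraph

/-- `H` is a minor of `G` (branch-set definition). -/
def MinorOf {α β : Type} (H : SimpleGraph α) (G : SimpleGraph β) : Prop :=
  ∃ φ : α → Set β,
    (∀ a, (G.induce (φ a)).Connected) ∧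
    (Pairwise fun a b => Disjoint (φ a) (φ b)) ∧
    (∀ a b, H.Adj a b → ∃ x ∈ φ a, ∃ y ∈ φ b, G.Adj x y)

/-- Adjacency matrix over ℝ. -/
noncomputable def adjMat {V : Type} [Fintype V] (G : SimpleGraph V) : Matrix V V ℝ :=
  letI := Classical.decRel G.Adj
  SimpleGraph.adjMatrix ℝ G

theorem adjMat_herm {V : Type} [Fintype V] (G : SimpleGraph V) : (adjMat G).IsHermitian := by
  letI := Classical.decRel G.Adj
  ext i j
  simp [adjMat, Matrix.conjTranspose_apply, SimpleGraph.adjMatrix_apply, SimpleGraph.adj_comm]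

/-- Spectral radius = largest adjacency eigenvalue. -/
noncomputable def specRad {V : Type} [Fintype V] [DecidableEq V] (G : SimpleGraph V) : ℝ :=
  ⨆ i, (adjMat_herm G).eigenvalues i

/-- degree -/
noncomputable def deg {V : Type} (G : SimpleGraph V) (v : V) : ℕ := (G.neighborSet v).ncard

/-- number of edges -/
noncomputable def ecard {V : Type} (G : SimpleGraph V) : ℕ := G.edgeSet.ncard

/-- k disjoint copies of G -/
def copies (k : ℕ) {V : Type} (G : SimpleGraph V) : SimpleGraph (Fin k × V) :=
  SimpleGraph.fromRel fun x y => x.1 = y.1 ∧ G.Adj x.2 y.2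

/-- disjoint union -/
def gUnion {V W : Type} (G : SimpleGraph V) (H : SimpleGraph W) : SimpleGraph (V ⊕ W) :=
  SimpleGraph.fromRel fun x y =>
    (∃ a b, x = Sum.inl a ∧ y = Sum.inl b ∧ G.Adj a b) ∨
    (∃ a b, x = Sum.inr a ∧ y = Sum.inr b ∧ H.Adj a b)

/-- join -/
def gJoin {V W : Type} (G : SimpleGraph V) (H : SimpleGraph W) : SimpleGraph (V ⊕ W) :=
  SimpleGraph.fromRel fun x y =>
    (∃ a b, x = Sum.inl a ∧ y = Sum.inl b ∧ G.Adj a b) ∨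
    (∃ a b, x = Sum.inr a ∧ y = Sum.inr b ∧ H.Adj a b) ∨
    (∃ a b, x = Sum.inl a ∧ y = Sum.inr b)

/-- Petersen graph (Kneser graph K(5,2)). -/
def petersen : SimpleGraph {s : Finset (Fin 5) // s.card = 2} :=
  SimpleGraph.fromRel fun a b => Disjoint a.1 b.1

/-- star K_{1,m} -/
def starG (m : ℕ) : SimpleGraph (Fin 1 ⊕ Fin m) := completeBipartiteGraph (Fin 1) (Fin m)

/-- the star forest H_{s,t} -/
def Hst (s t : ℕ) :
    SimpleGraph ((Fin ((t+1)/(s+1) - 1) × (Fin 1 ⊕ Fin s)) ⊕ (Fin 1 ⊕ Fin (t - ((t+1)/(s+1) - 1) * (s+1)))) :=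
  gUnion (copies ((t+1)/(s+1) - 1) (starG s)) (starG (t - ((t+1)/(s+1) - 1) * (s+1)))

/-- subdivide the edge uv of G by a path through k new vertices -/
def subdividePath {V : Type} (G : SimpleGraph V) (u v : V) (k : ℕ) : SimpleGraph (V ⊕ Fin k) :=
  SimpleGraph.fromRel fun x y =>
    (∃ a b, x = Sum.inl a ∧ y = Sum.inl b ∧ G.Adj a b ∧ ¬(a = u ∧ b = v) ∧ ¬(a = v ∧ b = u)) ∨
    (∃ i : Fin k, x = Sum.inl u ∧ y = Sum.inr i ∧ (i : ℕ) = 0) ∨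
    (∃ i j : Fin k, x = Sum.inr i ∧ y = Sum.inr j ∧ (j : ℕ) = (i : ℕ) + 1) ∨
    (∃ i : Fin k, x = Sum.inr i ∧ y = Sum.inl v ∧ (i : ℕ) = k - 1)

/-- (s,t)-property -/
def HasSTProp (s t : ℕ) {V : Type} (G : SimpleGraph V) : Prop :=
  ∀ a b : ℕ, 1 ≤ a → 1 ≤ b → a + b = t + 1 → a ≤ min s ((t+1)/2) →
    ¬ MinorOf (completeBipartiteGraph (Fin a) (Fin b)) G

/-- H_{a,b,c} -/
def Habc (a b c : ℕ) : SimpleGraph (Fin 3 ⊕ (Fin a ⊕ Fin b ⊕ Fin c)) :=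
  SimpleGraph.fromRel fun x y =>
    (x = Sum.inl 0 ∧ y = Sum.inl 1) ∨
    (x = Sum.inl 0 ∧ ∃ i : Fin a, y = Sum.inr (Sum.inl i)) ∨
    (x = Sum.inl 0 ∧ ∃ i : Fin b, y = Sum.inr (Sum.inr (Sum.inl i))) ∨
    (x = Sum.inl 1 ∧ ∃ i : Fin a, y = Sum.inr (Sum.inl i)) ∨
    (x = Sum.inl 1 ∧ ∃ i : Fin c, y = Sum.inr (Sum.inr (Sum.inr i))) ∨
    (x = Sum.inl 2 ∧ ∃ i : Fin b, y = Sum.inr (Sum.inr (Sum.inl i))) ∨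
    (x = Sum.inl 2 ∧ ∃ i : Fin c, y = Sum.inr (Sum.inr (Sum.inr i)))

noncomputable def edgeDegSum {V : Type} (G H : SimpleGraph V) : ℕ :=
  ∑ᶠ e ∈ G.edgeSet, Sym2.lift ⟨fun u v => deg H u + deg H v, fun u v => by dsimp; ring⟩ e

open scoped Matrix

section spectral
variable {V : Type} [Fintype V] [DecidableEq V]

lemma sx_adjMat_apply (G : SimpleGraph V) (i j : V) [Decidable (G.Adj i j)] :
    adjMat G i j = if G.Adj i j then (1:ℝ) else 0 := by
  simp [adjMat, SimpleGraph.adjMatrix_apply]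

lemma sx_le_specRad (G : SimpleGraph V) (i : V) :
    (adjMat_herm G).eigenvalues i ≤ specRad G :=
  le_ciSup (Set.finite_range _).bddAbove i

lemma sx_herm (G : SimpleGraph V) : (specRad G • (1 : Matrix V V ℝ) - adjMat G).IsHermitian := by
  refine Matrix.IsHermitian.sub ?_ (adjMat_herm G)
  simp [Matrix.IsHermitian]

lemma sx_psd (G : SimpleGraph V) : (specRad G • (1 : Matrix V V ℝ) - adjMat G).PosSemidef := by
  rw [(sx_herm G).posSemidef_iff_eigenvalues_nonneg]
  intro i
  have h1 := (sx_herm G).mulVec_eigenvectorBasis i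
  set v := (sx_herm G).eigenvectorBasis i with hv
  set μ := (sx_herm G).eigenvalues i with hμ
  have hv0 : (WithLp.ofLp v) ≠ 0 := by
    intro h
    have : v = 0 := by ext j; exact congrFun h j
    exact (sx_herm G).eigenvectorBasis.orthonormal.ne_zero i this
  have h2 : adjMat G *ᵥ (WithLp.ofLp v) = (specRad G - μ) • (WithLp.ofLp v) := by
    rw [Matrix.sub_mulVec, Matrix.smul_mulVec, Matrix.one_mulVec] at h1
    rw [sub_smul, ← h1]; abel
  have h3 : specRad G - μ ∈ spectrum ℝ (adjMat G) := by
    rw [← Matrix.spectrum_toLin' (R := ℝ)]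
    apply Module.End.HasEigenvalue.mem_spectrum
    apply Module.End.hasEigenvalue_of_hasEigenvector (x := WithLp.ofLp v)
    refine ⟨?_, hv0⟩
    rw [Module.End.mem_eigenspace_iff]
    simpa using h2
  rw [(adjMat_herm G).spectrum_real_eq_range_eigenvalues] at h3
  obtain ⟨j, hj⟩ := h3
  have := sx_le_specRad G j
  simp only [Pi.zero_apply]
  linarith

open Classical in
lemma sx_quad (G : SimpleGraph V) (y : V → ℝ) :
    y ⬝ᵥ ((specRad G • (1 : Matrix V V ℝ) - adjMat G) *ᵥ y) =
    specRad G * ∑ i, y i ^ 2 - ∑ i, ∑ j, (if G.Adj i j then y i * y j else 0) := by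
  rw [Matrix.sub_mulVec, Matrix.smul_mulVec, Matrix.one_mulVec, dotProduct_sub]
  congr 1
  · simp only [dotProduct, Pi.smul_apply, smul_eq_mul, Finset.mul_sum]
    exact Finset.sum_congr rfl fun i _ => by ring
  · simp only [dotProduct, Matrix.mulVec, Finset.mul_sum]
    refine Finset.sum_congr rfl fun i _ => Finset.sum_congr rfl fun j _ => ?_
    rw [sx_adjMat_apply]; split_ifs <;> simp

open Classical in
lemma sx_rayleigh (G : SimpleGraph V) (y : V → ℝ) :
    ∑ i, ∑ j, (if G.Adj i j then y i * y j else 0) ≤ specRad G * ∑ i, y i ^ 2 := by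
  have := (sx_psd G).dotProduct_mulVec_nonneg y
  rw [star_trivial, sx_quad] at this
  linarith

open Classical in
lemma sx_perron (G : SimpleGraph V) (hconn : G.Connected) :
    ∃ (x : V → ℝ) (u : V), (∀ i, 0 < x i) ∧
      (∀ i, ∑ j, (if G.Adj i j then x j else 0) = specRad G * x i) ∧ x u = 1 ∧ ∀ i, x i ≤ 1 := by
  haveI : Nonempty V := hconn.nonempty
  obtain ⟨i0, hi0⟩ := exists_eq_ciSup_of_finite (f := (adjMat_herm G).eigenvalues)
  have h1 := (adjMat_herm G).mulVec_eigenvectorBasis i0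
  rw [hi0] at h1
  set v := (adjMat_herm G).eigenvectorBasis i0 with hv
  have hv0 : ∃ i, v i ≠ 0 := by
    by_contra h
    push Not at h
    have : v = 0 := by ext j; exact h j
    exact (adjMat_herm G).eigenvectorBasis.orthonormal.ne_zero i0 this
  have hev : ∀ i, ∑ j, (if G.Adj i j then v j else 0) = specRad G * v i := by
    intro i
    have := congrFun h1 i
    simp only [Matrix.mulVec, dotProduct, Pi.smul_apply, smul_eq_mul] at this
    rw [specRad, ← this]
    refine Finset.sum_congr rfl fun j _ => ?_
    rw [sx_adjMat_apply]; split_ifs <;> simp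
  set y : V → ℝ := fun i => |v i| with hy
  have hker : (specRad G • (1 : Matrix V V ℝ) - adjMat G) *ᵥ y = 0 := by
    rw [← (sx_psd G).dotProduct_mulVec_zero_iff, star_trivial]
    apply le_antisymm
    · rw [sx_quad]
      have e1 : specRad G * ∑ i, y i ^ 2 = ∑ i, ∑ j, (if G.Adj i j then v i * v j else 0) := by
        rw [Finset.mul_sum]
        refine Finset.sum_congr rfl fun i _ => ?_
        simp only [hy, sq_abs]
        rw [show specRad G * v i ^ 2 = v i * (specRad G * v i) by ring, ← hev, Finset.mul_sum]
        refine Finset.sum_congr rfl fun j _ => ?_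
        split_ifs <;> simp
      rw [e1, sub_nonpos]
      refine Finset.sum_le_sum fun i _ => Finset.sum_le_sum fun j _ => ?_
      split_ifs
      · simp only [hy]; rw [← abs_mul]; exact le_abs_self _
      · rfl
    · simpa using (sx_psd G).dotProduct_mulVec_nonneg y
  have hevy : ∀ i, ∑ j, (if G.Adj i j then y j else 0) = specRad G * y i := by
    intro i
    have := congrFun hker i
    rw [Matrix.sub_mulVec, Matrix.smul_mulVec, Matrix.one_mulVec] at this
    simp only [Pi.sub_apply, Pi.smul_apply, smul_eq_mul, Pi.zero_apply, Matrix.mulVec, dotProduct] at this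
    rw [sub_eq_zero] at this
    rw [this]
    refine Finset.sum_congr rfl fun j _ => ?_
    rw [sx_adjMat_apply]; split_ifs <;> simp
  have hy0 : ∀ i, 0 ≤ y i := fun i => abs_nonneg _
  have hprop : ∀ i j, G.Adj i j → y i = 0 → y j = 0 := by
    intro i j hij hi
    have := hevy i
    rw [hi, mul_zero, Finset.sum_eq_zero_iff_of_nonneg] at this
    · simpa [hij] using this j (Finset.mem_univ _)
    · intro k _; split_ifs; exacts [hy0 k, le_rfl]
  have hpos : ∀ i, 0 < y i := by
    intro i
    rcases (hy0 i).lt_or_eq with h | h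
    · exact h
    · exfalso
      obtain ⟨k, hk⟩ := hv0
      have hr : G.Reachable i k := hconn.preconnected i k
      obtain ⟨p⟩ := hr
      have : y k = 0 := by
        clear hk
        induction p with
        | nil => exact h.symm
        | cons hadj p ih => exact ih (hprop _ _ hadj h.symm).symm
      exact hk (abs_eq_zero.mp this)
  obtain ⟨u, hu⟩ := Finite.exists_max y
  refine ⟨fun i => y i / y u, u, fun i => div_pos (hpos i) (hpos u), fun i => ?_,
    div_self (hpos u).ne', fun i => (div_le_one (hpos u)).mpr (hu i)⟩
  rw [← mul_div_assoc, ← hevy, Finset.sum_div]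
  refine Finset.sum_congr rfl fun j _ => ?_
  split_ifs <;> simp

/-- strict monotonicity used at the end -/
lemma sx_eq_of_le {G G' : SimpleGraph V} (hconn : G.Connected) (hle : G ≤ G')
    (hr : specRad G' ≤ specRad G) : G = G' := by
  classical
  obtain ⟨x, u, hpos, hev, -, -⟩ := sx_perron G hconn
  by_contra hne
  obtain ⟨a, b, hab, hnab⟩ : ∃ a b, G'.Adj a b ∧ ¬ G.Adj a b := by
    by_contra h
    push Not at h
    exact hne (le_antisymm hle fun a b => h a b)
  have h1 := sx_rayleigh G' x
  have h2 : ∑ i, ∑ j, (if G.Adj i j then x i * x j else 0) = specRad G * ∑ i, x i ^ 2 := by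
    rw [Finset.mul_sum]
    refine Finset.sum_congr rfl fun i _ => ?_
    rw [show specRad G * x i ^ 2 = x i * (specRad G * x i) by ring, ← hev, Finset.mul_sum]
    refine Finset.sum_congr rfl fun j _ => ?_
    split_ifs <;> simp
  have h3 : ∑ i, ∑ j, (if G.Adj i j then x i * x j else 0) <
      ∑ i, ∑ j, (if G'.Adj i j then x i * x j else 0) := by
    have hterm : ∀ i j, (if G.Adj i j then x i * x j else 0) ≤ (if G'.Adj i j then x i * x j else 0) := by
      intro i j
      by_cases h : G.Adj i j
      · simp [h, hle h]
      · simp only [h, if_false]; split_ifs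
        · exact (mul_pos (hpos i) (hpos j)).le
        · rfl
    refine Finset.sum_lt_sum (fun i _ => Finset.sum_le_sum fun j _ => hterm i j) ⟨a, Finset.mem_univ _, ?_⟩
    refine Finset.sum_lt_sum (fun j _ => hterm a j) ⟨b, Finset.mem_univ _, ?_⟩
    simp [hab, hnab, mul_pos (hpos a) (hpos b)]
  have h4 : 0 ≤ ∑ i, x i ^ 2 := Finset.sum_nonneg fun i _ => sq_nonneg _
  nlinarith [mul_le_mul_of_nonneg_right hr h4]

end spectral


section comb
variable {V : Type} [Fintype V] [DecidableEq V]

/-- boundary form of being `K_{1,t}`-minor free -/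
def FreeD (G : SimpleGraph V) (t : ℕ) : Prop :=
  ∀ I D : Finset V, (G.induce (I : Set V)).Connected → Disjoint I D →
    (∀ d ∈ D, ∃ i ∈ I, G.Adj i d) → D.card < t

lemma free_iff (G : SimpleGraph V) (t : ℕ) (ht : 0 < t) :
    ¬ MinorOf (completeBipartiteGraph (Fin 1) (Fin t)) G ↔ FreeD G t := by
  classical
  constructor
  · intro h I D hI hdis hadj
    by_contra hc
    push Not at hc
    apply h
    obtain ⟨f⟩ : Nonempty (Fin t ↪ D) := by
      apply Function.Embedding.nonempty_of_card_le
      simpa using hc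
    refine ⟨Sum.elim (fun _ => (I : Set V)) (fun i => {(f i : V)}), ?_, ?_, ?_⟩
    · rintro (a | a)
      · exact hI
      · simp only [Sum.elim_inr]
        exact SimpleGraph.connected_iff _ |>.mpr ⟨fun x y => by
          rw [Subsingleton.elim x y], ⟨⟨f a, rfl⟩⟩⟩
    · have key : ∀ i : Fin t, (f i : V) ∉ I := fun i hi =>
        Finset.disjoint_left.mp hdis hi (f i).2
      rintro (a | a) (b | b) hab
      · exact absurd (congrArg Sum.inl (Subsingleton.elim a b)) hab
      · simpa using key b
      · simpa using key a
      · simp only [Sum.elim_inr, Set.disjoint_singleton]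
        intro he
        exact hab (congrArg Sum.inr (f.injective (Subtype.ext he)))
    · have key : ∀ i : Fin t, ∃ x ∈ I, G.Adj x (f i) := fun i => hadj _ (f i).2
      rintro (a | a) (b | b) hab
      · simp at hab
      · obtain ⟨x, hx, hxy⟩ := key b
        exact ⟨x, hx, f b, rfl, hxy⟩
      · obtain ⟨x, hx, hxy⟩ := key a
        exact ⟨f a, rfl, x, hx, hxy.symm⟩
      · simp at hab
  · rintro h ⟨φ, h1, h2, h3⟩
    have key : ∀ i : Fin t, ∃ y ∈ φ (Sum.inr i), ∃ x ∈ φ (Sum.inl 0), G.Adj x y := by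
      intro i
      obtain ⟨x, hx, y, hy, hxy⟩ := h3 (Sum.inl 0) (Sum.inr i) (by simp)
      exact ⟨y, hy, x, hx, hxy⟩
    choose y hy x hx hxy using key
    have hinj : Function.Injective y := by
      intro i j hij
      by_contra hne
      have := h2 (show (Sum.inr i : Fin 1 ⊕ Fin t) ≠ Sum.inr j from fun h => hne (Sum.inr_injective h))
      exact Set.disjoint_left.mp this (hy i) (hij ▸ hy j)
    have := h (φ (Sum.inl 0)).toFinset (Finset.univ.image y) (by rw [Set.coe_toFinset]; exact h1 (Sum.inl 0)) (by
      rw [Finset.disjoint_left]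
      intro a ha hb
      simp only [Set.mem_toFinset] at ha
      simp only [Finset.mem_image, Finset.mem_univ, true_and] at hb
      obtain ⟨i, rfl⟩ := hb
      exact Set.disjoint_left.mp (h2 (show (Sum.inl 0 : Fin 1 ⊕ Fin t) ≠ Sum.inr i by simp)) ha (hy i)) (by
      intro d hd
      simp only [Finset.mem_image, Finset.mem_univ, true_and] at hd
      obtain ⟨i, rfl⟩ := hd
      exact ⟨x i, by simpa using hx i, hxy i⟩)
    rw [Finset.card_image_of_injective _ hinj] at this
    simp at this

lemma conn_singleton (G : SimpleGraph V) (a : V) :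
    (G.induce ((({a} : Finset V)) : Set V)).Connected := by
  rw [Finset.coe_singleton]
  exact SimpleGraph.connected_iff _ |>.mpr ⟨fun x y => by
          rw [Subsingleton.elim x y], ⟨⟨a, rfl⟩⟩⟩

lemma conn_insert (G : SimpleGraph V) {I : Finset V} (hI : (G.induce (I : Set V)).Connected)
    {x y : V} (hy : y ∈ I) (hxy : G.Adj y x) :
    (G.induce ((insert x I : Finset V) : Set V)).Connected := by
  rw [Finset.coe_insert, Set.insert_eq, Set.union_comm]
  have := conn_singleton G x
  rw [Finset.coe_singleton] at this
  exact connected_induce_union (v := y) (w := x) hI.preconnected this.preconnected hy (by simp) hxy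

variable {G : SimpleGraph V} {t : ℕ} {u : V} {N : Finset V}

lemma fact_LF (hF : FreeD G t) (hN : ∀ w, w ∈ N ↔ G.Adj u w) (hNc : N.card + 1 = t)
    {I : Finset V} (hI : (G.induce (I : Set V)).Connected) {w : V} (huI : u ∈ I) (hwN : w ∈ N)
    (hwI : w ∈ I) (hIN : ∀ v ∈ I, v ∈ N → v = w) {y y' : V} (hy : y ∉ I) (hy' : y' ∉ I)
    (hyN : y ∉ N) (hyN' : y' ∉ N) (hya : ∃ i ∈ I, G.Adj i y) (hya' : ∃ i ∈ I, G.Adj i y') : y = y' := by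
  by_contra hne
  have := hF I (N.erase w ∪ {y, y'}) hI (by
    rw [Finset.disjoint_left]
    intro a ha hb
    simp only [Finset.mem_union, Finset.mem_erase, Finset.mem_insert, Finset.mem_singleton] at hb
    rcases hb with ⟨h1, h2⟩ | rfl | rfl
    · exact h1 (hIN a ha h2)
    · exact hy ha
    · exact hy' ha) (by
    intro d hb
    simp only [Finset.mem_union, Finset.mem_erase, Finset.mem_insert, Finset.mem_singleton] at hb
    rcases hb with ⟨h1, h2⟩ | rfl | rfl
    · exact ⟨u, huI, (hN d).mp h2⟩
    · exact hya
    · exact hya')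
  rw [Finset.card_union_of_disjoint (by
    rw [Finset.disjoint_left]
    intro a ha hb
    simp only [Finset.mem_erase, Finset.mem_insert, Finset.mem_singleton] at ha hb
    rcases hb with rfl | rfl
    · exact hyN ha.2
    · exact hyN' ha.2), Finset.card_erase_of_mem hwN, Finset.card_pair hne] at this
  have : 0 < N.card := Finset.card_pos.mpr ⟨w, hwN⟩
  omega

lemma claim_one (hF : FreeD G t) (hN : ∀ w, w ∈ N ↔ G.Adj u w) (hNc : N.card + 1 = t)
    {w y y' : V} (hw : w ∈ N) (hyu : y ≠ u) (hyu' : y' ≠ u) (hyN : y ∉ N) (hyN' : y' ∉ N)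
    (h : G.Adj w y) (h' : G.Adj w y') : y = y' := by
  have huN : u ∉ N := by simp [hN]
  refine fact_LF hF hN hNc (I := {w, u}) (w := w)
    (conn_insert G (conn_singleton G u) (by simp) ((hN w).mp hw)) (by simp) hw (by simp) ?_ ?_ ?_ hyN hyN'
    ⟨w, by simp, h⟩ ⟨w, by simp, h'⟩
  · intro v hv hvN
    simp only [Finset.mem_insert, Finset.mem_singleton] at hv
    rcases hv with h | rfl
    · exact h
    · exact absurd hvN huN
  · simp only [Finset.mem_insert, Finset.mem_singleton, not_or]
    exact ⟨fun e => hyN (e ▸ hw), hyu⟩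
  · simp only [Finset.mem_insert, Finset.mem_singleton, not_or]
    exact ⟨fun e => hyN' (e ▸ hw), hyu'⟩

/-- an attached vertex outside has at most one outside neighbour -/
lemma claim_r (hF : FreeD G t) (hN : ∀ w, w ∈ N ↔ G.Adj u w) (hNc : N.card + 1 = t)
    {w z y y' : V} (hw : w ∈ N) (hzu : z ≠ u) (hzN : z ∉ N) (hwz : G.Adj w z)
    (hyu : y ≠ u) (hyu' : y' ≠ u) (hyN : y ∉ N) (hyN' : y' ∉ N)
    (h : G.Adj z y) (h' : G.Adj z y') : y = y' := by
  have huN : u ∉ N := by simp [hN]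
  refine fact_LF hF hN hNc (I := {z, w, u}) (w := w)
    (conn_insert G (conn_insert G (conn_singleton G u) (by simp) ((hN w).mp hw)) (y := w) (by simp) hwz)
      (by simp) hw (by simp) ?_ ?_ ?_ hyN hyN'
    ⟨z, by simp, h⟩ ⟨z, by simp, h'⟩
  · intro v hv hvN
    simp only [Finset.mem_insert, Finset.mem_singleton] at hv
    rcases hv with rfl | h | rfl
    · exact absurd hvN hzN
    · exact h
    · exact absurd hvN huN
  · simp only [Finset.mem_insert, Finset.mem_singleton, not_or]
    exact ⟨h.ne', fun e => hyN (e ▸ hw), hyu⟩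
  · simp only [Finset.mem_insert, Finset.mem_singleton, not_or]
    exact ⟨h'.ne', fun e => hyN' (e ▸ hw), hyu'⟩

lemma claim_deg (hF : FreeD G t) (hN : ∀ w, w ∈ N ↔ G.Adj u w) (hNc : N.card + 1 = t)
    {w z : V} (hw : w ∈ N) (hzu : z ≠ u) (hzN : z ∉ N) (hwz : G.Adj w z) :
    ∃ w' ∈ N, w' ≠ w ∧ ¬ G.Adj w w' := by
  by_contra hc
  push Not at hc
  have huN : u ∉ N := by simp [hN]
  have := hF {w} (insert u (insert z (N.erase w))) (conn_singleton G w) (by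
    have : w ≠ u := fun e => huN (e ▸ hw)
    have : w ≠ z := hwz.ne
    simp [*]) (by
    intro d hd
    simp only [Finset.mem_insert, Finset.mem_erase] at hd
    refine ⟨w, by simp, ?_⟩
    rcases hd with rfl | rfl | ⟨h1, h2⟩
    · exact ((hN w).mp hw).symm
    · exact hwz
    · exact hc d h2 h1)
  rw [Finset.card_insert_of_notMem (by simp [huN, hzu.symm]),
    Finset.card_insert_of_notMem (by simp [hzN]), Finset.card_erase_of_mem hw] at this
  have : 0 < N.card := Finset.card_pos.mpr ⟨w, hw⟩
  omega

lemma claim_A (hF : FreeD G t) (hN : ∀ w, w ∈ N ↔ G.Adj u w) (hNc : N.card + 1 = t)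
    {w z y : V} (hw : w ∈ N) (hzu : z ≠ u) (hzN : z ∉ N) (hwz : G.Adj w z)
    (hyu : y ≠ u) (hyN : y ∉ N) (hzy : G.Adj z y) :
    ∃ w' ∈ N, w' ≠ w ∧ ¬ G.Adj w w' ∧ ¬ G.Adj z w' := by
  by_contra hc
  push Not at hc
  have huN : u ∉ N := by simp [hN]
  have := hF {z, w} (insert u (insert y (N.erase w)))
    (conn_insert G (conn_singleton G w) (by simp) hwz) (by
    rw [Finset.disjoint_left]
    intro a ha hb
    simp only [Finset.mem_insert, Finset.mem_singleton, Finset.mem_erase] at ha hb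
    rcases ha with rfl | rfl
    · rcases hb with h | h | h
      · exact hzu h
      · exact hzy.ne h
      · exact hzN h.2
    · rcases hb with h | h | h
      · exact huN (h ▸ hw)
      · exact hyN (h ▸ hw)
      · exact h.1 rfl) (by
    intro d hd
    simp only [Finset.mem_insert, Finset.mem_erase] at hd
    rcases hd with rfl | rfl | ⟨h1, h2⟩
    · exact ⟨w, by simp, ((hN w).mp hw).symm⟩
    · exact ⟨z, by simp, hzy⟩
    · by_cases h : G.Adj w d
      · exact ⟨w, by simp, h⟩
      · exact ⟨z, by simp, hc d h2 h1 h⟩)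
  rw [Finset.card_insert_of_notMem (by simp [huN, hyu.symm]),
    Finset.card_insert_of_notMem (by simp [hyN]), Finset.card_erase_of_mem hw] at this
  have : 0 < N.card := Finset.card_pos.mpr ⟨w, hw⟩
  omega

lemma claim_B (hF : FreeD G t) (hN : ∀ w, w ∈ N ↔ G.Adj u w) (hNc : N.card + 1 = t)
    {w z w' z' : V} (hw : w ∈ N) (hzu : z ≠ u) (hzN : z ∉ N) (hwz : G.Adj w z)
    (hw' : w' ∈ N) (hzu' : z' ≠ u) (hzN' : z' ∉ N) (hwz' : G.Adj w' z')
    (hww : G.Adj w w') (hzz : z ≠ z') :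
    ∃ v ∈ N, v ≠ w ∧ v ≠ w' ∧ ¬ G.Adj w v ∧ ¬ G.Adj w' v := by
  by_contra hc
  push Not at hc
  have huN : u ∉ N := by simp [hN]
  have := hF {w', w} (insert u (insert z (insert z' ((N.erase w).erase w'))))
    (conn_insert G (conn_singleton G w) (by simp) hww) (by
    rw [Finset.disjoint_left]
    intro a ha hb
    simp only [Finset.mem_insert, Finset.mem_singleton, Finset.mem_erase] at ha hb
    have haN : a ∈ N := by rcases ha with rfl | rfl <;> assumption
    rcases hb with h | h | h | h
    · exact huN (h ▸ haN)
    · exact hzN (h ▸ haN)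
    · exact hzN' (h ▸ haN)
    · rcases ha with h' | h'
      · exact h.1 h'
      · exact h.2.1 h') (by
    intro d hd
    simp only [Finset.mem_insert, Finset.mem_erase] at hd
    rcases hd with rfl | rfl | rfl | ⟨h1, h2, h3⟩
    · exact ⟨w, by simp, ((hN w).mp hw).symm⟩
    · exact ⟨w, by simp, hwz⟩
    · exact ⟨w', by simp, hwz'⟩
    · by_cases h : G.Adj w d
      · exact ⟨w, by simp, h⟩
      · exact ⟨w', by simp, hc d h3 h2 h1 h⟩)
  rw [Finset.card_insert_of_notMem (by simp [huN, hzu.symm, hzu'.symm]),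
    Finset.card_insert_of_notMem (by simp [hzN, hzz]),
    Finset.card_insert_of_notMem (by simp [hzN']),
    Finset.card_erase_of_mem (by simp [hw', hww.ne']), Finset.card_erase_of_mem hw] at this
  have : 1 < N.card := Finset.one_lt_card.mpr ⟨w, hw, w', hw', hww.ne⟩
  omega

end comb

section P3
variable {V : Type} [Fintype V] [DecidableEq V]

open Classical in
structure Ctx (G : SimpleGraph V) (t : ℕ) (u : V) (N : Finset V) (x : V → ℝ) (ρ : ℝ) : Prop where
  hF : FreeD G t
  hN : ∀ w, w ∈ N ↔ G.Adj u w
  hNc : N.card + 1 = t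
  pos : ∀ i, 0 < x i
  eig : ∀ i, ∑ j, (if G.Adj i j then x j else 0) = ρ * x i
  xu : x u = 1
  le1 : ∀ i, x i ≤ 1

/-- the non-edge relation inside N -/
def Fe (G : SimpleGraph V) (N : Finset V) (a b : V) : Prop :=
  a ∈ N ∧ b ∈ N ∧ b ≠ a ∧ ¬ G.Adj a b

lemma Fe.symm {G : SimpleGraph V} {N : Finset V} {a b : V} (h : Fe G N a b) : Fe G N b a :=
  ⟨h.2.1, h.1, h.2.2.1.symm, fun h' => h.2.2.2 h'.symm⟩

open Classical in
/-- weight of outside neighbours -/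
noncomputable def rn (G : SimpleGraph V) (u : V) (N : Finset V) (x : V → ℝ) (w : V) : ℝ :=
  ∑ z ∈ Finset.univ.filter (fun z => z ≠ u ∧ z ∉ N ∧ G.Adj w z), x z

variable {G : SimpleGraph V} {t : ℕ} {u : V} {N : Finset V} {x : V → ℝ} {ρ : ℝ}

lemma Ctx.sumN (h : Ctx G t u N x ρ) : ∑ w ∈ N, x w = ρ := by
  classical
  have := h.eig u
  rw [h.xu, mul_one, ← Finset.sum_filter] at this
  rw [← this]
  congr 1
  ext w
  simp [h.hN]

lemma Ctx.u_not (h : Ctx G t u N x ρ) : u ∉ N := by simp [h.hN]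

open Classical in
lemma Ctx.T_eq (h : Ctx G t u N x ρ) {w : V} (hw : w ∈ N) :
    (ρ + 1) * (1 - x w) = ∑ w' ∈ N.filter (fun w' => w' ≠ w ∧ ¬ G.Adj w w'), x w' - rn G u N x w := by
  have e := h.eig w
  have hu := h.u_not
  have huw : G.Adj w u := ((h.hN w).mp hw).symm
  rw [← Finset.sum_filter] at e
  have e2 : Finset.univ.filter (fun j => G.Adj w j) =
      insert u (N.filter (fun j => G.Adj w j) ∪ Finset.univ.filter (fun z => z ≠ u ∧ z ∉ N ∧ G.Adj w z)) := by
    ext j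
    simp only [Finset.mem_filter, Finset.mem_univ, true_and, Finset.mem_insert, Finset.mem_union]
    by_cases hj : j = u
    · subst hj; simp [huw]
    · by_cases hjN : j ∈ N <;> simp [hj, hjN]
  rw [e2, Finset.sum_insert (by simp [hu]), Finset.sum_union (by
    rw [Finset.disjoint_left]; intro a ha hb
    simp only [Finset.mem_filter] at ha hb
    exact hb.2.2.1 ha.1), h.xu] at e
  have e3 := h.sumN
  rw [← Finset.sum_filter_add_sum_filter_not N (fun j => G.Adj w j)] at e3
  have e4 : N.filter (fun j => ¬ G.Adj w j) = insert w (N.filter (fun w' => w' ≠ w ∧ ¬ G.Adj w w')) := by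
    ext j
    simp only [Finset.mem_filter, Finset.mem_insert]
    by_cases hj : j = w
    · subst hj; simp [hw]
    · simp [hj]
  rw [e4, Finset.sum_insert (by simp)] at e3
  unfold rn
  linarith

lemma Ctx.rn_nonneg (h : Ctx G t u N x ρ) (w : V) : 0 ≤ rn G u N x w :=
  Finset.sum_nonneg fun z _ => (h.pos z).le

lemma Ctx.rn_eq (h : Ctx G t u N x ρ) {w z : V} (hw : w ∈ N) (hzu : z ≠ u) (hz : z ∉ N)
    (hwz : G.Adj w z) : rn G u N x w = x z := by
  classical
  unfold rn
  rw [show Finset.univ.filter (fun z => z ≠ u ∧ z ∉ N ∧ G.Adj w z) = {z} from ?_]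
  · simp
  ext y
  simp only [Finset.mem_filter, Finset.mem_univ, true_and, Finset.mem_singleton]
  constructor
  · rintro ⟨h1, h2, h3⟩
    exact claim_one h.hF h.hN h.hNc hw h1 hzu h2 hz h3 hwz
  · rintro rfl; exact ⟨hzu, hz, hwz⟩

lemma rn_pos_ex {w : V} (hr : 0 < rn G u N x w) : ∃ z, z ≠ u ∧ z ∉ N ∧ G.Adj w z := by
  classical
  by_contra hc
  push Not at hc
  have : rn G u N x w = 0 := by
    unfold rn
    apply Finset.sum_eq_zero
    intro z hz
    simp only [Finset.mem_filter, Finset.mem_univ, true_and] at hz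
    exact absurd hz.2.2 (hc z hz.1 hz.2.1)
  linarith

lemma Ctx.rn_le (h : Ctx G t u N x ρ) {w : V} (hw : w ∈ N) : rn G u N x w ≤ 1 := by
  by_cases hr : 0 < rn G u N x w
  · obtain ⟨z, h1, h2, h3⟩ := rn_pos_ex hr
    rw [h.rn_eq hw h1 h2 h3]; exact h.le1 z
  · linarith

lemma Ctx.defect (h : Ctx G t u N x ρ) {S : Finset V} (hS : S ⊆ N) :
    ∑ w ∈ S, (1 - x w) ≤ t - 1 - ρ := by
  have h1 : ∑ w ∈ S, (1 - x w) ≤ ∑ w ∈ N, (1 - x w) :=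
    Finset.sum_le_sum_of_subset_of_nonneg hS fun i _ _ => by linarith [h.le1 i]
  refine h1.trans ?_
  rw [Finset.sum_sub_distrib, h.sumN]
  have : (N.card : ℝ) + 1 = t := by exact_mod_cast h.hNc
  simp only [Finset.sum_const, nsmul_eq_mul, mul_one]
  linarith

lemma Ctx.T_ge (h : Ctx G t u N x ρ) {w : V} (hw : w ∈ N) {D : Finset V} (hD : ∀ d ∈ D, Fe G N w d) :
    ∑ d ∈ D, x d ≤ (ρ + 1) * (1 - x w) + rn G u N x w := by
  classical
  rw [h.T_eq hw]
  have : ∑ d ∈ D, x d ≤ ∑ w' ∈ N.filter (fun w' => w' ≠ w ∧ ¬ G.Adj w w'), x w' := by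
    apply Finset.sum_le_sum_of_subset_of_nonneg
    · intro d hd
      have := hD d hd
      simp only [Finset.mem_filter]
      exact this.2
    · intro i _ _; exact (h.pos i).le
  linarith

lemma Ctx.T1 (h : Ctx G t u N x ρ) {w a : V} (ha : Fe G N w a) :
    x a ≤ (ρ + 1) * (1 - x w) + rn G u N x w := by
  simpa using h.T_ge ha.1 (D := {a}) (by simpa using ha)

lemma Ctx.T2 (h : Ctx G t u N x ρ) {w a b : V} (ha : Fe G N w a) (hb : Fe G N w b) (hab : a ≠ b) :
    x a + x b ≤ (ρ + 1) * (1 - x w) + rn G u N x w := by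
  have := h.T_ge ha.1 (D := {a, b}) (by simp [ha, hb])
  rwa [Finset.sum_pair hab] at this

lemma Ctx.d2 (h : Ctx G t u N x ρ) {a b : V} (ha : a ∈ N) (hb : b ∈ N) (hab : a ≠ b) :
    (1 - x a) + (1 - x b) ≤ t - 1 - ρ := by
  have := h.defect (S := {a, b}) (by intro; simp; rintro (rfl|rfl) <;> assumption)
  rwa [Finset.sum_pair hab] at this

lemma Ctx.d1 (h : Ctx G t u N x ρ) {a : V} (ha : a ∈ N) :
    (1 - x a) ≤ t - 1 - ρ := by
  simpa using h.defect (S := {a}) (by simpa using ha)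

lemma Ctx.d3 (h : Ctx G t u N x ρ) {a b c : V} (ha : a ∈ N) (hb : b ∈ N) (hc : c ∈ N) (hab : a ≠ b)
    (hac : a ≠ c) (hbc : b ≠ c) :
    (1 - x a) + ((1 - x b) + (1 - x c)) ≤ t - 1 - ρ := by
  have := h.defect (S := {a, b, c}) (by intro; simp; rintro (rfl|rfl|rfl) <;> assumption)
  rwa [Finset.sum_insert (by simp [hab, hac]), Finset.sum_pair hbc] at this

lemma Ctx.d4 (h : Ctx G t u N x ρ) {a b c d : V} (ha : a ∈ N) (hb : b ∈ N) (hc : c ∈ N) (hd : d ∈ N)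
    (hab : a ≠ b) (hac : a ≠ c) (had : a ≠ d) (hbc : b ≠ c) (hbd : b ≠ d) (hcd : c ≠ d) :
    (1 - x a) + ((1 - x b) + ((1 - x c) + (1 - x d))) ≤ t - 1 - ρ := by
  have := h.defect (S := {a, b, c, d}) (by intro; simp; rintro (rfl|rfl|rfl|rfl) <;> assumption)
  rwa [Finset.sum_insert (by simp [hab, hac, had]), Finset.sum_insert (by simp [hbc, hbd]),
    Finset.sum_pair hcd] at this

/-- (a) -/
lemma Ctx.deg_lt3 (h : Ctx G t u N x ρ) (hρ : 0 < ρ) (h2 : (ρ + 3) * (t - 1 - ρ) < 2)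
    {w a b c : V} (ha : Fe G N w a) (hb : Fe G N w b) (hc : Fe G N w c)
    (hab : a ≠ b) (hac : a ≠ c) (hbc : b ≠ c) : False := by
  have e1 := h.T_ge ha.1 (D := {a, b, c}) (by simp [ha, hb, hc])
  rw [Finset.sum_insert (by simp [hab, hac]), Finset.sum_pair hbc] at e1
  have e2 := h.d3 ha.2.1 hb.2.1 hc.2.1 hab hac hbc
  have e3 := mul_le_mul_of_nonneg_left (h.d1 ha.1) (by linarith : 0 ≤ ρ + 1)
  have e4 := h.rn_le ha.1
  have e5 := h.le1 w
  have e6 := h.d1 ha.1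
  nlinarith

/-- (b) -/
lemma Ctx.deg2_unique (h : Ctx G t u N x ρ) (hρ : 0 < ρ) (h2 : (ρ + 3) * (t - 1 - ρ) < 2)
    {w a b w' a' b' : V} (ha : Fe G N w a) (hb : Fe G N w b) (hab : a ≠ b)
    (ha' : Fe G N w' a') (hb' : Fe G N w' b') (hab' : a' ≠ b') : w = w' := by
  by_contra hne
  have e1 := h.T2 ha hb hab
  have e1' := h.T2 ha' hb' hab'
  have e2 := h.d2 ha.2.1 hb.2.1 hab
  have e2' := h.d2 ha'.2.1 hb'.2.1 hab'
  have e3 := mul_le_mul_of_nonneg_left (h.d2 ha.1 ha'.1 hne) (by linarith : 0 ≤ ρ + 1)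
  have e4 := h.rn_le ha.1
  have e4' := h.rn_le ha'.1
  nlinarith

lemma cut_edge {V : Type} {G : SimpleGraph V} (hc : G.Connected) (S : Set V) {a b : V} (ha : a ∈ S) (hb : b ∉ S) :
    ∃ s ∈ S, ∃ s' ∉ S, G.Adj s s' := by
  obtain ⟨p⟩ := hc.preconnected a b
  obtain ⟨d, hd, h1, h2⟩ := p.exists_boundary_dart S ha hb
  exact ⟨d.fst, h1, d.snd, h2, d.adj⟩

lemma Ctx.other_attached (h : Ctx G t u N x ρ) (hc : G.Connected)
    (hR : ∀ z, ∃ r, r ≠ z ∧ r ≠ u ∧ r ∉ N) {z : V}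
    (hno : ∀ y, y ≠ u → y ∉ N → ¬ G.Adj z y) :
    ∃ w ∈ N, ∃ y, y ≠ u ∧ y ∉ N ∧ y ≠ z ∧ G.Adj w y := by
  obtain ⟨r, hr1, hr2, hr3⟩ := hR z
  obtain ⟨s, hs, s', hs', hadj⟩ := cut_edge hc {v | v = u ∨ v ∈ N ∨ v = z} (a := u) (b := r)
    (by simp) (by simp [hr1, hr2, hr3])
  simp only [Set.mem_setOf_eq, not_or] at hs hs'
  rcases hs with rfl | hs | rfl
  · exact absurd ((h.hN s').mpr hadj) hs'.2.1
  · exact ⟨s, hs, s', hs'.1, hs'.2.1, hs'.2.2, hadj⟩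
  · exact absurd hadj (hno s' hs'.1 hs'.2.1)

lemma Ctx.M_core (h : Ctx G t u N x ρ) (hc : G.Connected)
    (hR : ∀ z, ∃ r, r ≠ z ∧ r ≠ u ∧ r ∉ N) {a b a' : V}
    (hab : Fe G N a b) (ha : ∀ v, Fe G N a v → v = b) (hb : ∀ v, Fe G N b v → v = a)
    (ha'N : a' ∈ N) (ha'a : a' ≠ a) (ha'b : a' ≠ b)
    (ra : 0 < rn G u N x a) (rb : 0 < rn G u N x b) (ra' : 0 < rn G u N x a') : False := by
  obtain ⟨za, za1, za2, za3⟩ := rn_pos_ex ra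
  obtain ⟨zb, zb1, zb2, zb3⟩ := rn_pos_ex rb
  obtain ⟨zc, zc1, zc2, zc3⟩ := rn_pos_ex ra'
  have adja : ∀ v ∈ N, v ≠ a → v ≠ b → G.Adj a v := by
    intro v hv h1 h2
    by_contra hn
    exact h2 (ha v ⟨hab.1, hv, h1, hn⟩)
  have adjb : ∀ v ∈ N, v ≠ a → v ≠ b → G.Adj b v := by
    intro v hv h1 h2
    by_contra hn
    exact h1 (hb v ⟨hab.2.1, hv, h2, hn⟩)
  have key : ∀ w ∈ N, w ≠ a → w ≠ b → ∀ z, z ≠ u → z ∉ N → G.Adj w z → z = za ∧ z = zb := by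
    intro w hw hwa hwb z hz1 hz2 hz3
    constructor
    · by_contra hne
      obtain ⟨v, hv, v1, v2, v3, v4⟩ := claim_B h.hF h.hN h.hNc hw hz1 hz2 hz3 hab.1 za1 za2 za3
        (adja w hw hwa hwb).symm hne
      have := ha v ⟨hab.1, hv, v2, v4⟩
      subst this
      exact v3 (adjb w hw hwa hwb).symm
    · by_contra hne
      obtain ⟨v, hv, v1, v2, v3, v4⟩ := claim_B h.hF h.hN h.hNc hw hz1 hz2 hz3 hab.2.1 zb1 zb2 zb3
        (adjb w hw hwa hwb).symm hne
      have := hb v ⟨hab.2.1, hv, v2, v4⟩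
      subst this
      exact v3 (adja w hw hwa hwb).symm
  obtain ⟨e1, e2⟩ := key a' ha'N ha'a ha'b zc zc1 zc2 zc3
  subst e1
  subst e2
  have hno : ∀ y, y ≠ u → y ∉ N → ¬ G.Adj zc y := by
    intro y hy1 hy2 hy3
    obtain ⟨v, hv, v1, v2, v3⟩ := claim_A h.hF h.hN h.hNc hab.1 za1 za2 za3 hy1 hy2 hy3
    have := ha v ⟨hab.1, hv, v1, v2⟩
    subst this
    exact v3 zb3.symm
  obtain ⟨w, hw, y, y1, y2, y3, y4⟩ := h.other_attached hc hR hno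
  by_cases hwa : w = a
  · subst hwa; exact y3 (claim_one h.hF h.hN h.hNc hw y1 za1 y2 za2 y4 za3)
  by_cases hwb : w = b
  · subst hwb; exact y3 (claim_one h.hF h.hN h.hNc hw y1 za1 y2 za2 y4 zb3)
  exact y3 (key w hw hwa hwb y y1 y2 y4).1

lemma Ctx.M_case (h : Ctx G t u N x ρ) (hρ : 0 < ρ) (h2 : (ρ + 3) * (t - 1 - ρ) < 2) (hc : G.Connected)
    (hR : ∀ z, ∃ r, r ≠ z ∧ r ≠ u ∧ r ∉ N) {a b a' b' : V}
    (hab : Fe G N a b) (hab' : Fe G N a' b') (ha : ∀ v, Fe G N a v → v = b)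
    (hb : ∀ v, Fe G N b v → v = a)
    (ha' : ∀ v, Fe G N a' v → v = b') (hb' : ∀ v, Fe G N b' v → v = a')
    (h1 : a ≠ a') (h2' : a ≠ b') (h3 : b ≠ a') (h4 : b ≠ b') : False := by
  have e1 := h.T1 hab
  have e2 := h.T1 hab.symm
  have e3 := h.T1 hab'
  have e4 := h.T1 hab'.symm
  have e5 := h.d4 hab.1 hab.2.1 hab'.1 hab'.2.1 hab.2.2.1.symm h1 h2' h3 h4 hab'.2.2.1.symm
  have e6 := mul_le_mul_of_nonneg_left e5 (by linarith : 0 ≤ ρ + 1)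
  have r1 := h.rn_le hab.1
  have r2 := h.rn_le hab.2.1
  have r3 := h.rn_le hab'.1
  have r4 := h.rn_le hab'.2.1
  have d1 : 0 ≤ (t:ℝ) - 1 - ρ := by linarith [h.d1 hab.1, h.le1 a]
  have hs : 2 < rn G u N x a + rn G u N x b + rn G u N x a' + rn G u N x b' := by
    nlinarith
  have n1 := h.rn_nonneg a
  have n2 := h.rn_nonneg b
  have n3 := h.rn_nonneg a'
  have n4 := h.rn_nonneg b'
  by_cases c1 : 0 < rn G u N x a
  · by_cases c2 : 0 < rn G u N x b
    · by_cases c3 : 0 < rn G u N x a'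
      · exact h.M_core hc hR hab ha hb hab'.1 h1.symm h3.symm c1 c2 c3
      · exact h.M_core hc hR hab ha hb hab'.2.1 h2'.symm h4.symm c1 c2 (by linarith)
    · exact h.M_core hc hR hab' ha' hb' hab.1 h1 h2' (by linarith) (by linarith) c1
  · exact h.M_core hc hR hab' ha' hb' hab.2.1 h3 h4 (by linarith) (by linarith) (by linarith)

open Classical in
lemma Ctx.nbrs_ge (h : Ctx G t u N x ρ) {z : V} {k : ℕ} (hz : (k : ℝ) < ρ * x z) :
    k < (Finset.univ.filter (fun j => G.Adj z j)).card := by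
  have e := h.eig z
  rw [← Finset.sum_filter] at e
  have : ∑ j ∈ Finset.univ.filter (fun j => G.Adj z j), x j ≤
      ∑ j ∈ Finset.univ.filter (fun j => G.Adj z j), (1:ℝ) := Finset.sum_le_sum fun i _ => h.le1 i
  rw [e] at this
  simp at this
  have h3 := lt_of_lt_of_le hz this
  exact_mod_cast h3

lemma Ctx.P_case (h : Ctx G t u N x ρ) (hρ : 1 < ρ) (h2 : (ρ + 3) * (t - 1 - ρ) < 2)
    (h22 : ρ * ((ρ + 1) * (t - 1 - ρ)) < 2 * ρ - 2) (hc : G.Connected)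
    (hR : ∀ z, ∃ r, r ≠ z ∧ r ≠ u ∧ r ∉ N) {c p q : V}
    (hcp : Fe G N c p) (hcq : Fe G N c q) (hpq : p ≠ q) (fc : ∀ v, Fe G N c v → v = p ∨ v = q)
    (fp : ∀ v, Fe G N p v → v = c) (fq : ∀ v, Fe G N q v → v = c) : False := by
  classical
  have d1 : 0 ≤ (t:ℝ) - 1 - ρ := by linarith [h.d1 hcp.1, h.le1 c]
  have d3 := h.d3 hcp.1 hcp.2.1 hcq.2.1 hcp.2.2.1.symm hcq.2.2.1.symm hpq
  have d3' := mul_le_mul_of_nonneg_left d3 (by linarith : 0 ≤ ρ + 1)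
  have lc := h.le1 c
  have lp := h.le1 p
  have lq := h.le1 q
  have tc := h.T2 hcp hcq hpq
  have tp := h.T1 hcp.symm
  have tq := h.T1 hcq.symm
  have rc := h.rn_le hcp.1
  have rp := h.rn_le hcp.2.1
  have rq := h.rn_le hcq.2.1
  have np := h.rn_nonneg p
  have nq := h.rn_nonneg q
  have hrc : 2 < ρ * rn G u N x c := by
    have e1 : 2 - rn G u N x c ≤ (ρ + 1) * (t - 1 - ρ) := by nlinarith
    nlinarith
  have hp : 0 < rn G u N x p := by
    by_contra hh
    nlinarith
  have hq : 0 < rn G u N x q := by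
    by_contra hh
    nlinarith
  obtain ⟨z, z1, z2, z3⟩ := rn_pos_ex (show 0 < rn G u N x c by nlinarith [h.rn_nonneg c])
  obtain ⟨zp, zp1, zp2, zp3⟩ := rn_pos_ex hp
  obtain ⟨zq, zq1, zq2, zq3⟩ := rn_pos_ex hq
  rw [h.rn_eq hcp.1 z1 z2 z3] at hrc
  have hdeg := h.nbrs_ge (k := 2) (z := z) (by exact_mod_cast hrc)
  have huz : ¬ G.Adj z u := fun hh => z2 ((h.hN z).mpr hh.symm)
  have adjc : ∀ w ∈ N, w ≠ c → w ≠ p → w ≠ q → G.Adj w c := by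
    intro w hw h1 h2 h3
    by_contra hn
    rcases fc w ⟨hcp.1, hw, h1, fun hh => hn hh.symm⟩ with hh | hh
    · exact h2 hh
    · exact h3 hh
  have keyq : ∀ q zq, q ∈ N → Fe G N c q → (∀ v, Fe G N q v → v = c) → zq ≠ u → zq ∉ N → G.Adj q zq →
      ∀ w ∈ N, w ≠ c → w ≠ p → w ≠ q → w ≠ q → (∀ v, Fe G N c v → v = p ∨ v = q ∨ v ≠ w) → ∀ zw, zw ≠ u → zw ∉ N → G.Adj w zw → zw = zq := by
    intro q zq hqN hcq fq zq1 zq2 zq3 w hw w1 w2 w3 _ w4 zw zw1 zw2 zw3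
    by_contra hne
    have hwq : G.Adj w q := by
      by_contra hn
      exact w1 (fq w ⟨hqN, hw, w3, fun hh => hn hh.symm⟩)
    obtain ⟨v, hv, v1, v2, v3, v4⟩ := claim_B h.hF h.hN h.hNc hw zw1 zw2 zw3 hqN zq1 zq2 zq3 hwq hne
    have := fq v ⟨hqN, hv, v2, v4⟩
    subst this
    rcases w4 w ⟨hv, hw, w1, fun hh => v3 hh.symm⟩ with hh | hh | hh
    · exact w2 hh
    · exact w3 hh
    · exact hh rfl
  have key : ∀ w ∈ N, w ≠ c → w ≠ p → w ≠ q → ∀ zw, zw ≠ u → zw ∉ N → G.Adj w zw → zw = zp ∧ zw = zq := by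
    intro w hw w1 w2 w3 zw zw1 zw2 zw3
    have w4 : ∀ v, Fe G N c v → v ≠ w := by
      intro v hv hvw
      subst hvw
      rcases fc v hv with hh | hh
      · exact w2 hh
      · exact w3 hh
    exact ⟨keyq p zp hcp.2.1 hcp fp zp1 zp2 zp3 w hw w1 w2 w2 w2 (fun v hv => Or.inr (Or.inr (w4 v hv))) zw zw1 zw2 zw3,
      keyq q zq hcq.2.1 hcq fq zq1 zq2 zq3 w hw w1 w2 w3 w3 (fun v hv => Or.inr (Or.inr (w4 v hv))) zw zw1 zw2 zw3⟩
  by_cases hy : ∃ y, y ≠ u ∧ y ∉ N ∧ G.Adj z y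
  · obtain ⟨y, y1, y2, y3⟩ := hy
    have hpz : ¬ G.Adj p z := by
      intro hh
      obtain ⟨v, hv, v1, v2, v3⟩ := claim_A h.hF h.hN h.hNc hcp.2.1 z1 z2 hh y1 y2 y3
      have := fp v ⟨hcp.2.1, hv, v1, v2⟩
      subst this
      exact v3 z3.symm
    have hqz : ¬ G.Adj q z := by
      intro hh
      obtain ⟨v, hv, v1, v2, v3⟩ := claim_A h.hF h.hN h.hNc hcq.2.1 z1 z2 hh y1 y2 y3
      have := fq v ⟨hcq.2.1, hv, v1, v2⟩
      subst this
      exact v3 z3.symm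
    have : (Finset.univ.filter (fun j => G.Adj z j)) ⊆ {c, y} := by
      intro j hj
      simp only [Finset.mem_filter, Finset.mem_univ, true_and] at hj
      simp only [Finset.mem_insert, Finset.mem_singleton]
      by_contra hn
      push Not at hn
      have hju : j ≠ u := by rintro rfl; exact huz hj
      by_cases hjN : j ∈ N
      · have jp : j ≠ p := by rintro rfl; exact hpz hj.symm
        have jq : j ≠ q := by rintro rfl; exact hqz hj.symm
        have := (key j hjN hn.1 jp jq z z1 z2 hj.symm).1
        subst this
        exact hpz zp3
      · exact hn.2 (claim_r h.hF h.hN h.hNc hcp.1 z1 z2 z3 hju y1 hjN y2 hj y3)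
    have := (Finset.card_le_card this).trans Finset.card_le_two
    omega
  · push Not at hy
    obtain ⟨w, hw, y, y1, y2, y3, y4⟩ := h.other_attached hc hR hy
    have main : ∀ v, v ∈ N → v ≠ c → v ≠ p → v ≠ q → ¬ G.Adj v z := by
      intro v v1 v2 v3 v4 hvz
      obtain ⟨k1, k2⟩ := key v v1 v2 v3 v4 z z1 z2 hvz
      by_cases hwc : w = c
      · subst hwc; exact y3 (claim_one h.hF h.hN h.hNc hw y1 z1 y2 z2 y4 z3)
      by_cases hwp : w = p
      · subst hwp; exact y3 (k1 ▸ claim_one h.hF h.hN h.hNc hw y1 zp1 y2 zp2 y4 zp3)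
      by_cases hwq : w = q
      · subst hwq; exact y3 (k2 ▸ claim_one h.hF h.hN h.hNc hw y1 zq1 y2 zq2 y4 zq3)
      have := (key w hw hwc hwp hwq y y1 y2 y4).1
      exact y3 (this.trans k1.symm)
    have hnot : ¬ G.Adj p z ∨ ¬ G.Adj q z := by
      by_contra hh
      push Not at hh
      have ep := claim_one h.hF h.hN h.hNc hcp.2.1 zp1 z1 zp2 z2 zp3 hh.1
      by_cases hwc : w = c
      · subst hwc; exact y3 (claim_one h.hF h.hN h.hNc hw y1 z1 y2 z2 y4 z3)
      by_cases hwp : w = p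
      · subst hwp; exact y3 (claim_one h.hF h.hN h.hNc hw y1 z1 y2 z2 y4 hh.1)
      by_cases hwq : w = q
      · subst hwq; exact y3 (claim_one h.hF h.hN h.hNc hw y1 z1 y2 z2 y4 hh.2)
      exact y3 ((key w hw hwc hwp hwq y y1 y2 y4).1.trans ep)
    have hsub : ∃ p', (Finset.univ.filter (fun j => G.Adj z j)) ⊆ {c, p'} := by
      rcases hnot with hp' | hq'
      · refine ⟨q, fun j hj => ?_⟩
        simp only [Finset.mem_filter, Finset.mem_univ, true_and] at hj
        simp only [Finset.mem_insert, Finset.mem_singleton]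
        by_contra hn
        push Not at hn
        have hju : j ≠ u := by rintro rfl; exact huz hj
        by_cases hjN : j ∈ N
        · exact main j hjN hn.1 (by rintro rfl; exact hp' hj.symm) hn.2 hj.symm
        · exact hy j hju hjN hj
      · refine ⟨p, fun j hj => ?_⟩
        simp only [Finset.mem_filter, Finset.mem_univ, true_and] at hj
        simp only [Finset.mem_insert, Finset.mem_singleton]
        by_contra hn
        push Not at hn
        have hju : j ≠ u := by rintro rfl; exact huz hj
        by_cases hjN : j ∈ N
        · exact main j hjN hn.1 hn.2 (by rintro rfl; exact hq' hj.symm) hj.symm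
        · exact hy j hju hjN hj
    obtain ⟨p', hp'⟩ := hsub
    have := (Finset.card_le_card hp').trans Finset.card_le_two
    omega

lemma Ctx.F_le_one (h : Ctx G t u N x ρ) (hρ : 1 < ρ) (h2 : (ρ + 3) * (t - 1 - ρ) < 2)
    (h22 : ρ * ((ρ + 1) * (t - 1 - ρ)) < 2 * ρ - 2) (hc : G.Connected)
    (hR : ∀ z, ∃ r, r ≠ z ∧ r ≠ u ∧ r ∉ N) {a b a' b' : V}
    (hab : Fe G N a b) (hab' : Fe G N a' b') : (a' = a ∧ b' = b) ∨ (a' = b ∧ b' = a) := by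
  have hρ0 : 0 < ρ := by linarith
  have nodeg2 : ∀ c p q, Fe G N c p → Fe G N c q → p = q := by
    intro c p q hp hq
    by_contra hpq
    refine h.P_case hρ h2 h22 hc hR hp hq hpq ?_ ?_ ?_
    · intro v hv
      by_contra hn
      push Not at hn
      exact h.deg_lt3 hρ0 h2 hp hq hv hpq hn.1.symm hn.2.symm
    · intro v hv
      by_contra hn
      exact hp.2.2.1 (h.deg2_unique hρ0 h2 hv hp.symm hn hp hq hpq)
    · intro v hv
      by_contra hn
      exact hq.2.2.1 (h.deg2_unique hρ0 h2 hv hq.symm hn hp hq hpq)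
  by_cases h1 : a' = a
  · subst h1; exact Or.inl ⟨rfl, nodeg2 _ _ _ hab' hab⟩
  by_cases h3 : a' = b
  · subst h3; exact Or.inr ⟨rfl, nodeg2 _ _ _ hab' hab.symm⟩
  exfalso
  have h4 : b' ≠ a := by
    rintro rfl; exact h3 (nodeg2 _ _ _ hab'.symm hab)
  have h5 : b' ≠ b := by
    rintro rfl; exact h1 (nodeg2 _ _ _ hab'.symm hab.symm)
  exact h.M_case hρ0 h2 hc hR hab hab' (fun v hv => nodeg2 _ _ _ hv hab) (fun v hv => nodeg2 _ _ _ hv hab.symm)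
    (fun v hv => nodeg2 _ _ _ hv hab') (fun v hv => nodeg2 _ _ _ hv hab'.symm)
    (Ne.symm h1) (Ne.symm h4) (Ne.symm h3) (Ne.symm h5)
end P3

section P4
variable {V : Type} [Fintype V] [DecidableEq V]
variable {G : SimpleGraph V} {t : ℕ} {u : V} {N : Finset V}

structure IsChainF (G : SimpleGraph V) (u : V) (N : Finset V) (w : V) (f : ℕ → V) (j : ℕ) : Prop where
  nu : ∀ i < j, f i ≠ u
  nN : ∀ i < j, f i ∉ N
  inj : ∀ i < j, ∀ l < j, f i = f l → i = l
  zero : 0 < j → G.Adj w (f 0)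
  step : ∀ i, i + 1 < j → G.Adj (f i) (f (i + 1))

lemma IsChainF.le_card {w : V} {f : ℕ → V} {j : ℕ} (h : IsChainF G u N w f j) : j ≤ Fintype.card V := by
  have : ((Finset.range j).image f).card = j := by
    rw [Finset.card_image_of_injOn]
    · simp
    · intro a ha b hb hab
      exact h.inj a (by simpa using ha) b (by simpa using hb) hab
  rw [← this]
  exact Finset.card_le_univ _

lemma IsChainF.conn {w : V} {f : ℕ → V} {j : ℕ} (h : IsChainF G u N w f j) (hw : G.Adj u w) :
    ∀ i ≤ j, (G.induce (((({w, u} : Finset V) ∪ (Finset.range i).image f) : Finset V) : Set V)).Connected := by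
  intro i
  induction i with
  | zero =>
    intro _
    have := conn_insert G (conn_singleton G u) (x := w) (y := u) (by simp) hw
    rw [Finset.range_zero, Finset.image_empty, Finset.union_empty]
    exact this
  | succ i ih =>
    intro hi
    have h1 := ih (by omega)
    have h2 : ({w, u} : Finset V) ∪ (Finset.range (i+1)).image f =
        insert (f i) (({w, u} : Finset V) ∪ (Finset.range i).image f) := by
      ext a
      simp only [Finset.mem_union, Finset.mem_insert, Finset.mem_singleton, Finset.mem_image, Finset.mem_range]
      constructor
      · rintro (h | ⟨l, hl, rfl⟩)
        · tauto
        · by_cases hli : l = i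
          · subst hli; tauto
          · exact Or.inr (Or.inr ⟨l, by omega, rfl⟩)
      · rintro (rfl | h | ⟨l, hl, rfl⟩)
        · exact Or.inr ⟨i, by omega, rfl⟩
        · tauto
        · exact Or.inr ⟨l, by omega, rfl⟩
    rw [h2]
    cases i with
    | zero => exact conn_insert G h1 (y := w) (by simp) (h.zero (by omega))
    | succ i =>
      exact conn_insert G h1 (y := f i) (by
        simp only [Finset.mem_union, Finset.mem_image, Finset.mem_range]
        exact Or.inr ⟨i, by omega, rfl⟩) (h.step i (by omega))

lemma chain_exists (hF : FreeD G t) (hN : ∀ w, w ∈ N ↔ G.Adj u w) (hNc : N.card + 1 = t)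
    {w : V} (hw : w ∈ N) : ∃ f j, IsChainF G u N w f j ∧
      (∀ y, y ≠ u → y ∉ N → G.Adj w y → 0 < j ∧ y = f 0) ∧
      (∀ y, y ≠ u → y ∉ N → ∀ i < j, G.Adj (f i) y → ∃ l < j, y = f l ∧ (l = i + 1 ∨ i = l + 1)) := by
  classical
  let P : ℕ → Prop := fun j => ∃ f, IsChainF G u N w f j
  have P0 : P 0 := ⟨fun _ => u, by constructor <;> simp⟩
  obtain ⟨f, hf⟩ : P (Nat.findGreatest P (Fintype.card V)) :=
    Nat.findGreatest_spec (P := P) (Nat.zero_le _) P0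
  have hmax : ∀ j, P j → j ≤ Nat.findGreatest P (Fintype.card V) := by
    intro j hj
    obtain ⟨g, hg⟩ := hj
    exact Nat.le_findGreatest hg.le_card ⟨g, hg⟩
  set j := Nat.findGreatest P (Fintype.card V) with hj
  have huN : u ∉ N := by simp [hN]
  have hw0 : ∀ y, y ≠ u → y ∉ N → G.Adj w y → 0 < j ∧ y = f 0 := by
    intro y y1 y2 y3
    have hj0 : 0 < j := by
      have := hmax 1 ⟨fun _ => y, by
        constructor
        · intro _ _; exact y1
        · intro _ _; exact y2
        · intro a ha b hb _; omega
        · intro _; exact y3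
        · intro i hi; omega⟩
      omega
    exact ⟨hj0, claim_one hF hN hNc hw y1 (hf.nu 0 hj0) y2 (hf.nN 0 hj0) y3 (hf.zero hj0)⟩
  have fwd : ∀ i < j, ∀ y, y ≠ u → y ∉ N → G.Adj (f i) y → (∀ l ≤ i, y ≠ f l) → i + 1 < j ∧ y = f (i+1) := by
    intro i hi y y1 y2 y3 y4
    by_cases hij : i + 1 < j
    · refine ⟨hij, ?_⟩
      refine fact_LF hF hN hNc (I := ({w, u} : Finset V) ∪ (Finset.range (i+1)).image f) (w := w)
        (hf.conn ((hN w).mp hw) (i+1) (by omega)) (by simp) hw (by simp) ?_ ?_ ?_ y2 (hf.nN _ hij) ?_ ?_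
      · intro v hv hvN
        simp only [Finset.mem_union, Finset.mem_insert, Finset.mem_singleton, Finset.mem_image, Finset.mem_range] at hv
        rcases hv with (rfl | rfl) | ⟨l, hl, rfl⟩
        · rfl
        · exact absurd hvN huN
        · exact absurd hvN (hf.nN l (by omega))
      · simp only [Finset.mem_union, Finset.mem_insert, Finset.mem_singleton, Finset.mem_image, Finset.mem_range]
        rintro ((rfl | rfl) | ⟨l, hl, rfl⟩)
        · exact y2 hw
        · exact y1 rfl
        · exact y4 l (by omega) rfl
      · simp only [Finset.mem_union, Finset.mem_insert, Finset.mem_singleton, Finset.mem_image, Finset.mem_range]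
        rintro ((h | h) | ⟨l, hl, h⟩)
        · exact hf.nN _ hij (h ▸ hw)
        · exact hf.nu _ hij h
        · have := hf.inj l (by omega) _ hij h
          omega
      · exact ⟨f i, by simp only [Finset.mem_union, Finset.mem_image, Finset.mem_range]; exact Or.inr ⟨i, by omega, rfl⟩, y3⟩
      · exact ⟨f i, by simp only [Finset.mem_union, Finset.mem_image, Finset.mem_range]; exact Or.inr ⟨i, by omega, rfl⟩, hf.step i hij⟩
    · exfalso
      have hji : j = i + 1 := by omega
      have := hmax (j+1) ⟨fun l => if l < j then f l else y, by
        constructor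
        · intro l hl
          by_cases h : l < j
          · simp [h, hf.nu]
          · simpa [h] using y1
        · intro l hl
          by_cases h : l < j
          · simp [h, hf.nN]
          · simpa [h] using y2
        · intro a ha b hb hab
          by_cases h : a < j <;> by_cases h' : b < j <;> simp [h, h'] at hab
          · exact hf.inj a h b h' hab
          · exact absurd hab.symm (y4 a (by omega))
          · exact absurd hab (y4 b (by omega))
          · omega
        · intro _
          have : 0 < j := by omega
          simp only [this, if_true]
          exact hf.zero this
        · intro l hl
          have h : l < j := by omega
          by_cases h' : l + 1 < j
          · simp only [h, h', if_true]; exact hf.step l h'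
          · have : l = i := by omega
            subst this
            simp only [h, h', if_true, if_false]
            exact y3⟩
      omega
  refine ⟨f, j, hf, hw0, ?_⟩
  intro y y1 y2 i hi y3
  by_cases hl : ∃ l ≤ i, y = f l
  · obtain ⟨l, hli, rfl⟩ := hl
    have hne : l ≠ i := by rintro rfl; exact G.irrefl y3
    have := fwd l (by omega) (f i) (hf.nu i hi) (hf.nN i hi) y3.symm (by
      intro m hm h
      have := hf.inj i hi m (by omega) h
      omega)
    have := hf.inj i hi _ this.1 this.2
    exact ⟨l, by omega, rfl, Or.inr this⟩
  · push Not at hl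
    obtain ⟨h1, h2⟩ := fwd i hi y y1 y2 y3 hl
    exact ⟨i+1, h1, h2, Or.inl rfl⟩

/-- ordering of the outside vertices -/
lemma order_exists (hc : G.Connected) (hF : FreeD G t) (hN : ∀ w, w ∈ N ↔ G.Adj u w) (hNc : N.card + 1 = t)
    {w1 w2 : V} (hw : Fe G N w1 w2)
    (hun : ∀ a b, Fe G N a b → (a = w1 ∧ b = w2) ∨ (a = w2 ∧ b = w1)) :
    ∃ g : ℕ → V, ∃ k, (∀ i < k, g i ≠ u ∧ g i ∉ N) ∧ (∀ i < k, ∀ l < k, g i = g l → i = l) ∧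
      (∀ y, y ≠ u → y ∉ N → ∃ i < k, y = g i) ∧
      (∀ y, y ≠ u → y ∉ N → G.Adj w1 y → y = g 0) ∧
      (∀ y, y ≠ u → y ∉ N → G.Adj w2 y → y = g (k-1)) ∧
      (∀ i < k, ∀ l < k, G.Adj (g i) (g l) → l = i + 1 ∨ i = l + 1) := by
  classical
  obtain ⟨f1, j1, c1, c1w, c1c⟩ := chain_exists hF hN hNc hw.1
  obtain ⟨f2, j2, c2, c2w, c2c⟩ := chain_exists hF hN hNc hw.2.1
  have hB : ∀ w ∈ N, ∀ y, y ≠ u → y ∉ N → G.Adj w y → w = w1 ∨ w = w2 := by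
    intro w hwN y y1 y2 y3
    obtain ⟨w', h1, h2, h3⟩ := claim_deg hF hN hNc hwN y1 y2 y3
    rcases hun w w' ⟨hwN, h1, h2, h3⟩ with h | h
    · exact Or.inl h.1
    · exact Or.inr h.1
  by_cases hA : ∃ i < j1, G.Adj w2 (f1 i)
  · obtain ⟨i, hi, hadj⟩ := hA
    have hcov : ∀ y, y ≠ u → y ∉ N → ∃ i < j1, y = f1 i := by
      intro y y1 y2
      by_contra hn
      obtain ⟨s, hs, s', hs', hss⟩ := cut_edge hc {v | v = u ∨ v ∈ N ∨ ∃ i < j1, v = f1 i} (a := u) (b := y)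
        (by simp) (by
          simp only [Set.mem_setOf_eq]
          rintro (h | h | h)
          · exact y1 h
          · exact y2 h
          · exact hn h)
      simp only [Set.mem_setOf_eq, not_or] at hs hs'
      rcases hs with rfl | hs | ⟨l, hl, rfl⟩
      · exact hs'.2.1 ((hN s').mpr hss)
      · rcases hB s hs s' hs'.1 hs'.2.1 hss with rfl | rfl
        · obtain ⟨h1, h2⟩ := c1w s' hs'.1 hs'.2.1 hss
          exact hs'.2.2 ⟨0, h1, h2⟩
        · exact hs'.2.2 ⟨i, hi, claim_one hF hN hNc hs hs'.1 (c1.nu i hi) hs'.2.1 (c1.nN i hi) hss hadj⟩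
      · obtain ⟨m, hm, hm', _⟩ := c1c s' hs'.1 hs'.2.1 l hl hss
        exact hs'.2.2 ⟨m, hm, hm'⟩
    have hlast : i = j1 - 1 := by
      by_contra hne
      have hi1 : i + 1 < j1 := by omega
      cases i with
      | zero =>
        obtain ⟨v, hv, v1, v2, v3⟩ := claim_A hF hN hNc hw.1 (c1.nu 0 hi) (c1.nN 0 hi) (c1.zero hi)
          (c1.nu _ hi1) (c1.nN _ hi1) (c1.step 0 hi1)
        rcases hun w1 v ⟨hw.1, hv, v1, v2⟩ with h | h
        · rw [h.2] at v3; exact v3 hadj.symm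
        · exact v1 h.2
      | succ m =>
        have := claim_r hF hN hNc hw.2.1 (c1.nu _ hi) (c1.nN _ hi) hadj (c1.nu m (by omega)) (c1.nu _ hi1)
          (c1.nN m (by omega)) (c1.nN _ hi1) (c1.step m hi).symm (c1.step _ hi1)
        have := c1.inj _ (by omega) _ hi1 this
        omega
    refine ⟨f1, j1, fun i hi => ⟨c1.nu i hi, c1.nN i hi⟩, c1.inj, hcov, fun y y1 y2 y3 => (c1w y y1 y2 y3).2, ?_, ?_⟩
    · intro y y1 y2 y3
      rw [← hlast]
      exact claim_one hF hN hNc hw.2.1 y1 (c1.nu i hi) y2 (c1.nN i hi) y3 hadj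
    · intro a ha b hb hab
      obtain ⟨l, hl, h1, h2⟩ := c1c (f1 b) (c1.nu b hb) (c1.nN b hb) a ha hab
      rw [c1.inj b hb l hl h1]; exact h2
  · push Not at hA
    have hdis : ∀ l, l < j2 → ∀ i < j1, f2 l ≠ f1 i := by
      intro l
      induction l with
      | zero => intro hl i hi h; exact hA i hi (h ▸ c2.zero hl)
      | succ l ih =>
        intro hl i hi h
        obtain ⟨m, hm, h1, _⟩ := c1c (f2 l) (c2.nu l (by omega)) (c2.nN l (by omega)) i hi
          (h ▸ (c2.step l hl).symm)
        exact ih (by omega) m hm h1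
    have hcov : ∀ y, y ≠ u → y ∉ N → (∃ i < j1, y = f1 i) ∨ (∃ i < j2, y = f2 i) := by
      intro y y1 y2
      by_contra hn
      obtain ⟨s, hs, s', hs', hss⟩ := cut_edge hc
        {v | v = u ∨ v ∈ N ∨ (∃ i < j1, v = f1 i) ∨ (∃ i < j2, v = f2 i)} (a := u) (b := y)
        (by simp) (by
          simp only [Set.mem_setOf_eq]
          rintro (h | h | h)
          · exact y1 h
          · exact y2 h
          · exact hn h)
      simp only [Set.mem_setOf_eq, not_or] at hs hs'
      rcases hs with rfl | hs | ⟨l, hl, rfl⟩ | ⟨l, hl, rfl⟩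
      · exact hs'.2.1 ((hN s').mpr hss)
      · rcases hB s hs s' hs'.1 hs'.2.1 hss with rfl | rfl
        · obtain ⟨h1, h2⟩ := c1w s' hs'.1 hs'.2.1 hss
          exact hs'.2.2.1 ⟨0, h1, h2⟩
        · obtain ⟨h1, h2⟩ := c2w s' hs'.1 hs'.2.1 hss
          exact hs'.2.2.2 ⟨0, h1, h2⟩
      · obtain ⟨m, hm, hm', _⟩ := c1c s' hs'.1 hs'.2.1 l hl hss
        exact hs'.2.2.1 ⟨m, hm, hm'⟩
      · obtain ⟨m, hm, hm', _⟩ := c2c s' hs'.1 hs'.2.1 l hl hss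
        exact hs'.2.2.2 ⟨m, hm, hm'⟩
    have g1 : ∀ i, i < j1 → (fun i => if i < j1 then f1 i else f2 (j1 + j2 - 1 - i)) i = f1 i := by
      intro i hi; simp [hi]
    have g2 : ∀ i, ¬ i < j1 → (fun i => if i < j1 then f1 i else f2 (j1 + j2 - 1 - i)) i = f2 (j1 + j2 - 1 - i) := by
      intro i hi; simp [hi]
    refine ⟨fun i => if i < j1 then f1 i else f2 (j1 + j2 - 1 - i), j1 + j2, ?_, ?_, ?_, ?_, ?_, ?_⟩
    · intro i hi
      by_cases h : i < j1
      · rw [g1 i h]; exact ⟨c1.nu i h, c1.nN i h⟩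
      · rw [g2 i h]; exact ⟨c2.nu _ (by omega), c2.nN _ (by omega)⟩
    · intro i hi l hl hil
      by_cases h : i < j1 <;> by_cases h' : l < j1
      · rw [g1 i h, g1 l h'] at hil; exact c1.inj i h l h' hil
      · rw [g1 i h, g2 l h'] at hil; exact absurd hil.symm (hdis _ (by omega) i h)
      · rw [g2 i h, g1 l h'] at hil; exact absurd hil (hdis _ (by omega) l h')
      · rw [g2 i h, g2 l h'] at hil
        have := c2.inj _ (by omega) _ (by omega) hil
        omega
    · intro y y1 y2
      rcases hcov y y1 y2 with ⟨i, hi, h⟩ | ⟨i, hi, h⟩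
      · exact ⟨i, by omega, by rw [g1 i hi]; exact h⟩
      · refine ⟨j1 + j2 - 1 - i, by omega, ?_⟩
        rw [g2 _ (by omega), h]; congr 1; omega
    · intro y y1 y2 y3
      obtain ⟨h1, h2⟩ := c1w y y1 y2 y3
      rw [g1 0 h1]; exact h2
    · intro y y1 y2 y3
      obtain ⟨h1, h2⟩ := c2w y y1 y2 y3
      rw [g2 _ (by omega), h2]; congr 1; omega
    · intro i hi l hl hil
      by_cases h : i < j1 <;> by_cases h' : l < j1
      · rw [g1 i h, g1 l h'] at hil
        obtain ⟨m, hm, h1, h2⟩ := c1c _ (c1.nu l h') (c1.nN l h') i h hil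
        rw [c1.inj l h' m hm h1]; exact h2
      · rw [g1 i h, g2 l h'] at hil
        obtain ⟨m, hm, h1, h2⟩ := c1c _ (c2.nu _ (by omega)) (c2.nN _ (by omega)) i h hil
        exact absurd h1 (hdis _ (by omega) m hm)
      · rw [g2 i h, g1 l h'] at hil
        obtain ⟨m, hm, h1, h2⟩ := c1c _ (c2.nu _ (by omega)) (c2.nN _ (by omega)) l h' hil.symm
        exact absurd h1 (hdis _ (by omega) m hm)
      · rw [g2 i h, g2 l h'] at hil
        obtain ⟨m, hm, h1, h2⟩ := c2c _ (c2.nu _ (by omega)) (c2.nN _ (by omega)) _ (by omega) hil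
        have := c2.inj _ (by omega) m hm h1
        omega

lemma embed_exists (hc : G.Connected) (hF : FreeD G t) (hN : ∀ w, w ∈ N ↔ G.Adj u w) (hNc : N.card + 1 = t)
    {w1 w2 : V} (hw : Fe G N w1 w2)
    (hun : ∀ a b, Fe G N a b → (a = w1 ∧ b = w2) ∨ (a = w2 ∧ b = w1)) {k : ℕ} (hk : Fintype.card V = t + k) :
    ∃ e : V ≃ Fin t ⊕ Fin k, ∃ a b : Fin t, a ≠ b ∧
      ∀ x y, G.Adj x y → (subdividePath (⊤ : SimpleGraph (Fin t)) a b k).Adj (e x) (e y) := by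
  classical
  obtain ⟨g, k', g1, g2, g3, g4, g5, g6⟩ := order_exists hc hF hN hNc hw hun
  have huN : u ∉ N := by simp [hN]
  have hcard : (insert u N).card = t := by rw [Finset.card_insert_of_notMem huN, hNc]
  have hk' : k' = k := by
    have h1 : (Finset.univ : Finset V) = insert u N ∪ (Finset.range k').image g := by
      ext y
      simp only [Finset.mem_univ, Finset.mem_union, Finset.mem_insert, Finset.mem_image, Finset.mem_range, true_iff]
      by_cases h1 : y = u
      · tauto
      by_cases h2 : y ∈ N
      · tauto
      obtain ⟨i, hi, h⟩ := g3 y h1 h2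
      exact Or.inr ⟨i, hi, h.symm⟩
    have h2 := congrArg Finset.card h1
    rw [Finset.card_union_of_disjoint, hcard, Finset.card_image_of_injOn, Finset.card_univ, hk, Finset.card_range] at h2
    · omega
    · intro a ha b hb hab
      exact g2 a (by simpa using ha) b (by simpa using hb) hab
    · rw [Finset.disjoint_left]
      intro y hy hy'
      simp only [Finset.mem_insert, Finset.mem_image, Finset.mem_range] at hy hy'
      obtain ⟨i, hi, rfl⟩ := hy'
      rcases hy with h | h
      · exact (g1 i hi).1 h
      · exact (g1 i hi).2 h
  subst hk'
  let q := (Finset.equivFinOfCardEq hcard).symm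
  let φ : Fin t ⊕ Fin k' → V := Sum.elim (fun i => (q i).1) (fun i => g i)
  have hqm : ∀ i, (q i).1 = u ∨ (q i).1 ∈ N := fun i => Finset.mem_insert.mp (q i).2
  have hbij : Function.Bijective φ := by
    constructor
    · rintro (a | a) (b | b) hab
      · have : q a = q b := Subtype.ext hab
        rw [q.injective this]
      · exfalso
        have hab : (q a).1 = g b := hab
        rcases hqm a with h | h
        · exact (g1 b b.2).1 (hab ▸ h)
        · exact (g1 b b.2).2 (hab ▸ h)
      · exfalso
        have hab : g a = (q b).1 := hab
        rcases hqm b with h | h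
        · exact (g1 a a.2).1 (hab ▸ h)
        · exact (g1 a a.2).2 (hab ▸ h)
      · have := g2 a a.2 b b.2 hab
        rw [Fin.ext this]
    · intro y
      by_cases h1 : y ∈ insert u N
      · exact ⟨Sum.inl (q.symm ⟨y, h1⟩), by simp [φ]⟩
      · simp only [Finset.mem_insert, not_or] at h1
        obtain ⟨i, hi, h⟩ := g3 y h1.1 h1.2
        exact ⟨Sum.inr ⟨i, hi⟩, h.symm⟩
  have m1 : w1 ∈ insert u N := Finset.mem_insert_of_mem hw.1
  have m2 : w2 ∈ insert u N := Finset.mem_insert_of_mem hw.2.1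
  have qinj : ∀ i j, (q i).1 = (q j).1 → i = j := fun i j h => q.injective (Subtype.ext h)
  refine ⟨(Equiv.ofBijective φ hbij).symm, q.symm ⟨w1, m1⟩, q.symm ⟨w2, m2⟩, ?_, ?_⟩
  · intro h
    have := q.symm.injective h
    exact hw.2.2.1 (Subtype.ext_iff.mp this).symm
  · suffices hs : ∀ a b, G.Adj (φ a) (φ b) → (subdividePath (⊤ : SimpleGraph (Fin t)) (q.symm ⟨w1, m1⟩) (q.symm ⟨w2, m2⟩) k').Adj a b by
      intro x y hxy
      apply hs
      rw [show φ ((Equiv.ofBijective φ hbij).symm x) = x from (Equiv.ofBijective φ hbij).apply_symm_apply x,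
        show φ ((Equiv.ofBijective φ hbij).symm y) = y from (Equiv.ofBijective φ hbij).apply_symm_apply y]
      exact hxy
    have mixed : ∀ (a : Fin t) (b : Fin k'), G.Adj (φ (Sum.inl a)) (φ (Sum.inr b)) →
        (a = q.symm ⟨w1, m1⟩ ∧ (b : ℕ) = 0) ∨ (a = q.symm ⟨w2, m2⟩ ∧ (b : ℕ) = k' - 1) := by
      intro a b hab
      have hab : G.Adj (q a).1 (g b) := hab
      have hb := g1 b b.2
      rcases hqm a with h | h
      · rw [h] at hab; exact absurd ((hN _).mpr hab) hb.2
      · obtain ⟨w', h1, h2, h3⟩ := claim_deg hF hN hNc h hb.1 hb.2 hab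
        have hb2 := b.2
        rcases hun _ w' ⟨h, h1, h2, h3⟩ with h4 | h4
        · left
          refine ⟨qinj _ _ (by simpa using h4.1), ?_⟩
          exact g2 b b.2 0 (by omega) (g4 _ hb.1 hb.2 (h4.1 ▸ hab))
        · right
          refine ⟨qinj _ _ (by simpa using h4.1), ?_⟩
          exact g2 b b.2 _ (by omega) (g5 _ hb.1 hb.2 (h4.1 ▸ hab))
    rintro (a | a) (b | b) hab <;> unfold subdividePath <;> rw [SimpleGraph.fromRel_adj]
    · have hne : a ≠ b := by rintro rfl; exact G.irrefl hab
      refine ⟨fun h => hne (Sum.inl_injective h), Or.inl (Or.inl ⟨a, b, rfl, rfl, by simpa using hne, ?_, ?_⟩)⟩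
      · rintro ⟨rfl, rfl⟩
        exact hw.2.2.2 (by simpa [φ] using hab)
      · rintro ⟨rfl, rfl⟩
        exact hw.2.2.2 (by simpa [φ] using hab.symm)
    · refine ⟨by simp, ?_⟩
      rcases mixed a b hab with ⟨rfl, h⟩ | ⟨rfl, h⟩
      · exact Or.inl (Or.inr (Or.inl ⟨b, rfl, rfl, h⟩))
      · exact Or.inr (Or.inr (Or.inr (Or.inr ⟨b, rfl, rfl, h⟩)))
    · refine ⟨by simp, ?_⟩
      rcases mixed b a hab.symm with ⟨rfl, h⟩ | ⟨rfl, h⟩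
      · exact Or.inr (Or.inr (Or.inl ⟨a, rfl, rfl, h⟩))
      · exact Or.inl (Or.inr (Or.inr (Or.inr ⟨a, rfl, rfl, h⟩)))
    · have hne : a ≠ b := by rintro rfl; exact G.irrefl hab
      refine ⟨fun h => hne (Sum.inr_injective h), ?_⟩
      rcases g6 a a.2 b b.2 hab with h | h
      · exact Or.inl (Or.inr (Or.inr (Or.inl ⟨a, b, rfl, rfl, h⟩)))
      · exact Or.inr (Or.inr (Or.inr (Or.inl ⟨b, a, rfl, rfl, h⟩)))
end P4

section P5

lemma cut_ind {V : Type} {G : SimpleGraph V} {I : Set V} (hI : (G.induce I).Connected) (X : V → Prop)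
    {p q : V} (hp : p ∈ I) (hpX : X p) (hq : q ∈ I) (hqX : ¬ X q) :
    ∃ s ∈ I, X s ∧ ∃ s' ∈ I, ¬ X s' ∧ G.Adj s s' := by
  obtain ⟨s, hs, s', hs', h⟩ := cut_edge hI {v | X v.1} (a := ⟨p, hp⟩) (b := ⟨q, hq⟩) hpX hqX
  exact ⟨s.1, s.2, hs, s'.1, s'.2, hs', h⟩

variable {t k : ℕ} {a b : Fin t}

lemma S_ll (i j : Fin t) : (subdividePath (⊤ : SimpleGraph (Fin t)) a b k).Adj (Sum.inl i) (Sum.inl j) ↔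
    i ≠ j ∧ ¬ (i = a ∧ j = b) ∧ ¬ (i = b ∧ j = a) := by
  unfold subdividePath
  simp only [fromRel_adj, Sum.inl.injEq, reduceCtorEq, false_and, and_false, exists_false, or_false, false_or, top_adj, ne_eq]
  constructor
  · rintro ⟨h, ⟨x, y, rfl, rfl, h1, h2, h3⟩ | ⟨x, y, rfl, rfl, h1, h2, h3⟩⟩
    · exact ⟨h, h2, h3⟩
    · exact ⟨h, fun hh => h3 ⟨hh.2, hh.1⟩, fun hh => h2 ⟨hh.2, hh.1⟩⟩
  · rintro ⟨h1, h2, h3⟩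
    exact ⟨h1, Or.inl ⟨i, j, rfl, rfl, h1, h2, h3⟩⟩

lemma S_lr (i : Fin t) (j : Fin k) : (subdividePath (⊤ : SimpleGraph (Fin t)) a b k).Adj (Sum.inl i) (Sum.inr j) ↔
    (i = a ∧ (j : ℕ) = 0) ∨ (i = b ∧ (j : ℕ) + 1 = k) := by
  have := j.2
  unfold subdividePath
  simp only [fromRel_adj, Sum.inl.injEq, Sum.inr.injEq, reduceCtorEq, false_and, and_false, exists_false, or_false, false_or, ne_eq, not_false_eq_true, true_and]
  constructor
  · rintro (⟨x, rfl, rfl, h⟩ | ⟨x, rfl, rfl, h⟩)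
    · exact Or.inl ⟨rfl, h⟩
    · exact Or.inr ⟨rfl, by omega⟩
  · rintro (⟨rfl, h⟩ | ⟨rfl, h⟩)
    · exact Or.inl ⟨j, rfl, rfl, h⟩
    · exact Or.inr ⟨j, rfl, rfl, by omega⟩

lemma S_rr (i j : Fin k) : (subdividePath (⊤ : SimpleGraph (Fin t)) a b k).Adj (Sum.inr i) (Sum.inr j) ↔
    (j : ℕ) = i + 1 ∨ (i : ℕ) = j + 1 := by
  unfold subdividePath
  simp only [fromRel_adj, Sum.inr.injEq, reduceCtorEq, false_and, and_false, exists_false, or_false, false_or, ne_eq]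
  constructor
  · rintro ⟨h, ⟨x, y, rfl, rfl, h⟩ | ⟨x, y, rfl, rfl, h⟩⟩
    · exact Or.inl h
    · exact Or.inr h
  · rintro (h | h)
    · exact ⟨by rintro rfl; omega, Or.inl ⟨i, j, rfl, rfl, h⟩⟩
    · exact ⟨by rintro rfl; omega, Or.inr ⟨j, i, rfl, rfl, h⟩⟩

lemma S_rl (i : Fin t) (j : Fin k) : (subdividePath (⊤ : SimpleGraph (Fin t)) a b k).Adj (Sum.inr j) (Sum.inl i) ↔
    (i = a ∧ (j : ℕ) = 0) ∨ (i = b ∧ (j : ℕ) + 1 = k) := by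
  rw [SimpleGraph.adj_comm, S_lr]

lemma S_connected (ht : 3 ≤ t) (hab : a ≠ b) : (subdividePath (⊤ : SimpleGraph (Fin t)) a b k).Connected := by
  obtain ⟨c, hc⟩ : ∃ c : Fin t, c ∉ ({a, b} : Finset (Fin t)) := by
    apply Finset.exists_mem_notMem_of_card_lt_card (s := {a, b}) (t := Finset.univ) ?_ |>.imp
    · intro x hx; exact hx.2
    · have := Finset.card_le_two (a := a) (b := b)
      simp; omega
  simp at hc
  have hl : ∀ i : Fin t, (subdividePath (⊤ : SimpleGraph (Fin t)) a b k).Reachable (Sum.inl i) (Sum.inl c) := by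
    intro i
    by_cases hi : i = c
    · subst hi; exact Reachable.refl _
    · apply Adj.reachable
      rw [S_ll]; exact ⟨hi, fun h => hc.2 h.2, fun h => hc.1 h.2⟩
  have hr : ∀ m : ℕ, ∀ hm : m < k, (subdividePath (⊤ : SimpleGraph (Fin t)) a b k).Reachable (Sum.inr ⟨m, hm⟩) (Sum.inl c) := by
    intro m
    induction m with
    | zero =>
      intro hm
      refine Reachable.trans (Adj.reachable ?_) (hl a)
      rw [S_rl]; exact Or.inl ⟨rfl, rfl⟩
    | succ m ih =>
      intro hm
      refine Reachable.trans (Adj.reachable ?_) (ih (by omega))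
      rw [S_rr]; exact Or.inr rfl
  have hall : ∀ v, (subdividePath (⊤ : SimpleGraph (Fin t)) a b k).Reachable v (Sum.inl c) := by
    rintro (i | i)
    · exact hl i
    · exact hr i i.2
  rw [connected_iff]
  exact ⟨fun x y => (hall x).trans (hall y).symm, ⟨Sum.inl c⟩⟩

section free
variable {I : Set (Fin t ⊕ Fin k)}

lemma S_left (hI : ((subdividePath (⊤ : SimpleGraph (Fin t)) a b k).induce I).Connected)
    {c : Fin t} (hc : Sum.inl c ∈ I) {d j : Fin k} (hd : Sum.inr d ∉ I) (hj : Sum.inr j ∈ I)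
    (hjd : j < d) : Sum.inl a ∈ I ∧ ∀ i ≤ j, Sum.inr i ∈ I := by
  have hd2 := d.2
  constructor
  · by_contra ha
    obtain ⟨s, hs, hsX, s', hs', hsX', hadj⟩ := cut_ind hI (fun v => ∃ i : Fin k, v = Sum.inr i ∧ i < d)
      hj ⟨j, rfl, hjd⟩ hc (by rintro ⟨i, h, _⟩; cases h)
    obtain ⟨i, rfl, hi⟩ := hsX
    rcases s' with e | e
    · rw [S_rl] at hadj
      rcases hadj with ⟨rfl, h⟩ | ⟨rfl, h⟩
      · exact ha hs'
      · omega
    · rw [S_rr] at hadj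
      have h1 : ¬ e < d := fun h => hsX' ⟨e, rfl, h⟩
      have h2 : e = d := by omega
      exact hd (h2 ▸ hs')
  · intro m hm
    by_contra hmI
    have hmj : m ≠ j := by rintro rfl; exact hmI hj
    obtain ⟨s, hs, hsX, s', hs', hsX', hadj⟩ := cut_ind hI (fun v => ∃ i : Fin k, v = Sum.inr i ∧ i < d ∧ m < i)
      hj ⟨j, rfl, hjd, by omega⟩ hc (by rintro ⟨i, h, _⟩; cases h)
    obtain ⟨i, rfl, hi, hi'⟩ := hsX
    rcases s' with e | e
    · rw [S_rl] at hadj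
      rcases hadj with ⟨rfl, h⟩ | ⟨rfl, h⟩ <;> omega
    · rw [S_rr] at hadj
      have h1 : ¬ (e < d ∧ m < e) := fun h => hsX' ⟨e, rfl, h⟩
      have h2 : e = d ∨ e = m := by omega
      rcases h2 with rfl | rfl
      · exact hd hs'
      · exact hmI hs'

lemma S_right (hI : ((subdividePath (⊤ : SimpleGraph (Fin t)) a b k).induce I).Connected)
    {c : Fin t} (hc : Sum.inl c ∈ I) {d j : Fin k} (hd : Sum.inr d ∉ I) (hj : Sum.inr j ∈ I)
    (hjd : d < j) : Sum.inl b ∈ I ∧ ∀ i ≥ j, Sum.inr i ∈ I := by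
  have hd2 := d.2
  constructor
  · by_contra ha
    obtain ⟨s, hs, hsX, s', hs', hsX', hadj⟩ := cut_ind hI (fun v => ∃ i : Fin k, v = Sum.inr i ∧ d < i)
      hj ⟨j, rfl, hjd⟩ hc (by rintro ⟨i, h, _⟩; cases h)
    obtain ⟨i, rfl, hi⟩ := hsX
    rcases s' with e | e
    · rw [S_rl] at hadj
      rcases hadj with ⟨rfl, h⟩ | ⟨rfl, h⟩
      · omega
      · exact ha hs'
    · rw [S_rr] at hadj
      have h1 : ¬ d < e := fun h => hsX' ⟨e, rfl, h⟩
      have h2 : e = d := by omega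
      exact hd (h2 ▸ hs')
  · intro m hm
    by_contra hmI
    have hmj : m ≠ j := by rintro rfl; exact hmI hj
    have hm2 := m.2
    obtain ⟨s, hs, hsX, s', hs', hsX', hadj⟩ := cut_ind hI (fun v => ∃ i : Fin k, v = Sum.inr i ∧ d < i ∧ i < m)
      hj ⟨j, rfl, hjd, by omega⟩ hc (by rintro ⟨i, h, _⟩; cases h)
    obtain ⟨i, rfl, hi, hi'⟩ := hsX
    rcases s' with e | e
    · rw [S_rl] at hadj
      rcases hadj with ⟨rfl, h⟩ | ⟨rfl, h⟩ <;> omega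
    · rw [S_rr] at hadj
      have h1 : ¬ (d < e ∧ e < m) := fun h => hsX' ⟨e, rfl, h⟩
      have h2 : e = d ∨ e = m := by omega
      rcases h2 with rfl | rfl
      · exact hd hs'
      · exact hmI hs'

lemma S_interval (hI : ((subdividePath (⊤ : SimpleGraph (Fin t)) a b k).induce I).Connected)
    (hno : ∀ c, Sum.inl c ∉ I) {i l j : Fin k} (hi : Sum.inr i ∈ I) (hj : Sum.inr j ∈ I)
    (h1 : i < l) (h2 : l < j) : Sum.inr l ∈ I := by
  by_contra hl
  obtain ⟨s, hs, hsX, s', hs', hsX', hadj⟩ := cut_ind hI (fun v => ∃ i : Fin k, v = Sum.inr i ∧ i < l)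
    hi ⟨i, rfl, h1⟩ hj (by rintro ⟨i, h, h'⟩; cases h; omega)
  obtain ⟨i, rfl, hi⟩ := hsX
  rcases s' with e | e
  · exact hno e hs'
  · rw [S_rr] at hadj
    have h1 : ¬ e < l := fun h => hsX' ⟨e, rfl, h⟩
    have h2 : e = l := by omega
    exact hl (h2 ▸ hs')

end free

lemma S_free (ht : 3 ≤ t) (hab : a ≠ b) : FreeD (subdividePath (⊤ : SimpleGraph (Fin t)) a b k) t := by
  classical
  intro I D hI hdis hadj
  have hDI : ∀ d ∈ D, d ∉ I := fun d hd hd' => Finset.disjoint_left.mp hdis hd' hd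
  by_cases hcore : ∃ c, Sum.inl c ∈ I
  · obtain ⟨c, hc⟩ := hcore
    have hcardD : D.card = D.toLeft.card + D.toRight.card := by
      rw [← Finset.card_toLeft_add_card_toRight]
    have hK : D.toLeft.card + I.toLeft.card ≤ t := by
      rw [← Finset.card_union_of_disjoint]
      · exact (Finset.card_le_univ _).trans (by simp)
      · rw [Finset.disjoint_left]
        intro x hx hx'
        exact hDI _ (Finset.mem_toLeft.mp hx) (Finset.mem_toLeft.mp hx')
    have hcI : c ∈ I.toLeft := Finset.mem_toLeft.mpr hc
    have hK1 : 1 ≤ I.toLeft.card := Finset.card_pos.mpr ⟨c, hcI⟩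
    let L : Fin k → Prop := fun d => (Sum.inl a ∈ I ∧ (d : ℕ) = 0) ∨ ∃ j : Fin k, Sum.inr j ∈ I ∧ (d : ℕ) = j + 1
    let Rt : Fin k → Prop := fun d => (Sum.inl b ∈ I ∧ (d : ℕ) + 1 = k) ∨ ∃ j : Fin k, Sum.inr j ∈ I ∧ (j : ℕ) = d + 1
    have hLR : ∀ d ∈ D.toRight, L d ∨ Rt d := by
      intro d hd
      obtain ⟨i, hi, hid⟩ := hadj _ (Finset.mem_toRight.mp hd)
      rcases i with i | i
      · rw [S_lr] at hid
        rcases hid with ⟨rfl, h⟩ | ⟨rfl, h⟩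
        · exact Or.inl (Or.inl ⟨hi, h⟩)
        · exact Or.inr (Or.inl ⟨hi, h⟩)
      · rw [S_rr] at hid
        rcases hid with h | h
        · exact Or.inl (Or.inr ⟨i, hi, h⟩)
        · exact Or.inr (Or.inr ⟨i, hi, h⟩)
    have hdI : ∀ d ∈ D.toRight, (Sum.inr d : Fin t ⊕ Fin k) ∉ I := fun d hd => hDI _ (Finset.mem_toRight.mp hd)
    have hLa : ∀ d ∈ D.toRight, L d → Sum.inl a ∈ I := by
      intro d hd hL
      rcases hL with h | ⟨j, hj, h⟩
      · exact h.1
      · exact (S_left hI (Finset.mem_coe.mpr hc) (d := d) (by simpa using hdI d hd) (Finset.mem_coe.mpr hj) (by omega)).1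
    have hRb : ∀ d ∈ D.toRight, Rt d → Sum.inl b ∈ I := by
      intro d hd hL
      rcases hL with h | ⟨j, hj, h⟩
      · exact h.1
      · exact (S_right hI (Finset.mem_coe.mpr hc) (d := d) (by simpa using hdI d hd) (Finset.mem_coe.mpr hj) (by omega)).1
    have hLlt : ∀ d ∈ D.toRight, ∀ d' ∈ D.toRight, L d → L d' → ¬ d < d' := by
      intro d hd d' hd' _ hL' hlt
      rcases hL' with h | ⟨j, hj, h⟩
      · omega
      · exact hdI d hd ((S_left hI (Finset.mem_coe.mpr hc) (d := d') (by simpa using hdI d' hd')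
          (Finset.mem_coe.mpr hj) (by omega)).2 d (by omega))
    have hRlt : ∀ d ∈ D.toRight, ∀ d' ∈ D.toRight, Rt d → Rt d' → ¬ d < d' := by
      intro d hd d' hd' hL _ hlt
      have := d'.2
      rcases hL with h | ⟨j, hj, h⟩
      · omega
      · exact hdI d' hd' ((S_right hI (Finset.mem_coe.mpr hc) (d := d) (by simpa using hdI d hd)
          (Finset.mem_coe.mpr hj) (by omega)).2 d' (by show j ≤ d'; omega))
    have hcL : (D.toRight.filter L).card ≤ 1 := by
      rw [Finset.card_le_one]
      intro x hx y hy
      simp only [Finset.mem_filter] at hx hy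
      have h1 := hLlt x hx.1 y hy.1 hx.2 hy.2
      have h2 := hLlt y hy.1 x hx.1 hy.2 hx.2
      omega
    have hcR : (D.toRight.filter Rt).card ≤ 1 := by
      rw [Finset.card_le_one]
      intro x hx y hy
      simp only [Finset.mem_filter] at hx hy
      have h1 := hRlt x hx.1 y hy.1 hx.2 hy.2
      have h2 := hRlt y hy.1 x hx.1 hy.2 hx.2
      omega
    have hsplit : D.toRight.card ≤ (D.toRight.filter L).card + (D.toRight.filter Rt).card := by
      refine le_trans (Finset.card_le_card ?_) (Finset.card_union_le _ _)
      intro d hd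
      rw [Finset.mem_union, Finset.mem_filter, Finset.mem_filter]
      rcases hLR d hd with h | h
      · exact Or.inl ⟨hd, h⟩
      · exact Or.inr ⟨hd, h⟩
    have hL0 : Sum.inl a ∉ I → (D.toRight.filter L).card = 0 := by
      intro ha
      rw [Finset.card_eq_zero, Finset.filter_eq_empty_iff]
      intro d hd hL
      exact ha (hLa d hd hL)
    have hR0 : Sum.inl b ∉ I → (D.toRight.filter Rt).card = 0 := by
      intro ha
      rw [Finset.card_eq_zero, Finset.filter_eq_empty_iff]
      intro d hd hL
      exact ha (hRb d hd hL)
    by_cases ha : Sum.inl a ∈ I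
    · by_cases hb : Sum.inl b ∈ I
      · by_cases h3 : 3 ≤ I.toLeft.card
        · omega
        · have hsub : ({a, b} : Finset (Fin t)) ⊆ I.toLeft := by
            intro x; simp only [Finset.mem_insert, Finset.mem_singleton]
            rintro (rfl | rfl) <;> exact Finset.mem_toLeft.mpr (by assumption)
          have heq := Finset.eq_of_subset_of_card_le hsub (by rw [Finset.card_pair hab]; omega)
          have hemp : D.toRight = ∅ := by
            rw [Finset.eq_empty_iff_forall_notMem]
            intro d hd
            obtain ⟨s, hs, hsX, s', hs', hsX', hadj⟩ := cut_ind hI (fun v => v = Sum.inl a ∨ ∃ i : Fin k, v = Sum.inr i ∧ i < d)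
              (Finset.mem_coe.mpr ha) (Or.inl rfl) (Finset.mem_coe.mpr hb)
              (by rintro (h | ⟨i, h, _⟩)
                  · exact hab (Sum.inl_injective h).symm
                  · cases h)
            have hd2 := d.2
            rcases s' with e | e
            · have he : e ∈ I.toLeft := Finset.mem_toLeft.mpr hs'
              rw [← heq] at he
              simp only [Finset.mem_insert, Finset.mem_singleton] at he
              rcases he with rfl | rfl
              · exact hsX' (Or.inl rfl)
              · rcases hsX with rfl | ⟨i, rfl, hi⟩
                · rw [S_ll] at hadj; exact hadj.2.1 ⟨rfl, rfl⟩
                · rw [S_rl] at hadj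
                  rcases hadj with h | h
                  · exact hab h.1.symm
                  · omega
            · have h1 : ¬ e < d := fun h => hsX' (Or.inr ⟨e, rfl, h⟩)
              have h2 : e ≠ d := by rintro rfl; exact hdI _ hd hs'
              rcases hsX with rfl | ⟨i, rfl, hi⟩
              · rw [S_lr] at hadj
                rcases hadj with h | h
                · omega
                · exact hab h.1
              · rw [S_rr] at hadj
                omega
          rw [hemp] at hcardD
          rw [← heq, Finset.card_pair hab] at hK
          simp at hcardD
          omega
      · have := hR0 hb
        by_cases h2 : 2 ≤ I.toLeft.card
        · omega
        · have heq : I.toLeft = {a} := by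
            symm
            apply Finset.eq_of_subset_of_card_le
            · simpa using ha
            · simp; omega
          by_cases hbD : Sum.inl b ∈ D
          · obtain ⟨s, hs, hsb⟩ := hadj _ hbD
            have hemp : D.toRight = ∅ := by
              rw [Finset.eq_empty_iff_forall_notMem]
              intro d hd
              rcases s with s | s
              · have hs1 : s ∈ I.toLeft := Finset.mem_toLeft.mpr hs
                rw [heq, Finset.mem_singleton] at hs1
                subst hs1
                rw [S_ll] at hsb
                exact hsb.2.1 ⟨rfl, rfl⟩
              · rw [S_rl] at hsb
                rcases hsb with h | h
                · exact hab h.1.symm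
                · have hd2 := d.2
                  have hds : d ≠ s := by rintro rfl; exact hdI _ hd hs
                  exact hb (S_right hI (Finset.mem_coe.mpr hc) (d := d) (by simpa using hdI d hd)
                    (Finset.mem_coe.mpr hs) (by omega)).1
            rw [hemp] at hcardD
            simp at hcardD
            omega
          · have : D.toLeft.card + ({a, b} : Finset (Fin t)).card ≤ t := by
              rw [← Finset.card_union_of_disjoint]
              · exact (Finset.card_le_univ _).trans (by simp)
              · rw [Finset.disjoint_left]
                intro x hx hx'
                have hx := Finset.mem_toLeft.mp hx
                simp only [Finset.mem_insert, Finset.mem_singleton] at hx'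
                rcases hx' with rfl | rfl
                · exact hDI _ hx ha
                · exact hbD hx
            rw [Finset.card_pair hab] at this
            omega
    · have := hL0 ha
      by_cases hb : Sum.inl b ∈ I
      · by_cases h2 : 2 ≤ I.toLeft.card
        · omega
        · have heq : I.toLeft = {b} := by
            symm
            apply Finset.eq_of_subset_of_card_le
            · simpa using hb
            · simp; omega
          by_cases hbD : Sum.inl a ∈ D
          · obtain ⟨s, hs, hsb⟩ := hadj _ hbD
            have hemp : D.toRight = ∅ := by
              rw [Finset.eq_empty_iff_forall_notMem]
              intro d hd
              rcases s with s | s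
              · have hs1 : s ∈ I.toLeft := Finset.mem_toLeft.mpr hs
                rw [heq, Finset.mem_singleton] at hs1
                subst hs1
                rw [S_ll] at hsb
                exact hsb.2.2 ⟨rfl, rfl⟩
              · rw [S_rl] at hsb
                rcases hsb with h | h
                · have hd2 := d.2
                  have hds : d ≠ s := by rintro rfl; exact hdI _ hd hs
                  exact ha (S_left hI (Finset.mem_coe.mpr hc) (d := d) (by simpa using hdI d hd)
                    (Finset.mem_coe.mpr hs) (by omega)).1
                · exact hab h.1
            rw [hemp] at hcardD
            simp at hcardD
            omega
          · have : D.toLeft.card + ({a, b} : Finset (Fin t)).card ≤ t := by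
              rw [← Finset.card_union_of_disjoint]
              · exact (Finset.card_le_univ _).trans (by simp)
              · rw [Finset.disjoint_left]
                intro x hx hx'
                have hx := Finset.mem_toLeft.mp hx
                simp only [Finset.mem_insert, Finset.mem_singleton] at hx'
                rcases hx' with rfl | rfl
                · exact hbD hx
                · exact hDI _ hx hb
            rw [Finset.card_pair hab] at this
            omega
      · have := hR0 hb
        omega
  · push Not at hcore
    have hcore' : ∀ c, Sum.inl c ∉ (I : Set (Fin t ⊕ Fin k)) := fun c h => hcore c (Finset.mem_coe.mp h)
    let L : Fin t ⊕ Fin k → Prop := fun d => ∃ i : Fin k, Sum.inr i ∈ I ∧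
      ((d = Sum.inl a ∧ (i : ℕ) = 0) ∨ ∃ e : Fin k, d = Sum.inr e ∧ (i : ℕ) = e + 1)
    let Rt : Fin t ⊕ Fin k → Prop := fun d => ∃ i : Fin k, Sum.inr i ∈ I ∧
      ((d = Sum.inl b ∧ (i : ℕ) + 1 = k) ∨ ∃ e : Fin k, d = Sum.inr e ∧ (e : ℕ) = i + 1)
    have hLR : ∀ d ∈ D, L d ∨ Rt d := by
      intro d hd
      obtain ⟨i, hi, hid⟩ := hadj _ hd
      rcases i with i | i
      · exact absurd hi (hcore i)
      · rcases d with d | d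
        · rw [S_rl] at hid
          rcases hid with ⟨rfl, h⟩ | ⟨rfl, h⟩
          · exact Or.inl ⟨i, hi, Or.inl ⟨rfl, h⟩⟩
          · exact Or.inr ⟨i, hi, Or.inl ⟨rfl, h⟩⟩
        · rw [S_rr] at hid
          rcases hid with h | h
          · exact Or.inr ⟨i, hi, Or.inr ⟨d, rfl, h⟩⟩
          · exact Or.inl ⟨i, hi, Or.inr ⟨d, rfl, h⟩⟩
    have key : ∀ i j l : Fin k, Sum.inr i ∈ I → Sum.inr j ∈ I → Sum.inr l ∈ D → i < l → ¬ l < j := by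
      intro i j l hi hj hl h1 h2
      exact hDI _ hl (Finset.mem_coe.mp (S_interval hI hcore' (Finset.mem_coe.mpr hi) (Finset.mem_coe.mpr hj) h1 h2))
    have hne : ∀ i l : Fin k, Sum.inr i ∈ I → Sum.inr l ∈ D → i ≠ l := by
      rintro i l hi hl rfl; exact hDI _ hl hi
    have hcL : (D.filter L).card ≤ 1 := by
      rw [Finset.card_le_one]
      intro x hx y hy
      simp only [Finset.mem_filter] at hx hy
      obtain ⟨hxD, i, hi, hx⟩ := hx
      obtain ⟨hyD, j, hj, hy⟩ := hy
      rcases hx with ⟨rfl, hx⟩ | ⟨e, rfl, hx⟩ <;> rcases hy with ⟨rfl, hy⟩ | ⟨f, rfl, hy⟩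
      · rfl
      · exfalso
        have := hne i f hi hyD
        exact key i j f hi hj hyD (by omega) (by omega)
      · exfalso
        have := hne j e hj hxD
        exact key j i e hj hi hxD (by omega) (by omega)
      · have h1 := hne i f hi hyD
        have h2 := hne j e hj hxD
        have h3 := key i j f hi hj hyD
        have h4 := key j i e hj hi hxD
        have : e = f := by omega
        rw [this]
    have hcR : (D.filter Rt).card ≤ 1 := by
      rw [Finset.card_le_one]
      intro x hx y hy
      simp only [Finset.mem_filter] at hx hy
      obtain ⟨hxD, i, hi, hx⟩ := hx
      obtain ⟨hyD, j, hj, hy⟩ := hy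
      rcases hx with ⟨rfl, hx⟩ | ⟨e, rfl, hx⟩ <;> rcases hy with ⟨rfl, hy⟩ | ⟨f, rfl, hy⟩
      · rfl
      · exfalso
        have := hne i f hi hyD
        have := f.2
        exact key j i f hj hi hyD (by omega) (by omega)
      · exfalso
        have := hne j e hj hxD
        have := e.2
        exact key i j e hi hj hxD (by omega) (by omega)
      · have h1 := hne i f hi hyD
        have h2 := hne j e hj hxD
        have h3 := key j i f hj hi hyD
        have h4 := key i j e hi hj hxD
        have : e = f := by omega
        rw [this]
    have hsplit : D.card ≤ (D.filter L).card + (D.filter Rt).card := by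
      refine le_trans (Finset.card_le_card ?_) (Finset.card_union_le _ _)
      intro d hd
      rw [Finset.mem_union, Finset.mem_filter, Finset.mem_filter]
      rcases hLR d hd with h | h
      · exact Or.inl ⟨hd, h⟩
      · exact Or.inr ⟨hd, h⟩
    omega
end P5

section P6

lemma FreeD_comap {V W : Type} [Fintype V] [DecidableEq V] [Fintype W] [DecidableEq W]
    {S : SimpleGraph W} {t : ℕ} (h : FreeD S t) (e : V ≃ W) :
    FreeD (S.comap e) t := by
  intro I D hI hdis hadj
  have := h (I.map e.toEmbedding) (D.map e.toEmbedding) ?_ ?_ ?_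
  · simpa using this
  · let f : (S.comap e).induce (I : Set V) →g S.induce ((I.map e.toEmbedding : Finset W) : Set W) :=
      ⟨fun v => ⟨e v.1, by simpa using v.2⟩, fun {a b} hab => hab⟩
    refine hI.map f ?_
    rintro ⟨w, hw⟩
    simp only [Finset.coe_map, Set.mem_image, Finset.mem_coe] at hw
    obtain ⟨v, hv, rfl⟩ := hw
    exact ⟨⟨v, hv⟩, rfl⟩
  · rwa [Finset.disjoint_map]
  · intro d hd
    simp only [Finset.mem_map] at hd
    obtain ⟨d, hd, rfl⟩ := hd
    obtain ⟨i, hi, h⟩ := hadj d hd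
    exact ⟨e i, by simpa using hi, h⟩

open Classical in
lemma rayleigh_comap {V W : Type} [Fintype V] [DecidableEq V] [Fintype W] [DecidableEq W]
    (S : SimpleGraph W) (e : V ≃ W) (y : W → ℝ) :
    ∑ i, ∑ j, (if S.Adj i j then y i * y j else 0) ≤ specRad (S.comap e) * ∑ i, y i ^ 2 := by
  have := sx_rayleigh (S.comap e) (y ∘ e)
  rw [← Equiv.sum_comp e, ← Equiv.sum_comp e (fun i => y i ^ 2)]
  refine le_trans (le_of_eq ?_) this
  apply Finset.sum_congr rfl
  intro i _
  rw [← Equiv.sum_comp e]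
  rfl

open Classical in
lemma max_bound {t n : ℕ} (ht : 3 ≤ t) {G : SimpleGraph (Fin n)}
    (hmax : ∀ G' : SimpleGraph (Fin n), G'.Connected →
      ¬ MinorOf (completeBipartiteGraph (Fin 1) (Fin t)) G' → specRad G' ≤ specRad G)
    {W : Type} [Fintype W] [DecidableEq W] {S : SimpleGraph W} (e : Fin n ≃ W) (hc : S.Connected) (hS : FreeD S t)
    (y : W → ℝ) :
    ∑ i, ∑ j, (if S.Adj i j then y i * y j else 0) ≤ specRad G * ∑ i, y i ^ 2 := by
  refine (rayleigh_comap S e y).trans ?_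
  refine mul_le_mul_of_nonneg_right ?_ (Finset.sum_nonneg fun i _ => sq_nonneg _)
  apply hmax
  · exact (Iso.comap e S).connected_iff.mpr hc
  · rw [free_iff _ _ (by omega)]
    exact FreeD_comap hS e

set_option maxHeartbeats 1000000 in
open Classical in
lemma S_lower {t k : ℕ} {a b : Fin t} (hab : a ≠ b) (hk : 2 ≤ k) (y0 : Fin t → ℝ) (h0 : ∀ i, 0 ≤ y0 i)
    (γ : ℝ) (hγ : 0 ≤ γ) (ρ : ℝ)
    (hR : ∀ y : Fin t ⊕ Fin k → ℝ, ∑ i, ∑ j, (if (subdividePath (⊤ : SimpleGraph (Fin t)) a b k).Adj i j then y i * y j else 0)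
      ≤ ρ * ∑ i, y i ^ 2) :
    (∑ i, y0 i) ^ 2 - ∑ i, y0 i ^ 2 - 2 * (y0 a * y0 b) + 2 * γ * (y0 a + y0 b) ≤ ρ * (∑ i, y0 i ^ 2 + 2 * γ ^ 2) := by
  set f : Fin k := ⟨0, by omega⟩ with hf
  set l : Fin k := ⟨k-1, by omega⟩ with hl
  have hfl : f ≠ l := by rw [hf, hl]; intro h; rw [Fin.mk.injEq] at h; omega
  set y1 : Fin k → ℝ := fun j => (if j = f then γ else 0) + (if j = l then γ else 0) with hy1
  have y1n : ∀ j, 0 ≤ y1 j := by intro j; rw [hy1]; positivity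
  have := hR (Sum.elim y0 y1)
  simp only [Fintype.sum_sum_type, Sum.elim_inl, Sum.elim_inr, Finset.sum_add_distrib] at this
  have sq1 : ∑ j, y1 j ^ 2 = 2 * γ ^ 2 := by
    have : ∀ j, y1 j ^ 2 = (if j = f then γ ^ 2 else 0) + (if j = l then γ ^ 2 else 0) := by
      intro j
      simp only [hy1]
      clear_value f l
      grind
    simp only [this, Finset.sum_add_distrib, Finset.sum_ite_eq', Finset.mem_univ, if_true]
    ring
  rw [sq1] at this
  have core : ∑ i, ∑ j, (if (subdividePath (⊤ : SimpleGraph (Fin t)) a b k).Adj (Sum.inl i) (Sum.inl j) then y0 i * y0 j else 0)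
      = (∑ i, y0 i) ^ 2 - ∑ i, y0 i ^ 2 - 2 * (y0 a * y0 b) := by
    have e1 : ∀ i j, (if (subdividePath (⊤ : SimpleGraph (Fin t)) a b k).Adj (Sum.inl i) (Sum.inl j) then y0 i * y0 j else 0)
      = y0 i * y0 j - (if j = i then y0 i * y0 j else 0) - (if i = a then (if j = b then y0 i * y0 j else 0) else 0)
        - (if i = b then (if j = a then y0 i * y0 j else 0) else 0) := by
      intro i j
      simp only [S_ll]
      grind
    simp only [e1, Finset.sum_sub_distrib]
    have e2 : ∑ i, ∑ j, y0 i * y0 j = (∑ i, y0 i) ^ 2 := by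
      rw [sq, Finset.sum_mul_sum]
    have e3 : ∀ (a b : Fin t), ∑ i, ∑ j, (if i = a then (if j = b then y0 i * y0 j else 0) else 0) = y0 a * y0 b := by
      intro a b
      rw [Finset.sum_eq_single a]
      · simp
      · intro i _ hi; simp [hi]
      · simp
    rw [e2, e3, e3]
    simp only [Finset.sum_ite_eq', Finset.mem_univ, if_true]
    have : ∀ i, y0 i * y0 i = y0 i ^ 2 := fun i => by ring
    simp only [this]
    ring
  have cross : γ * (y0 a + y0 b) ≤ ∑ i, ∑ j, (if (subdividePath (⊤ : SimpleGraph (Fin t)) a b k).Adj (Sum.inl i) (Sum.inr j) then y0 i * y1 j else 0) := by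
    have e3 : ∀ (a : Fin t) (f : Fin k) (c : ℝ), ∑ i, ∑ j, (if i = a then (if j = f then c else 0) else 0) = c := by
      intro a f c
      rw [Finset.sum_eq_single a]
      · simp
      · intro i _ hi; simp [hi]
      · simp
    have e4 : γ * (y0 a + y0 b) = ∑ i, ∑ j, ((if i = a then (if j = f then γ * y0 a else 0) else 0) + (if i = b then (if j = l then γ * y0 b else 0) else 0)) := by
      simp only [Finset.sum_add_distrib]
      rw [e3, e3]; ring
    rw [e4]
    refine Finset.sum_le_sum fun i _ => Finset.sum_le_sum fun j _ => ?_
    have hnn : 0 ≤ (if (subdividePath (⊤ : SimpleGraph (Fin t)) a b k).Adj (Sum.inl i) (Sum.inr j) then y0 i * y1 j else 0) := by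
      split_ifs
      · exact mul_nonneg (h0 i) (y1n j)
      · exact le_rfl
    by_cases h1 : i = a
    · subst h1
      by_cases h2 : j = f
      · subst h2
        have : (subdividePath (⊤ : SimpleGraph (Fin t)) i b k).Adj (Sum.inl i) (Sum.inr f) := by
          rw [S_lr]; exact Or.inl ⟨rfl, rfl⟩
        simp [this, hab, hy1, hfl]
        linarith
      · simpa [hab, h2] using hnn
    · by_cases h2 : i = b
      · subst h2
        by_cases h3 : j = l
        · subst h3
          have : (subdividePath (⊤ : SimpleGraph (Fin t)) a i k).Adj (Sum.inl i) (Sum.inr l) := by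
            rw [S_lr]; exact Or.inr ⟨rfl, by simp [hl]; omega⟩
          simp [this, h1, hy1, hfl.symm]
          linarith
        · simpa [h1, h3] using hnn
      · simpa [h1, h2] using hnn
  have cross' : ∑ i, ∑ j, (if (subdividePath (⊤ : SimpleGraph (Fin t)) a b k).Adj (Sum.inr i) (Sum.inl j) then y1 i * y0 j else 0)
      = ∑ i, ∑ j, (if (subdividePath (⊤ : SimpleGraph (Fin t)) a b k).Adj (Sum.inl i) (Sum.inr j) then y0 i * y1 j else 0) := by
    rw [Finset.sum_comm]
    refine Finset.sum_congr rfl fun i _ => Finset.sum_congr rfl fun j _ => ?_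
    rw [SimpleGraph.adj_comm, mul_comm]
  have pp : 0 ≤ ∑ i, ∑ j, (if (subdividePath (⊤ : SimpleGraph (Fin t)) a b k).Adj (Sum.inr i) (Sum.inr j) then y1 i * y1 j else 0) := by
    refine Finset.sum_nonneg fun i _ => Finset.sum_nonneg fun j _ => ?_
    split_ifs
    · exact mul_nonneg (y1n i) (y1n j)
    · exact le_rfl
  rw [cross'] at this
  linarith

lemma S_bounds {t : ℕ} (ht : 3 ≤ t) {a b : Fin t} (hab : a ≠ b) (ρ : ℝ)
    (hR : ∀ (y0 : Fin t → ℝ) (γ : ℝ), (∀ i, 0 ≤ y0 i) → 0 ≤ γ →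
    (∑ i, y0 i) ^ 2 - ∑ i, y0 i ^ 2 - 2 * (y0 a * y0 b) + 2 * γ * (y0 a + y0 b) ≤ ρ * (∑ i, y0 i ^ 2 + 2 * γ ^ 2)) :
    (t : ℝ) - 2 < ρ ∧ 1 < ρ ∧ (0 ≤ (t:ℝ) - 1 - ρ → (ρ + 3) * (t - 1 - ρ) < 2 ∧ ρ * ((ρ + 1) * (t - 1 - ρ)) < 2 * ρ - 2) := by
  have ht' : (3:ℝ) ≤ t := by exact_mod_cast ht
  have h1 := hR (fun _ => 1) 0 (by simp) le_rfl
  simp at h1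
  have b1 : (t : ℝ) - 2 < ρ := by nlinarith
  have b2 : 1 < ρ := by nlinarith
  refine ⟨b1, b2, fun hε => ?_⟩
  have hβ : 0 < ρ ^ 2 - 1 := by nlinarith
  set s : ℝ := t - 2 with hs
  set β : ℝ := s * ρ / (ρ ^ 2 - 1) with hβd
  have hβ0 : 0 < β := by rw [hβd]; apply div_pos (mul_pos (by linarith) (by linarith)) hβ
  have hβe : β * (ρ ^ 2 - 1) = s * ρ := by rw [hβd]; field_simp
  have h2 := hR (fun i => if i = a ∨ i = b then β else 1) (β / ρ) (by intro i; split_ifs <;> linarith) (by positivity)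
  have e1 : ∀ c : ℝ, ∑ i : Fin t, (if i = a ∨ i = b then c else 1) = s + 2 * c := by
    intro c
    have : ∀ i : Fin t, (if i = a ∨ i = b then c else 1) = 1 + ((if i = a then c - 1 else 0) + (if i = b then c - 1 else 0)) := by
      intro i
      grind
    simp only [this, Finset.sum_add_distrib, Finset.sum_ite_eq', Finset.mem_univ, if_true]
    simp
    rw [hs]; ring
  have e2 : ∑ i : Fin t, (if i = a ∨ i = b then β else 1) ^ 2 = s + 2 * β ^ 2 := by
    rw [← e1 (β ^ 2)]
    refine Finset.sum_congr rfl fun i _ => ?_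
    split_ifs <;> simp
  rw [e1, e2] at h2
  simp at h2
  set γ := β / ρ with hγ
  have hγe : γ * ρ = β := by rw [hγ]; field_simp
  have h3 : s ^ 2 - s + 4 * β * s + 4 * β * γ ≤ ρ * s + 2 * ρ * β ^ 2 + 2 * β * γ := by
    have : ρ * γ ^ 2 = β * γ := by rw [← hγe]; ring
    nlinarith
  have h4 : ρ * β ^ 2 - β * γ = β * s := by
    have : ρ * (ρ * β ^ 2 - β * γ) = ρ * (β * s) := by
      have : ρ * (β * γ) = β ^ 2 := by
        calc ρ * (β * γ) = β * (γ * ρ) := by ring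
          _ = _ := by rw [hγe]; ring
      calc ρ * (ρ * β ^ 2 - β * γ) = ρ^2 * β^2 - ρ * (β * γ) := by ring
        _ = β * (β * (ρ ^ 2 - 1)) := by rw [this]; ring
        _ = _ := by rw [hβe]; ring
    exact mul_left_cancel₀ (by linarith) this
  have h5 : s - 1 + 2 * β ≤ ρ := by
    have : s * (s - 1 + 2 * β) ≤ s * ρ := by nlinarith
    exact le_of_mul_le_mul_left this (by linarith)
  have h6 : 2 * (s * ρ) ≤ (ρ - s + 1) * (ρ ^ 2 - 1) := by
    rw [← hβe]
    nlinarith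
  have hte : (t:ℝ) - 1 - ρ = s + 1 - ρ := by rw [hs]; ring
  rw [hte] at hε ⊢
  set ε := s + 1 - ρ with hεd
  have hse : s = ρ + ε - 1 := by rw [hεd]; ring
  rw [hse] at h6
  have h7 : ε * (ρ ^ 2 + 2 * ρ - 1) ≤ 2 * (ρ - 1) := by nlinarith
  have hD : 0 < ρ ^ 2 + 2 * ρ - 1 := by nlinarith
  constructor
  · have h8 : ((ρ + 3) * ε) * (ρ ^ 2 + 2 * ρ - 1) < 2 * (ρ ^ 2 + 2 * ρ - 1) := by
      have h9 := mul_le_mul_of_nonneg_left h7 (by linarith : 0 ≤ ρ + 3)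
      have h10 : (ρ + 3) * (2 * (ρ - 1)) = 2 * (ρ ^ 2 + 2 * ρ - 1) - 4 := by ring
      have h11 : ((ρ + 3) * ε) * (ρ ^ 2 + 2 * ρ - 1) = (ρ + 3) * (ε * (ρ ^ 2 + 2 * ρ - 1)) := by ring
      linarith
    exact lt_of_mul_lt_mul_right h8 hD.le
  · rcases hε.eq_or_lt with h0 | h0
    · rw [← h0]; linarith
    · have : ρ * ((ρ + 1) * ε) < ε * (ρ ^ 2 + 2 * ρ - 1) := by
        have h12 := mul_pos h0 (by linarith : (0:ℝ) < ρ - 1)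
        have e : ε * (ρ ^ 2 + 2 * ρ - 1) - ρ * ((ρ + 1) * ε) = ε * (ρ - 1) := by ring
        linarith
      linarith

open Classical in
lemma Ctx.mk_of {n t : ℕ} {G : SimpleGraph (Fin n)} (hconn : G.Connected) (hF : FreeD G t)
    (hρ : (t : ℝ) - 2 < specRad G) : ∃ u N x, Ctx G t u N x (specRad G) := by
  obtain ⟨x, u, hpos, hev, hxu, hle⟩ := sx_perron G hconn
  refine ⟨u, Finset.univ.filter (fun w => G.Adj u w), x, hF, by simp, ?_, hpos, hev, hxu, hle⟩
  have h1 := hF {u} (Finset.univ.filter (fun w => G.Adj u w)) (conn_singleton G u) (by simp) (by simp)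
  have h2 := hev u
  rw [← Finset.sum_filter, hxu, mul_one] at h2
  have h3 : ∑ w ∈ Finset.univ.filter (fun w => G.Adj u w), x w ≤ ∑ w ∈ Finset.univ.filter (fun w => G.Adj u w), (1:ℝ) :=
    Finset.sum_le_sum fun i _ => hle i
  rw [h2] at h3
  simp only [Finset.sum_const, nsmul_eq_mul, mul_one] at h3
  have h4 : (t : ℝ) < ((Finset.univ.filter (fun w => G.Adj u w)).card + 2 : ℕ) := by push_cast; linarith
  have h5 := Nat.cast_lt.mp h4
  omega

theorem case_big (t n : ℕ) (ht : 3 ≤ t) (hn : t + 2 ≤ n)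
    (G : SimpleGraph (Fin n)) (hconn : G.Connected)
    (hfree : ¬ MinorOf (completeBipartiteGraph (Fin 1) (Fin t)) G)
    (hmax : ∀ G' : SimpleGraph (Fin n), G'.Connected →
      ¬ MinorOf (completeBipartiteGraph (Fin 1) (Fin t)) G' → specRad G' ≤ specRad G) :
    ∃ u v : Fin t, u ≠ v ∧ Nonempty (G ≃g subdividePath (⊤ : SimpleGraph (Fin t)) u v (n - t)) := by
  classical
  have hF := (free_iff G t (by omega)).mp hfree
  let e0 : Fin n ≃ Fin t ⊕ Fin (n - t) := Fintype.equivOfCardEq (by simp; omega)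
  have hab0 : (⟨0, by omega⟩ : Fin t) ≠ ⟨1, by omega⟩ := by simp
  obtain ⟨b1, b2, b3⟩ := S_bounds ht hab0 (specRad G) (fun y0 γ h0 hγ =>
    S_lower hab0 (k := n - t) (by omega) y0 h0 γ hγ (specRad G) (fun y =>
      max_bound ht hmax e0 (S_connected ht hab0) (S_free ht hab0) y))
  obtain ⟨u, N, x, h⟩ := Ctx.mk_of hconn hF b1
  have hε : 0 ≤ (t:ℝ) - 1 - specRad G := by
    simpa using h.defect (S := ∅) (by simp)
  obtain ⟨b4, b5⟩ := b3 hε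
  have hR : ∀ z, ∃ r, r ≠ z ∧ r ≠ u ∧ r ∉ N := by
    intro z
    obtain ⟨r, hr⟩ := Finset.exists_mem_notMem_of_card_lt_card (s := insert z (insert u N)) (t := Finset.univ) (by
      have := h.hNc
      have h1 := Finset.card_insert_le z (insert u N)
      have h2 := Finset.card_insert_le u N
      rw [Finset.card_univ, Fintype.card_fin]
      omega)
    simp at hr
    exact ⟨r, hr.1, hr.2.1, hr.2.2⟩
  obtain ⟨w, hw, y, y1, y2, -, y3⟩ := h.other_attached hconn hR (z := u) (fun y h1 h2 h3 => h2 ((h.hN y).mpr h3))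
  obtain ⟨w', hw', h1, h2⟩ := claim_deg h.hF h.hN h.hNc hw y1 y2 y3
  have hFe : Fe G N w w' := ⟨hw, hw', h1, h2⟩
  obtain ⟨e, a, b, hab, hadj⟩ := embed_exists hconn hF h.hN h.hNc hFe
    (fun a b hab => h.F_le_one b2 b4 b5 hconn hR hFe hab) (k := n - t) (by simp; omega)
  refine ⟨a, b, hab, ?_⟩
  have heq : G = (subdividePath (⊤ : SimpleGraph (Fin t)) a b (n - t)).comap e := by
    apply sx_eq_of_le hconn
    · intro x y hxy; exact hadj x y hxy
    · apply hmax
      · exact (Iso.comap e _).connected_iff.mpr (S_connected ht hab)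
      · rw [free_iff _ _ (by omega)]
        exact FreeD_comap (S_free ht hab) e
  rw [heq]
  exact ⟨Iso.comap e _⟩
end P6

section P7

lemma H_ll {t : ℕ} (a b) : (Hst 1 t).Adj (Sum.inl a) (Sum.inl b) ↔ a.1 = b.1 ∧ a.2 ≠ b.2 := by
  obtain ⟨a1, a2⟩ := a
  obtain ⟨b1, b2⟩ := b
  rcases a2 with a2 | a2 <;> rcases b2 with b2 | b2 <;>
  fin_cases a2 <;> fin_cases b2 <;> simp [Hst, gUnion, copies, starG] <;> tauto

lemma H_lr {t : ℕ} (a b) : ¬ (Hst 1 t).Adj (Sum.inl a) (Sum.inr b) := by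
  simp [Hst, gUnion]

lemma H_rr {t : ℕ} (a b) : (Hst 1 t).Adj (Sum.inr a) (Sum.inr b) ↔ (starG _).Adj a b := by
  simp only [Hst, gUnion, fromRel_adj]
  constructor
  · rintro ⟨h, h'⟩
    rcases h' with (⟨_, _, h1, _⟩ | ⟨c, d, h1, h2, h3⟩) | (⟨_, _, h1, _⟩ | ⟨c, d, h1, h2, h3⟩)
    · simp at h1
    · cases h1; cases h2; exact h3
    · simp at h1
    · cases h1; cases h2; exact h3.symm
  · intro h
    exact ⟨fun e => h.ne (Sum.inr_injective e), Or.inl (Or.inr ⟨a, b, rfl, rfl, h⟩)⟩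

lemma Hc_lr {t : ℕ} (a b) : (Hst 1 t)ᶜ.Adj (Sum.inl a) (Sum.inr b) := by
  rw [compl_adj]; exact ⟨by simp, H_lr a b⟩

lemma Hc_connected {t : ℕ} (ht : 3 ≤ t) : (Hst 1 t)ᶜ.Connected := by
  have hq : 0 < (t+1)/(1+1) - 1 := by omega
  have : Nonempty ((Fin ((t+1)/(1+1) - 1) × (Fin 1 ⊕ Fin 1)) ⊕ (Fin 1 ⊕ Fin (t - ((t+1)/(1+1) - 1) * (1+1)))) :=
    ⟨Sum.inr (Sum.inl 0)⟩
  refine ⟨?_⟩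
  have key : ∀ v, (Hst 1 t)ᶜ.Reachable v (Sum.inr (Sum.inl 0)) := by
    rintro (a | b)
    · exact (Hc_lr a _).reachable
    · exact ((Hc_lr (⟨0, hq⟩, Sum.inl 0) b).symm.reachable).trans (Hc_lr _ _).reachable
  intro v w
  exact (key v).trans (key w).symm

lemma Free_of_nonadj {V : Type} [Fintype V] [DecidableEq V] {S : SimpleGraph V} {t : ℕ}
    (hc : Fintype.card V = t + 1) (h : ∀ v, ∃ w, w ≠ v ∧ ¬ S.Adj v w) : FreeD S t := by
  intro I D hI hdis hadj
  obtain ⟨⟨v, hv⟩⟩ := hI.nonempty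
  have hv : v ∈ I := hv
  obtain ⟨w, hw, hvw⟩ := h v
  obtain ⟨w', hw', hD⟩ : ∃ w', w' ≠ v ∧ w' ∉ D := by
    by_cases hwD : w ∈ D
    · obtain ⟨i, hi, hiw⟩ := hadj w hwD
      exact ⟨i, fun e => hvw (e ▸ hiw), fun hiD => Finset.disjoint_left.mp hdis hi hiD⟩
    · exact ⟨w, hw, hwD⟩
  have hvD : v ∉ D := Finset.disjoint_left.mp hdis hv
  have := Finset.card_le_univ (insert v (insert w' D))
  rw [Finset.card_insert_of_notMem (by simp [hw'.symm, hvD]), Finset.card_insert_of_notMem hD, hc] at this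
  omega

lemma H_card {t : ℕ} (ht : 3 ≤ t) : Fintype.card ((Fin ((t+1)/(1+1) - 1) × (Fin 1 ⊕ Fin 1)) ⊕ (Fin 1 ⊕ Fin (t - ((t+1)/(1+1) - 1) * (1+1)))) = t + 1 := by
  simp
  omega

lemma Hc_free {t : ℕ} (ht : 3 ≤ t) : FreeD (Hst 1 t)ᶜ t := by
  apply Free_of_nonadj (H_card ht)
  have hr : 0 < t - ((t+1)/(1+1) - 1) * (1+1) := by omega
  have : ∀ v, ∃ w, (Hst 1 t).Adj v w := by
    rintro (⟨a, (b | b)⟩ | (b | b))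
    · exact ⟨Sum.inl (a, Sum.inr 0), by rw [H_ll]; simp⟩
    · exact ⟨Sum.inl (a, Sum.inl 0), by rw [H_ll]; simp⟩
    · exact ⟨Sum.inr (Sum.inr ⟨0, hr⟩), by rw [H_rr]; simp [starG]⟩
    · exact ⟨Sum.inr (Sum.inl 0), by rw [H_rr]; simp [starG]⟩
  intro v
  obtain ⟨w, hw⟩ := this v
  exact ⟨w, hw.ne', fun h => (compl_adj _ _ _ |>.mp h).2 hw⟩

lemma Hc_sum {t : ℕ} (ht : 3 ≤ t) [DecidableRel (Hst 1 t)ᶜ.Adj] :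
    (∑ i, ∑ j, (if (Hst 1 t)ᶜ.Adj i j then (1:ℝ) * 1 else 0)) =
      ((t:ℝ) + 1) * t - 2 * (((t+1)/(1+1) - 1 : ℕ) : ℝ) - 2 * ((t - ((t+1)/(1+1) - 1) * (1+1) : ℕ) : ℝ) := by
  classical
  have e1 : ∀ i j, (if (Hst 1 t)ᶜ.Adj i j then (1:ℝ) * 1 else 0) =
      1 - (if i = j then 1 else 0) - (if (Hst 1 t).Adj i j then 1 else 0) := by
    intro i j
    by_cases h : i = j
    · subst h; simp
    · by_cases h' : (Hst 1 t).Adj i j <;> simp [compl_adj, h, h']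
  simp only [e1, Finset.sum_sub_distrib, Finset.sum_const, Finset.card_univ, H_card ht]
  have e2 : ∑ i, ∑ j, (if (Hst 1 t).Adj i j then (1:ℝ) else 0) =
      2 * (((t+1)/(1+1) - 1 : ℕ) : ℝ) + 2 * ((t - ((t+1)/(1+1) - 1) * (1+1) : ℕ) : ℝ) := by
    have hrl : ∀ a b, ¬ (Hst 1 t).Adj (Sum.inr a) (Sum.inl b) := fun a b h => H_lr b a h.symm
    have l1 : ∀ i j a b, ¬ (Hst 1 t).Adj (Sum.inl (i, Sum.inl a)) (Sum.inl (j, Sum.inl b)) := by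
      intro i j a b; rw [H_ll]; simp [Subsingleton.elim a b]
    have l2 : ∀ i j a b, ¬ (Hst 1 t).Adj (Sum.inl (i, Sum.inr a)) (Sum.inl (j, Sum.inr b)) := by
      intro i j a b; rw [H_ll]; simp [Subsingleton.elim a b]
    have l3 : ∀ i j a b, (Hst 1 t).Adj (Sum.inl (i, Sum.inl a)) (Sum.inl (j, Sum.inr b)) ↔ i = j := by
      intro i j a b; rw [H_ll]; simp
    have l4 : ∀ i j a b, (Hst 1 t).Adj (Sum.inl (i, Sum.inr a)) (Sum.inl (j, Sum.inl b)) ↔ i = j := by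
      intro i j a b; rw [H_ll]; simp
    simp only [Fintype.sum_sum_type, l1, l2, l3, l4, H_lr, hrl, H_rr, Fintype.sum_prod_type, starG]
    simp
    ring
  rw [e2]
  simp [H_card ht]
  ring

lemma halves {n : ℕ} (A : Finset (Fin n)) (f : Fin n → Fin n) (hf : ∀ a ∈ A, f a ∈ A)
    (hff : ∀ a ∈ A, f (f a) = a) (hne : ∀ a ∈ A, f a ≠ a) :
    2 * (A.filter (fun a => a < f a)).card = A.card := by
  have h1 := Finset.card_filter_add_card_filter_not (s := A) (fun a => a < f a)
  have h2 : (A.filter (fun a => a < f a)).card = (A.filter (fun a => ¬ a < f a)).card := by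
    apply Finset.card_bij' (fun a _ => f a) (fun a _ => f a)
    · intro a ha
      simp only [Finset.mem_filter] at ha ⊢
      rw [hff a ha.1]
      exact ⟨hf a ha.1, not_lt.mpr ha.2.le⟩
    · intro a ha
      simp only [Finset.mem_filter] at ha ⊢
      rw [hff a ha.1]
      exact ⟨hf a ha.1, lt_of_le_of_ne (not_lt.mp ha.2) (hne a ha.1)⟩
    · intro a ha; exact hff a (Finset.mem_filter.mp ha).1
    · intro a ha; exact hff a (Finset.mem_filter.mp ha).1
  omega

/-- a numerical step: the number of vertices outside the matching is the right one -/
lemma num_k {t k m : ℕ} {ρ : ℝ} (ht : 3 ≤ t) (hm : 1 ≤ m) (hk : 2 * m + k + 1 = t)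
    (hε0 : 0 ≤ (t:ℝ) - 1 - ρ)
    (hb : ((t:ℝ) - 1 - ρ) * (t + 1) ≤ ((t - ((t+1)/(1+1) - 1) * (1+1) : ℕ) : ℝ) - 1)
    (hrel : ((t:ℝ) - 1 - ρ) * (ρ ^ 2 + 2 * ρ - k) = k * (ρ - k)) :
    k + 1 = t - ((t+1)/(1+1) - 1) * (1+1) := by
  have ht' : (3:ℝ) ≤ t := by exact_mod_cast ht
  set ε := (t:ℝ) - 1 - ρ with hε
  have hρ : ρ = t - 1 - ε := by rw [hε]; ring
  have hkt : (k:ℝ) ≤ t - 3 := by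
    have : k + 3 ≤ t := by omega
    have : (k:ℝ) + 3 ≤ t := by exact_mod_cast this
    linarith
  have hε1 : ε ≤ 1 / 2 := by
    have : ((t - ((t+1)/(1+1) - 1) * (1+1) : ℕ) : ℝ) ≤ 2 := by
      have : t - ((t+1)/(1+1) - 1) * (1+1) ≤ 2 := by omega
      exact_mod_cast this
    nlinarith
  have hk0 : (0:ℝ) ≤ k := by positivity
  have hz : ε = 0 → k = 0 := by
    intro h0
    rw [h0, zero_mul] at hrel
    rcases mul_eq_zero.mp hrel.symm with h | h
    · exact_mod_cast h
    · linarith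
  rcases Nat.even_or_odd' t with ⟨s, hs | hs⟩
  · have hr : t - ((t+1)/(1+1) - 1) * (1+1) = 2 := by omega
    rw [hr] at hb ⊢
    norm_num at hb
    by_contra hne
    have hk3 : 3 ≤ k := by omega
    have hk3' : (3:ℝ) ≤ k := by exact_mod_cast hk3
    have hεp : 0 < ε := by
      rcases hε0.eq_or_lt with h | h
      · have := hz h.symm; omega
      · exact h
    have ht6 : (6:ℝ) ≤ t := by linarith
    have a1 : 0 ≤ ((k:ℝ) - 3) * (t - 3 - k) := mul_nonneg (by linarith) (by linarith)
    have a2 : ((t:ℝ) - 3) * (2 - ε) ≤ k * (ρ - k) := by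
      rw [hρ]
      have : 0 ≤ ((t:ℝ) - 3 - k) * (1 + ε) := mul_nonneg (by linarith) (by linarith)
      nlinarith
    have a3 : ε * (ρ ^ 2 + 2 * ρ - k) ≤ ε * (ρ + 1) * (ρ + 1) - ε := by
      nlinarith [mul_nonneg hε0 hk0]
    have a4 : ε * (ρ + 1) ≤ 1 - ε := by
      rw [hρ]; nlinarith [mul_nonneg hε0 hε0]
    have a5 : ε * (ρ + 1) * (ρ + 1) ≤ (1 - ε) * t := by
      calc ε * (ρ + 1) * (ρ + 1) ≤ (1 - ε) * (ρ + 1) := mul_le_mul_of_nonneg_right a4 (by linarith)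
        _ ≤ (1 - ε) * t := mul_le_mul_of_nonneg_left (by linarith) (by linarith)
    nlinarith
  · have hr : t - ((t+1)/(1+1) - 1) * (1+1) = 1 := by omega
    rw [hr] at hb ⊢
    norm_num at hb
    have : ε = 0 := by nlinarith
    rw [hz this]

open Classical in
theorem case_small (t : ℕ) (ht : 3 ≤ t)
    (G : SimpleGraph (Fin (t+1))) (hconn : G.Connected)
    (hfree : ¬ MinorOf (completeBipartiteGraph (Fin 1) (Fin t)) G)
    (hmax : ∀ G' : SimpleGraph (Fin (t+1)), G'.Connected →
      ¬ MinorOf (completeBipartiteGraph (Fin 1) (Fin t)) G' → specRad G' ≤ specRad G) :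
    Nonempty (G ≃g (Hst 1 t)ᶜ) := by
  have hF := (free_iff G t (by omega)).mp hfree
  have ht' : (3:ℝ) ≤ t := by exact_mod_cast ht
  have e0 := (Fintype.equivFinOfCardEq (H_card ht)).symm
  have hb0 := (@Hc_sum t ht (fun a b => Classical.propDecidable _)).symm.le.trans
    (max_bound ht hmax e0 (Hc_connected ht) (Hc_free ht) (fun _ => 1))
  simp only [one_pow, Finset.sum_const, Finset.card_univ, H_card ht, nsmul_eq_mul, mul_one] at hb0
  push_cast at hb0
  have hqr : 2 * ((((t+1)/(1+1) - 1 : ℕ) : ℝ)) + ((t - ((t+1)/(1+1) - 1) * (1+1) : ℕ) : ℝ) = t := by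
    have : 2 * ((t+1)/(1+1) - 1) + (t - ((t+1)/(1+1) - 1) * (1+1)) = t := by omega
    exact_mod_cast this
  have hr2 : ((t - ((t+1)/(1+1) - 1) * (1+1) : ℕ) : ℝ) ≤ 2 := by
    have : t - ((t+1)/(1+1) - 1) * (1+1) ≤ 2 := by omega
    exact_mod_cast this
  have hb : ((t:ℝ) - 1 - specRad G) * (t + 1) ≤ ((t - ((t+1)/(1+1) - 1) * (1+1) : ℕ) : ℝ) - 1 := by
    linarith
  have hρ : (t:ℝ) - 2 < specRad G := by nlinarith
  obtain ⟨u, N, x, h⟩ := Ctx.mk_of hconn hF hρ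
  set ρ := specRad G with hρd
  have hε : 0 ≤ (t:ℝ) - 1 - ρ := by
    simpa using h.defect (S := ∅) (by simp)
  have hε2 : (ρ + 2) * ((t:ℝ) - 1 - ρ) < 1 := by
    rcases hε.eq_or_lt with h0 | h0
    · rw [← h0]; norm_num
    · nlinarith [mul_pos h0 h0]
  have hun := h.u_not
  have huniv : ∃ z, z ≠ u ∧ z ∉ N ∧ ∀ y, y ≠ u → y ∉ N → y = z := by
    have hc : (Finset.univ \ (insert u N)).card = 1 := by
      rw [Finset.card_sdiff_of_subset (Finset.subset_univ _), Finset.card_insert_of_notMem hun,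
        Finset.card_univ, Fintype.card_fin, h.hNc]
      omega
    obtain ⟨z, hz⟩ := Finset.card_eq_one.mp hc
    have hz' : ∀ y, (y ≠ u ∧ y ∉ N) ↔ y = z := by
      intro y
      have := Finset.ext_iff.mp hz y
      simpa using this
    exact ⟨z, ((hz' z).mpr rfl).1, ((hz' z).mpr rfl).2, fun y h1 h2 => (hz' y).mp ⟨h1, h2⟩⟩
  obtain ⟨z, hzu, hzN, hz⟩ := huniv
  have hnuz : ¬ G.Adj u z := fun h' => hzN ((h.hN z).mpr h')
  set A := N.filter (fun w => G.Adj w z) with hA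
  have memA : ∀ w, w ∈ A ↔ w ∈ N ∧ G.Adj w z := by intro w; simp [hA]
  have zA : ∀ w, G.Adj z w → w ∈ A := by
    intro w hw
    rw [memA]
    refine ⟨?_, hw.symm⟩
    by_contra hwN
    have := hz w (fun e => hnuz (e ▸ hw.symm)) hwN
    exact hw.ne this.symm
  have hAne : A.Nonempty := by
    obtain ⟨w, hw⟩ : ∃ w, G.Adj z w := by
      have : Nontrivial (Fin (t+1)) := ⟨⟨z, u, hzu⟩⟩
      exact hconn.preconnected.exists_adj_of_nontrivial z
    exact ⟨w, zA w hw⟩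
  have rnA : ∀ w ∈ A, rn G u N x w = x z := fun w hw =>
    h.rn_eq ((memA w).mp hw).1 hzu hzN ((memA w).mp hw).2
  have rn0 : ∀ w ∈ N, w ∉ A → rn G u N x w = 0 := by
    intro w hw hwA
    by_contra hne
    obtain ⟨y, h1, h2, h3⟩ := rn_pos_ex (lt_of_le_of_ne (h.rn_nonneg w) (Ne.symm hne))
    have := hz y h1 h2
    subst this
    exact hwA ((memA w).mpr ⟨hw, h3⟩)
  have hρp : 0 < ρ := by linarith
  have Tle : ∀ w ∈ N, (ρ + 1) * (1 - x w) ≤ (ρ + 1) * ((t:ℝ) - 1 - ρ) := fun w hw =>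
    mul_le_mul_of_nonneg_left (h.d1 hw) (by linarith)
  have FeA : ∀ w a, Fe G N w a → w ∈ A := by
    intro w a hwa
    by_contra hw
    have h1 := h.T1 hwa
    rw [rn0 w hwa.1 hw] at h1
    have h2 := Tle w hwa.1
    have h3 := h.d1 hwa.2.1
    linarith
  have Feu : ∀ w a b, Fe G N w a → Fe G N w b → a = b := by
    intro w a b ha hb'
    by_contra hab
    have h1 := h.T2 ha hb' hab
    have h2 := Tle w ha.1
    have h3 := h.d2 ha.2.1 hb'.2.1 hab
    have h4 := h.rn_le ha.1
    linarith
  have FeE : ∀ w, ∃ a, w ∈ A → Fe G N w a := by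
    intro w
    by_cases hw : w ∈ A
    · obtain ⟨a, h1, h2, h3⟩ := claim_deg h.hF h.hN h.hNc ((memA w).mp hw).1 hzu hzN ((memA w).mp hw).2
      exact ⟨a, fun _ => ⟨((memA w).mp hw).1, h1, h2, h3⟩⟩
    · exact ⟨w, fun h' => absurd h' hw⟩
  choose f hf using FeE
  have fA : ∀ a ∈ A, f a ∈ A := fun a ha => FeA _ _ (hf a ha).symm
  have ff : ∀ a ∈ A, f (f a) = a := fun a ha => Feu _ _ _ (hf _ (fA a ha)) (hf a ha).symm
  have fne : ∀ a ∈ A, f a ≠ a := fun a ha => (hf a ha).2.2.1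
  have hhalf := halves A f fA ff fne
  set B := A.filter (fun a => a < f a) with hB
  have hAN : A ⊆ N := Finset.filter_subset _ _
  have hcard := Finset.card_sdiff_add_card_eq_card hAN
  set k := (N \ A).card with hk
  have x1 : ∀ w ∈ N \ A, x w = 1 := by
    intro w hw
    rw [Finset.mem_sdiff] at hw
    have h1 := h.T_eq hw.1
    rw [rn0 w hw.1 hw.2, Finset.filter_false_of_mem (by
      intro a ha h'
      exact hw.2 (FeA w a ⟨hw.1, ha, h'⟩))] at h1
    simp at h1
    rcases h1 with h1 | h1 <;> linarith
  have sA : ∑ w ∈ A, x w = ρ - k := by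
    have h1 := Finset.sum_sdiff hAN (f := x)
    rw [h.sumN, Finset.sum_congr rfl x1] at h1
    simp at h1
    linarith
  have sz : ρ * x z = ρ - k := by
    rw [← sA, ← h.eig z, ← Finset.sum_filter]
    congr 1
    ext w
    simp only [Finset.mem_filter, Finset.mem_univ, true_and]
    exact ⟨zA w, fun hw => ((memA w).mp hw).2.symm⟩
  have TA : ∀ w ∈ A, (ρ + 1) * (1 - x w) = x (f w) - x z := by
    intro w hw
    rw [h.T_eq ((memA w).mp hw).1, rnA w hw]
    congr 1
    rw [show N.filter (fun w' => w' ≠ w ∧ ¬ G.Adj w w') = {f w} from ?_]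
    · simp
    ext a
    simp only [Finset.mem_filter, Finset.mem_singleton]
    constructor
    · intro ha; exact Feu w _ _ ⟨((memA w).mp hw).1, ha⟩ (hf w hw)
    · rintro rfl; exact (hf w hw).2
  have sf : ∑ w ∈ A, x (f w) = ∑ w ∈ A, x w :=
    Finset.sum_bij' (fun a _ => f a) (fun a _ => f a) fA fA ff ff (fun _ _ => rfl)
  have sT := Finset.sum_congr rfl TA
  rw [← Finset.mul_sum, Finset.sum_sub_distrib, Finset.sum_sub_distrib, sf, sA] at sT
  simp only [Finset.sum_const, nsmul_eq_mul, mul_one] at sT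
  have hNc := h.hNc
  have hmk : 2 * B.card + k + 1 = t := by omega
  have hAc : (A.card : ℝ) = t - 1 - k := by
    have : A.card + 1 + k = t := by omega
    have : (A.card : ℝ) + 1 + k = t := by exact_mod_cast this
    linarith
  have hrel : ((t:ℝ) - 1 - ρ) * (ρ ^ 2 + 2 * ρ - k) = k * (ρ - k) := by
    rw [hAc] at sT
    have : ρ * ((ρ + 1) * (t - 1 - k - (ρ - k))) = ρ * (ρ - k) - (t - 1 - k) * (ρ * x z) := by
      rw [sT]; ring
    rw [sz] at this
    linear_combination this
  have hm : 1 ≤ B.card := by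
    have := hAne.card_pos
    omega
  have hkr := num_k ht hm hmk hε hb hrel
  have hBc : B.card = (t+1)/(1+1) - 1 := by omega
  set L := insert u (N \ A) with hL
  have hLc : L.card = t - ((t+1)/(1+1) - 1) * (1+1) := by
    rw [hL, Finset.card_insert_of_notMem (by simp [hun]), ← hk, hkr]
  let eB := B.orderEmbOfFin hBc
  let eL := L.orderEmbOfFin hLc
  have eBm : ∀ i, eB i ∈ B := fun i => Finset.orderEmbOfFin_mem B hBc i
  have eLm : ∀ i, eL i ∈ L := fun i => Finset.orderEmbOfFin_mem L hLc i
  have eBA : ∀ i, eB i ∈ A := fun i => (Finset.mem_filter.mp (eBm i)).1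
  have eBlt : ∀ i, eB i < f (eB i) := fun i => (Finset.mem_filter.mp (eBm i)).2
  have LA : ∀ w ∈ L, w ∉ A ∧ w ≠ z := by
    intro w hw
    rw [hL, Finset.mem_insert, Finset.mem_sdiff] at hw
    rcases hw with rfl | hw
    · exact ⟨fun h' => hun (hAN h'), hzu.symm⟩
    · exact ⟨hw.2, fun e => hzN (e ▸ hw.1)⟩
  have Lz : ∀ w ∈ L, ¬ G.Adj z w := fun w hw h' => (LA w hw).1 (zA w h')
  have zA' : z ∉ A := fun h' => hzN (hAN h')
  let g : ((Fin ((t+1)/(1+1) - 1) × (Fin 1 ⊕ Fin 1)) ⊕ (Fin 1 ⊕ Fin (t - ((t+1)/(1+1) - 1) * (1+1)))) → Fin (t+1) :=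
    Sum.elim (fun p => Sum.elim (fun _ => eB p.1) (fun _ => f (eB p.1)) p.2)
      (Sum.elim (fun _ => z) (fun j => eL j))
  have gA : ∀ p, g (Sum.inl p) ∈ A := by
    rintro ⟨i, (j | j)⟩
    · exact eBA i
    · exact fA _ (eBA i)
  have gnA : ∀ p, g (Sum.inr p) ∉ A := by
    rintro (j | j)
    · exact zA'
    · exact (LA _ (eLm j)).1
  have fB : ∀ i j, f (eB i) ≠ eB j := by
    intro i j e
    have h1 := eBlt i
    have h2 := eBlt j
    rw [← e, ff _ (eBA i)] at h2
    exact absurd h1 (not_lt.mpr h2.le)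
  have ginj : Function.Injective g := by
    rintro (⟨i, (a | a)⟩ | (a | a)) (⟨j, (b | b)⟩ | (b | b)) e
    · have : i = j := eB.injective e
      rw [this, Subsingleton.elim a b]
    · exact absurd (Eq.symm e) (fB j i)
    · exact absurd (e ▸ gA _) (gnA _)
    · exact absurd (e ▸ gA _) (gnA _)
    · exact absurd e (fB i j)
    · have e' : f (eB i) = f (eB j) := e
      have : eB i = eB j := by rw [← ff _ (eBA i), e', ff _ (eBA j)]
      have : i = j := eB.injective this
      rw [this, Subsingleton.elim a b]
    · exact absurd (e ▸ gA _) (gnA _)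
    · exact absurd (e ▸ gA _) (gnA _)
    · exact absurd (e.symm ▸ gA _) (gnA _)
    · exact absurd (e.symm ▸ gA _) (gnA _)
    · rw [Subsingleton.elim a b]
    · exact absurd (Eq.symm e) (LA _ (eLm b)).2
    · exact absurd (e.symm ▸ gA _) (gnA _)
    · exact absurd (e.symm ▸ gA _) (gnA _)
    · exact absurd e (LA _ (eLm a)).2
    · have : a = b := eL.injective e
      rw [this]
  have gbij : Function.Bijective g :=
    (Fintype.bijective_iff_injective_and_card g).mpr ⟨ginj, by rw [H_card ht, Fintype.card_fin]⟩
  have gH : ∀ a b, (Hst 1 t).Adj a b → ¬ G.Adj (g a) (g b) := by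
    have nB : ∀ i, ¬ G.Adj (eB i) (f (eB i)) := fun i => (hf _ (eBA i)).2.2.2
    rintro (⟨i, a⟩ | a) (⟨j, b⟩ | b) hab
    · rw [H_ll] at hab
      obtain ⟨h1, h2⟩ := hab
      simp only at h1 h2
      subst h1
      rcases a with a | a <;> rcases b with b | b
      · exact absurd (by rw [Subsingleton.elim a b]) h2
      · exact nB i
      · exact fun h' => nB i h'.symm
      · exact absurd (by rw [Subsingleton.elim a b]) h2
    · exact absurd hab (H_lr _ _)
    · exact absurd hab.symm (H_lr _ _)
    · rw [H_rr] at hab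
      rcases a with a | a <;> rcases b with b | b
      · simp [starG] at hab
      · exact Lz _ (eLm b)
      · exact fun h' => Lz _ (eLm a) h'.symm
      · simp [starG] at hab
  let e : Fin (t+1) ≃ _ := (Equiv.ofBijective g gbij).symm
  have hge : ∀ i, g (e i) = i := fun i => (Equiv.ofBijective g gbij).apply_symm_apply i
  have hle : G ≤ (Hst 1 t)ᶜ.comap e := by
    intro a b hab
    rw [comap_adj, compl_adj]
    refine ⟨fun h' => hab.ne (e.injective h'), fun h' => ?_⟩
    have := gH _ _ h'
    rw [hge, hge] at this
    exact this hab
  have hr : specRad ((Hst 1 t)ᶜ.comap e) ≤ specRad G := by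
    apply hmax
    · exact (Iso.comap e _).connected_iff.mpr (Hc_connected ht)
    · rw [free_iff _ _ (by omega)]
      exact FreeD_comap (Hc_free ht) e
  have heq := sx_eq_of_le hconn hle hr
  rw [heq]
  exact ⟨Iso.comap e _⟩

lemma deg_top {t : ℕ} (v w : Fin t) : deg (⊤ : SimpleGraph (Fin t)) v = deg (⊤ : SimpleGraph (Fin t)) w := by
  have : ∀ v : Fin t, deg (⊤ : SimpleGraph (Fin t)) v = t - 1 := by
    intro v
    unfold deg
    rw [Set.ncard_eq_toFinset_card', ← SimpleGraph.neighborFinset_def, SimpleGraph.card_neighborFinset_eq_degree,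
      SimpleGraph.complete_graph_degree, Fintype.card_fin]
  rw [this, this]

end P7

/-- Theorem 1.4: spectral extremal connected `K_{1,t}`-minor free graphs. -/
theorem spectral_extremal_K1t_connected (t n : ℕ) (ht : 3 ≤ t) (hn : t + 1 ≤ n)
    (G : SimpleGraph (Fin n)) (hconn : G.Connected)
    (hfree : ¬ MinorOf (completeBipartiteGraph (Fin 1) (Fin t)) G)
    (hmax : ∀ G' : SimpleGraph (Fin n), G'.Connected →
      ¬ MinorOf (completeBipartiteGraph (Fin 1) (Fin t)) G' → specRad G' ≤ specRad G) :
    (n = t + 1 → Nonempty (G ≃g (Hst 1 t)ᶜ)) ∧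
    (t + 2 ≤ n → ∃ u v : Fin t, (⊤ : SimpleGraph (Fin t)).Adj u v ∧
      (∀ a b : Fin t, (⊤ : SimpleGraph (Fin t)).Adj a b →
        deg (⊤ : SimpleGraph (Fin t)) u + deg (⊤ : SimpleGraph (Fin t)) v ≤
          deg (⊤ : SimpleGraph (Fin t)) a + deg (⊤ : SimpleGraph (Fin t)) b) ∧
      Nonempty (G ≃g subdividePath (⊤ : SimpleGraph (Fin t)) u v (n - t))) := by
  refine ⟨fun h => ?_, fun h => ?_⟩
  · subst h
    exact case_small t ht G hconn hfree hmax
  · obtain ⟨u, v, huv, hiso⟩ := case_big t n ht h G hconn hfree hmax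
    refine ⟨u, v, huv, fun a b _ => ?_, hiso⟩
    rw [deg_top u a, deg_top v b]
end

section
/- Let 2 ≤ s ≤ t and N be fixed integers. There exists n₀ such that for all n ≥ n₀ the following holds: with G⋆ and K as in the extremal setup, let H be the disjoint union of some collection of connected components of G⋆ − K with |V(H)| ≤ N, and let H′ be a graph on the vertex set V(H) having the (s,t)-property. Then e(H′) ≤ e(H). -/
open SimpleGraph

/-- A property invariant along edges is constant on a connected set. -/
lemma conn_prop {β : Type} {L : SimpleGraph β} {A : Set β} (hA : (L.induce A).Connected)
    (P : β → Prop) (hP : ∀ u ∈ A, ∀ v ∈ A, L.Adj u v → P u → P v)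
    {u : β} (hu : u ∈ A) (hPu : P u) : ∀ v ∈ A, P v := by
  intro v hv
  obtain ⟨w⟩ := hA.preconnected ⟨u, hu⟩ ⟨v, hv⟩
  have key : ∀ (x y : A), (L.induce A).Walk x y → P x.1 → P y.1 := by
    intro x y w
    induction w with
    | nil => exact id
    | cons h _ ih => exact fun hx => ih (hP _ (Subtype.property _) _ (Subtype.property _) h hx)
  exact key _ _ w hPu

/-- Replacing the part `range f` by a graph with the (s,t)-property creates no minor. -/
lemma minor_part {β γ : Type} {s t : ℕ} (hst : s ≤ t) (f : γ → β)
    (hf : Function.Injective f)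
    (G G' : SimpleGraph β) (H' : SimpleGraph γ) (K : Finset β) (hK : K.card + 1 ≤ s)
    (hcl : G.IsClique (↑K : Set β)) (hdom : ∀ v, v ∉ K → ∀ u ∈ K, G.Adj u v)
    (h1 : ∀ u v, G'.Adj u v → u ∉ Set.range f → v ∉ Set.range f → G.Adj u v)
    (h2 : ∀ p q, G'.Adj (f p) (f q) → H'.Adj p q)
    (h3 : ∀ u v, G'.Adj u v → u ∈ Set.range f → v ∉ K → v ∈ Set.range f)
    (hG : ¬ MinorOf (completeBipartiteGraph (Fin s) (Fin t)) G)
    (hH : HasSTProp s t H') :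
    ¬ MinorOf (completeBipartiteGraph (Fin s) (Fin t)) G' := by
  classical
  rintro ⟨φ, hcon, hdis, hadj⟩
  -- touching indices
  let T : Fin s ⊕ Fin t → Prop := fun i => ∃ k ∈ K, k ∈ φ i
  have hex : ∀ i, ∃ k, T i → k ∈ K ∧ k ∈ φ i := by
    intro i
    by_cases h : T i
    · obtain ⟨k, hk⟩ := h
      exact ⟨k, fun _ => hk⟩
    · obtain ⟨x⟩ := (hcon i).nonempty
      exact ⟨x.1, fun h' => absurd h' h⟩
  choose c hc using hex
  have hne : ∀ i j, i ≠ j → ∀ x, x ∈ φ i → x ∈ φ j → False := fun i j hij x hx hy =>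
    Set.disjoint_left.1 (hdis hij) hx hy
  have hcinj : ∀ i j, T i → T j → c i = c j → i = j := by
    intro i j hi hj h
    by_contra hij
    exact hne i j hij (c i) (hc i hi).2 (h ▸ (hc j hj).2)
  -- each nontouching set lies inside or outside
  have hin : ∀ i, ¬ T i → ∀ u ∈ φ i, u ∈ Set.range f → ∀ v ∈ φ i, v ∈ Set.range f := by
    intro i hi u hu huf
    exact conn_prop (hcon i) (fun v => v ∈ Set.range f)
      (fun u _ v hv hadj hu => h3 u v hadj hu (fun hvK => hi ⟨v, hvK, hv⟩)) hu huf
  by_cases hcase : ∀ i, ¬ T i → ∀ v ∈ φ i, v ∉ Set.range f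
  · apply hG
    refine ⟨fun i => if T i then {c i} else φ i, ?_, ?_, ?_⟩
    · intro i
      by_cases hi : T i
      · have : ((if T i then {c i} else φ i) : Set β) = {c i} := if_pos hi
        beta_reduce
        rw [this]
        have : Nonempty ({c i} : Set β) := ⟨⟨c i, rfl⟩⟩
        exact ⟨fun x y => by
          have : x = y := Subsingleton.elim _ _
          subst this; exact Reachable.refl _⟩
      · have : ((if T i then {c i} else φ i) : Set β) = φ i := if_neg hi
        beta_reduce
        rw [this]
        have : G'.induce (φ i) ≤ G.induce (φ i) := by
          intro x y hxy
          exact h1 _ _ hxy (hcase i hi _ x.2) (hcase i hi _ y.2)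
        exact (hcon i).mono this
    · have hsub : ∀ i, (if T i then {c i} else φ i) ⊆ φ i := by
        intro i
        split_ifs with hi
        · exact Set.singleton_subset_iff.2 (hc i hi).2
        · exact subset_rfl
      intro i j hij
      exact (hdis hij).mono (hsub i) (hsub j)
    · intro i j hij
      have hijne : i ≠ j := hij.ne
      by_cases hi : T i <;> by_cases hj : T j
      · simp only [hi, hj, if_true, Set.mem_singleton_iff, exists_eq_left]
        exact hcl (hc i hi).1 (hc j hj).1 (fun h => hijne (hcinj i j hi hj h))
      · simp only [hi, hj, if_true, if_false, Set.mem_singleton_iff, exists_eq_left]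
        obtain ⟨y⟩ := (hcon j).nonempty
        exact ⟨y, y.2, hdom _ (fun h => hj ⟨_, h, y.2⟩) _ (hc i hi).1⟩
      · simp only [hi, hj, if_true, if_false, Set.mem_singleton_iff, exists_eq_left]
        obtain ⟨y⟩ := (hcon i).nonempty
        exact ⟨y, y.2, (hdom _ (fun h => hi ⟨_, h, y.2⟩) _ (hc j hj).1).symm⟩
      · simp only [hi, hj, if_false]
        obtain ⟨x, hx, y, hy, h⟩ := hadj i j hij
        exact ⟨x, hx, y, hy, h1 x y h (hcase i hi x hx) (hcase j hj y hy)⟩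
  · push Not at hcase
    obtain ⟨i0, hi0, v0, hv0, hv0f⟩ := hcase
    let A : Finset (Fin s) := Finset.univ.filter fun i => ¬ T (Sum.inl i)
    let B : Finset (Fin t) := Finset.univ.filter fun i => ¬ T (Sum.inr i)
    have hTcard : (Finset.univ.filter T).card ≤ K.card := by
      apply Finset.card_le_card_of_injOn c
      · intro i hi
        simp only [Finset.coe_filter, Finset.mem_univ, true_and, Set.mem_ofPred_eq] at hi
        exact (hc i hi).1
      · intro i hi j hj h
        simp only [Finset.coe_filter, Finset.mem_univ, true_and, Set.mem_ofPred_eq] at hi hj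
        exact hcinj i j hi hj h
    have hsum : (Finset.univ.filter fun i => ¬ T i).card = A.card + B.card := by
      rw [← Finset.card_disjSum]
      congr 1
      ext i
      rcases i with i | i <;> simp [A, B]
    have htot := Finset.card_filter_add_card_filter_not (s := Finset.univ) T
    rw [hsum, Finset.card_univ, Fintype.card_sum, Fintype.card_fin, Fintype.card_fin] at htot
    have hA : A.card ≤ s := by simpa using Finset.card_le_univ A
    have hB : B.card ≤ t := by simpa using Finset.card_le_univ B
    obtain ⟨a0, ha0⟩ : A.Nonempty := Finset.card_pos.1 (by omega)
    obtain ⟨b0, hb0⟩ : B.Nonempty := Finset.card_pos.1 (by omega)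
    have hTA : ∀ i ∈ A, ¬ T (Sum.inl i) := fun i hi => (Finset.mem_filter.1 hi).2
    have hTB : ∀ i ∈ B, ¬ T (Sum.inr i) := fun i hi => (Finset.mem_filter.1 hi).2
    have hstep : ∀ i j, (completeBipartiteGraph (Fin s) (Fin t)).Adj i j → ¬ T i → ¬ T j →
        (∀ v ∈ φ i, v ∈ Set.range f) → ∀ v ∈ φ j, v ∈ Set.range f := by
      intro i j hij hi hj h
      obtain ⟨x, hx, y, hy, hxy⟩ := hadj i j hij
      exact hin j hj y hy (h3 x y hxy (h x hx) (fun hk => hj ⟨y, hk, hy⟩))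
    have hi0' := hin i0 hi0 v0 hv0 hv0f
    have hab : (∀ v ∈ φ (Sum.inl a0), v ∈ Set.range f) ∧
        (∀ v ∈ φ (Sum.inr b0), v ∈ Set.range f) := by
      rcases i0 with i0 | i0
      · have hb := hstep _ (Sum.inr b0) (by simp) hi0 (hTB _ hb0) hi0'
        exact ⟨hstep _ _ (by simp) (hTB _ hb0) (hTA _ ha0) hb, hb⟩
      · have ha := hstep _ (Sum.inl a0) (by simp) hi0 (hTA _ ha0) hi0'
        exact ⟨ha, hstep _ _ (by simp) (hTA _ ha0) (hTB _ hb0) ha⟩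
    have hall : ∀ i, ¬ T i → ∀ v ∈ φ i, v ∈ Set.range f := by
      intro i hi
      rcases i with i | i
      · exact hstep _ _ (by simp) (hTB _ hb0) hi hab.2
      · exact hstep _ _ (by simp) (hTA _ ha0) hi hab.1
    -- pull back
    have hpc : ∀ i, ¬ T i → (H'.induce (f ⁻¹' φ i)).Connected := by
      intro i hi
      have hg : ∀ x : φ i, ∃ p : (f ⁻¹' φ i : Set γ), f p.1 = x.1 := by
        intro x
        obtain ⟨p, hp⟩ := hall i hi x.1 x.2
        exact ⟨⟨p, by simp [hp]⟩, hp⟩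
      choose g hg using hg
      refine Connected.map (G := G'.induce (φ i)) ⟨g, ?_⟩ ?_ (hcon i)
      · intro x y hxy
        apply h2
        have hxy' : G'.Adj x.1 y.1 := hxy
        rw [← hg, ← hg] at hxy'
        exact hxy'
      · intro p
        refine ⟨⟨f p.1, p.2⟩, ?_⟩
        apply Subtype.ext
        apply hf
        exact hg _
    have hpa : ∀ i j, (completeBipartiteGraph (Fin s) (Fin t)).Adj i j → ¬ T i → ¬ T j →
        ∃ x ∈ f ⁻¹' φ i, ∃ y ∈ f ⁻¹' φ j, H'.Adj x y := by
      intro i j hij hi hj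
      obtain ⟨x, hx, y, hy, hxy⟩ := hadj i j hij
      obtain ⟨p, rfl⟩ := hall i hi x hx
      obtain ⟨q, rfl⟩ := hall j hj y hy
      exact ⟨p, hx, q, hy, h2 _ _ hxy⟩
    have hpd : ∀ i j, i ≠ j → Disjoint (f ⁻¹' φ i) (f ⁻¹' φ j) := fun i j hij =>
      (hdis hij).preimage f
    -- embeddings
    obtain ⟨eA⟩ : Nonempty (Fin A.card ↪ A) := ⟨A.equivFin.symm.toEmbedding⟩
    obtain ⟨b, hb⟩ : ∃ b, A.card + b = t + 1 := ⟨t + 1 - A.card, by omega⟩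
    have hbB : b ≤ B.card := by omega
    have eB : Fin b ↪ B := (Fin.castLEEmb hbB).trans B.equivFin.symm.toEmbedding
    have hA1 : 1 ≤ A.card := Finset.card_pos.2 ⟨a0, ha0⟩
    by_cases hle : A.card ≤ (t + 1) / 2
    · apply hH A.card b hA1 (by omega) hb (by omega)
      have hT : ∀ i : Fin A.card ⊕ Fin b, ¬ T (Sum.map (fun i => (eA i).1) (fun i => (eB i).1) i) := by
        rintro (i | i)
        · exact hTA _ (eA i).2
        · exact hTB _ (eB i).2
      refine ⟨fun i => f ⁻¹' φ (Sum.map (fun i => (eA i).1) (fun i => (eB i).1) i),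
        fun i => hpc _ (hT i), fun i j hij => hpd _ _ (fun h => hij ?_),
        fun i j hij => hpa _ _ ?_ (hT i) (hT j)⟩
      · exact Function.Injective.sumMap (Subtype.val_injective.comp eA.injective)
          (Subtype.val_injective.comp eB.injective) h
      · rcases i with i | i <;> rcases j with j | j <;>
          simp [completeBipartiteGraph_adj] at hij ⊢
    · apply hH b A.card (by omega) hA1 (by omega) (by omega)
      have hT : ∀ i : Fin b ⊕ Fin A.card,
          ¬ T (Sum.map (fun i => (eA i).1) (fun i => (eB i).1) i.swap) := by
        rintro (i | i)
        · exact hTB _ (eB i).2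
        · exact hTA _ (eA i).2
      refine ⟨fun i => f ⁻¹' φ (Sum.map (fun i => (eA i).1) (fun i => (eB i).1) i.swap),
        fun i => hpc _ (hT i), fun i j hij => hpd _ _ (fun h => hij ?_),
        fun i j hij => hpa _ _ ?_ (hT i) (hT j)⟩
      · have := Function.Injective.sumMap (Subtype.val_injective.comp eA.injective)
          (Subtype.val_injective.comp eB.injective) h
        exact Sum.swap_leftInverse.injective this
      · rcases i with i | i <;> rcases j with j | j <;>
          simp [completeBipartiteGraph_adj] at hij ⊢

open Matrix in
lemma adjMat_apply' {V : Type} [Fintype V] (G : SimpleGraph V) (u v : V) [Decidable (G.Adj u v)] :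
    adjMat G u v = if G.Adj u v then 1 else 0 := by
  simp only [adjMat, SimpleGraph.adjMatrix_apply]
  congr

open Matrix in
lemma shift_psd {V : Type} [Fintype V] [DecidableEq V] (G : SimpleGraph V) :
    (specRad G • (1 : Matrix V V ℝ) - adjMat G).PosSemidef := by
  have hA := adjMat_herm G
  have hd : (Matrix.diagonal fun i => specRad G - hA.eigenvalues i).PosSemidef := by
    rw [Matrix.posSemidef_diagonal_iff]
    intro i
    exact sub_nonneg.2 (le_ciSup (f := fun i => hA.eigenvalues i) (Set.finite_range _).bddAbove i)
  have h := hd.mul_mul_conjTranspose_same (hA.eigenvectorUnitary : Matrix V V ℝ)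
  convert h using 1
  have hs : (Matrix.diagonal fun i => specRad G - hA.eigenvalues i)
      = specRad G • (1 : Matrix V V ℝ) - Matrix.diagonal (RCLike.ofReal ∘ hA.eigenvalues) := by
    ext i j
    by_cases hij : i = j
    · subst hij; simp
    · simp [hij]
  have hU : (hA.eigenvectorUnitary : Matrix V V ℝ) * (hA.eigenvectorUnitary : Matrix V V ℝ)ᴴ = 1 :=
    Unitary.coe_mul_star_self hA.eigenvectorUnitary
  have hsp := hA.spectral_theorem
  rw [Unitary.conjStarAlgAut_apply] at hsp
  rw [hs, Matrix.mul_sub, Matrix.sub_mul, Matrix.mul_smul, Matrix.smul_mul, Matrix.mul_one, hU]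
  congr 1

open Matrix in
lemma quad_le {V : Type} [Fintype V] [DecidableEq V] (G : SimpleGraph V) (x : V → ℝ) :
    x ⬝ᵥ (adjMat G *ᵥ x) ≤ specRad G * (x ⬝ᵥ x) := by
  have := (shift_psd G).dotProduct_mulVec_nonneg x
  simp only [star_trivial, Matrix.sub_mulVec, Matrix.smul_mulVec, Matrix.one_mulVec,
    dotProduct_sub, dotProduct_smul, smul_eq_mul] at this
  linarith

open Matrix in
lemma exists_perron {V : Type} [Fintype V] [DecidableEq V] [Nonempty V] (G : SimpleGraph V) :
    ∃ x : V → ℝ, (∀ v, 0 ≤ x v) ∧ x ≠ 0 ∧ adjMat G *ᵥ x = specRad G • x := by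
  classical
  have hA := adjMat_herm G
  obtain ⟨i, hi⟩ := exists_eq_ciSup_of_finite (f := fun i => hA.eigenvalues i)
  have hi : hA.eigenvalues i = specRad G := hi
  have hy := hA.mulVec_eigenvectorBasis i
  have hy0 : (hA.eigenvectorBasis i).ofLp ≠ 0 := by
    intro h
    have h1 := hA.eigenvectorBasis.orthonormal.1 i
    have : hA.eigenvectorBasis i = 0 := by
      ext j; exact congrFun h j
    rw [this] at h1
    simp at h1
  generalize (hA.eigenvectorBasis i).ofLp = y at hy hy0
  rw [hi] at hy
  refine ⟨fun v => |y v|, fun v => abs_nonneg _, ?_, ?_⟩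
  · intro h
    apply hy0
    ext v
    simpa using congrFun h v
  · have hle := quad_le G (fun v => |y v|)
    have hsq : (fun v => |y v|) ⬝ᵥ (fun v => |y v|) = y ⬝ᵥ y := by
      simp [dotProduct]
    have hge : y ⬝ᵥ (adjMat G *ᵥ y) ≤ (fun v => |y v|) ⬝ᵥ (adjMat G *ᵥ (fun v => |y v|)) := by
      simp only [dotProduct, Matrix.mulVec, Finset.mul_sum]
      refine Finset.sum_le_sum fun u _ => Finset.sum_le_sum fun v _ => ?_
      rw [adjMat_apply']
      split_ifs
      · rw [one_mul, one_mul, ← abs_mul]; exact le_abs_self _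
      · simp
    rw [hy, dotProduct_smul, smul_eq_mul] at hge
    rw [hsq] at hle
    have h0 : star (fun v => |y v|) ⬝ᵥ
        ((specRad G • (1 : Matrix V V ℝ) - adjMat G) *ᵥ (fun v => |y v|)) = 0 := by
      simp only [star_trivial, Matrix.sub_mulVec, Matrix.smul_mulVec, Matrix.one_mulVec,
        dotProduct_sub, dotProduct_smul, smul_eq_mul]
      rw [hsq]; linarith
    rw [(shift_psd G).dotProduct_mulVec_zero_iff] at h0
    simp only [Matrix.sub_mulVec, Matrix.smul_mulVec, Matrix.one_mulVec] at h0
    exact (sub_eq_zero.1 h0).symm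

lemma sum_adjMat_eq {W : Type} [Fintype W] (L : SimpleGraph W) :
    ∑ p, ∑ q, adjMat L p q = 2 * (ecard L : ℝ) := by
  classical
  have h := L.sum_degrees_eq_twice_card_edges
  have he : ecard L = L.edgeFinset.card := by
    rw [ecard, ← SimpleGraph.coe_edgeFinset, Set.ncard_coe_finset]
  rw [he]
  have h' : ((∑ v, L.degree v : ℕ) : ℝ) = 2 * (L.edgeFinset.card : ℝ) := by
    rw [h]; push_cast; rfl
  rw [← h']
  push_cast
  refine Finset.sum_congr rfl fun p _ => ?_
  simp only [adjMat_apply']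
  rw [Finset.sum_boole, ← SimpleGraph.card_neighborFinset_eq_degree,
    SimpleGraph.neighborFinset_eq_filter]

open Matrix in
lemma spectral_part {β γ : Type} [Fintype β] [DecidableEq β] [Fintype γ] (N : ℕ) (f : γ → β)
    (hf : Function.Injective f)
    (G G' : SimpleGraph β) (H H' : SimpleGraph γ) (K : Finset β) (hKne : K.Nonempty)
    (hn : (2 * N * (N ^ 2 + 1) + N + 1) ^ 2 + 2 ≤ Fintype.card β)
    (hcl : G.IsClique (↑K : Set β)) (hdom : ∀ v, v ∉ K → ∀ u ∈ K, G.Adj u v)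
    (hfK : ∀ p, f p ∉ K)
    (hclosed : ∀ p v, G.Adj (f p) v → v ∉ K → v ∈ Set.range f)
    (hHG : ∀ p q, G.Adj (f p) (f q) ↔ H.Adj p q)
    (hHG' : ∀ p q, G'.Adj (f p) (f q) ↔ H'.Adj p q)
    (hout : ∀ u v, ¬ (u ∈ Set.range f ∧ v ∈ Set.range f) → (G'.Adj u v ↔ G.Adj u v))
    (hN : Fintype.card γ ≤ N)
    (hle : specRad G' ≤ specRad G) : ecard H' ≤ ecard H := by
  classical
  by_contra hlt
  push Not at hlt
  haveI : Nonempty β := Fintype.card_pos_iff.1 (by omega)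
  obtain ⟨x, hx0, hxne, hx⟩ := exists_perron G
  set ρ := specRad G with hρ
  have heig : ∀ v, ∑ u, adjMat G v u * x u = ρ * x v := fun v => by
    have := congrFun hx v
    simpa [Matrix.mulVec, dotProduct] using this
  have hAnn : ∀ u v, 0 ≤ adjMat G u v * x v := by
    intro u v
    rw [adjMat_apply']
    split_ifs <;> simp [hx0]
  -- a dominating vertex
  obtain ⟨k, hk⟩ := hKne
  have hkadj : ∀ v, v ≠ k → G.Adj k v := by
    intro v hv
    by_cases hvK : v ∈ K
    · exact hcl hk hvK hv.symm
    · exact hdom v hvK k hk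
  have hk_eig : ∑ v ∈ Finset.univ.erase k, x v = ρ * x k := by
    rw [← heig k, ← Finset.add_sum_erase _ _ (Finset.mem_univ k)]
    rw [adjMat_apply', if_neg (G.irrefl), zero_mul, zero_add]
    refine Finset.sum_congr rfl fun v hv => ?_
    rw [adjMat_apply', if_pos (hkadj v (Finset.ne_of_mem_erase hv)), one_mul]
  have hxk : 0 < x k := by
    rcases (hx0 k).lt_or_eq with h | h
    · exact h
    exfalso
    apply hxne
    rw [← h, mul_zero, Finset.sum_eq_zero_iff_of_nonneg (fun v _ => hx0 v)] at hk_eig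
    ext v
    by_cases hv : v = k
    · rw [hv, ← h]; rfl
    · exact hk_eig v (Finset.mem_erase.2 ⟨hv, Finset.mem_univ _⟩)
  have hρ0 : 0 ≤ ρ := by
    have : 0 ≤ ρ * x k := hk_eig ▸ Finset.sum_nonneg fun v _ => hx0 v
    exact nonneg_of_mul_nonneg_left this hxk
  have hρv : ∀ v, v ≠ k → x k ≤ ρ * x v := by
    intro v hv
    rw [← heig v]
    refine le_trans ?_ (Finset.single_le_sum (fun u _ => hAnn v u) (Finset.mem_univ k))
    rw [adjMat_apply', if_pos (hkadj v hv).symm, one_mul]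
  set M : ℝ := 2 * N * (N ^ 2 + 1) + N + 1 with hM
  have hM0 : 0 < M := by positivity
  have hρM : M ≤ ρ := by
    have h1 : ((Finset.univ.erase k).card : ℝ) * x k ≤ ρ * (ρ * x k) := by
      rw [← hk_eig, Finset.mul_sum, ← nsmul_eq_mul]
      exact Finset.card_nsmul_le_sum _ _ _ fun v hv => hρv v (Finset.ne_of_mem_erase hv)
    have h2 : M ^ 2 ≤ ((Finset.univ.erase k).card : ℝ) := by
      rw [Finset.card_erase_of_mem (Finset.mem_univ k), Finset.card_univ]
      have : (2 * N * (N ^ 2 + 1) + N + 1) ^ 2 ≤ Fintype.card β - 1 := by omega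
      rw [hM]
      exact_mod_cast this
    have h3 : M ^ 2 * x k ≤ ρ ^ 2 * x k := by nlinarith
    exact le_of_sq_le_sq (le_of_mul_le_mul_right h3 hxk) hρ0
  -- bounds on entries
  set σ := ∑ u ∈ K, x u with hσ
  have hσ0 : 0 < σ := lt_of_lt_of_le hxk (Finset.single_le_sum (fun u _ => hx0 u) hk)
  have hlow : ∀ p, σ ≤ ρ * x (f p) := by
    intro p
    rw [← heig]
    refine le_trans (le_of_eq ?_) (Finset.sum_le_sum_of_subset_of_nonneg (Finset.subset_univ K)
      fun u _ _ => hAnn _ u)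
    refine Finset.sum_congr rfl fun u hu => ?_
    rw [adjMat_apply', if_pos (hdom _ (hfK p) u hu).symm, one_mul]
  set T := ∑ p, x (f p) with hT
  have hTeq : T = ∑ u, if u ∈ Set.range f then x u else 0 := by
    refine Fintype.sum_of_injective f hf _ _ (fun u hu => if_neg hu) fun p => ?_
    rw [if_pos ⟨p, rfl⟩]
  have hσeq : σ = ∑ u, if u ∈ K then x u else 0 := by
    rw [hσ]; simp
  have hup1 : ∀ p, ρ * x (f p) ≤ σ + T := by
    intro p
    rw [← heig, hTeq, hσeq, ← Finset.sum_add_distrib]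
    refine Finset.sum_le_sum fun u _ => ?_
    rw [adjMat_apply']
    have := hx0 u
    by_cases ha : G.Adj (f p) u
    · rw [if_pos ha, one_mul]
      by_cases hu : u ∈ K
      · rw [if_pos hu]; split_ifs <;> linarith
      · rw [if_pos (hclosed p u ha hu), if_neg hu, zero_add]
    · rw [if_neg ha, zero_mul]
      split_ifs <;> linarith
  have hT0 : 0 ≤ T := Finset.sum_nonneg fun p _ => hx0 _
  have hNr : (Fintype.card γ : ℝ) ≤ N := by exact_mod_cast hN
  have hTb : ρ * T ≤ N * (σ + T) := by
    rw [hT, Finset.mul_sum, ← hT]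
    calc ∑ p, ρ * x (f p) ≤ ∑ _p : γ, (σ + T) := Finset.sum_le_sum fun p _ => hup1 p
      _ = Fintype.card γ * (σ + T) := by simp [mul_add]
      _ ≤ N * (σ + T) := by gcongr
  have hN0 : (0 : ℝ) ≤ N := Nat.cast_nonneg N
  have hMN : (2 : ℝ) * N * (N ^ 2 + 1) + N + 1 ≤ ρ := hρM
  have hNN : (0 : ℝ) ≤ 2 * N * (N ^ 2 + 1) := by positivity
  have hρN : 0 < ρ - N := by linarith
  have hρpos : 0 < ρ := by linarith
  have hup : ∀ p, (ρ - N) * x (f p) ≤ σ := by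
    intro p
    have h1 := mul_le_mul_of_nonneg_left (hup1 p) hρN.le
    have h2 : ρ * ((ρ - N) * x (f p)) ≤ ρ * σ := by nlinarith
    exact le_of_mul_le_mul_left h2 hρpos
  -- comparing quadratic forms
  have hq : x ⬝ᵥ (adjMat G' *ᵥ x) ≤ x ⬝ᵥ (adjMat G *ᵥ x) := by
    rw [hx, dotProduct_smul, smul_eq_mul]
    refine (quad_le G' x).trans (mul_le_mul_of_nonneg_right hle ?_)
    exact Finset.sum_nonneg fun v _ => mul_self_nonneg _
  have hdiff : x ⬝ᵥ (adjMat G' *ᵥ x) - x ⬝ᵥ (adjMat G *ᵥ x)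
      = ∑ p, ∑ q, (adjMat H' p q - adjMat H p q) * (x (f p) * x (f q)) := by
    have e1 : x ⬝ᵥ (adjMat G' *ᵥ x) - x ⬝ᵥ (adjMat G *ᵥ x)
        = ∑ u, ∑ v, (adjMat G' u v - adjMat G u v) * (x u * x v) := by
      simp only [dotProduct, Matrix.mulVec, Finset.mul_sum, ← Finset.sum_sub_distrib]
      refine Finset.sum_congr rfl fun u _ => Finset.sum_congr rfl fun v _ => ?_
      ring
    have hz : ∀ u v, ¬ (u ∈ Set.range f ∧ v ∈ Set.range f) →
        (adjMat G' u v - adjMat G u v) * (x u * x v) = 0 := by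
      intro u v huv
      rw [adjMat_apply', adjMat_apply']
      simp only [hout u v huv, sub_self, zero_mul]
    rw [e1]
    symm
    refine Fintype.sum_of_injective f hf _ _ (fun u hu => ?_) fun p => ?_
    · exact Finset.sum_eq_zero fun v _ => hz u v fun h => hu h.1
    · refine Fintype.sum_of_injective f hf _ _ (fun v hv => hz _ _ fun h => hv h.2) fun q => ?_
      simp only [adjMat_apply', hHG, hHG']
  have hdiff2 : (0 : ℝ) ≥ ∑ p, ∑ q, (adjMat H' p q - adjMat H p q) * (x (f p) * x (f q)) := by
    rw [← hdiff]; linarith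
  set l := σ / ρ with hl
  set w := σ / (ρ - N) with hw
  have hl0 : 0 < l := div_pos hσ0 hρpos
  have hw0 : 0 < w := div_pos hσ0 hρN
  have hlx : ∀ p, l ≤ x (f p) := fun p => by
    rw [hl, div_le_iff₀ hρpos]; linarith [hlow p]
  have hxw : ∀ p, x (f p) ≤ w := fun p => by
    rw [hw, le_div_iff₀ hρN]; linarith [hup p]
  have hmain : 2 * (ecard H' : ℝ) * (l * l) - 2 * (ecard H : ℝ) * (w * w) ≤ 0 := by
    refine le_trans ?_ hdiff2
    rw [← sum_adjMat_eq, ← sum_adjMat_eq]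
    simp only [Finset.sum_mul, ← Finset.sum_sub_distrib]
    refine Finset.sum_le_sum fun p _ => Finset.sum_le_sum fun q _ => ?_
    have h1 : l * l ≤ x (f p) * x (f q) := mul_le_mul (hlx p) (hlx q) hl0.le (hx0 _)
    have h2 : x (f p) * x (f q) ≤ w * w := mul_le_mul (hxw p) (hxw q) (hx0 _) hw0.le
    rw [adjMat_apply', adjMat_apply']
    split_ifs <;> linarith
  -- numerics
  have he : (ecard H : ℝ) ≤ N ^ 2 := by
    have h1 : ∑ p, ∑ q, adjMat H p q ≤ ∑ _p : γ, ∑ _q : γ, (1 : ℝ) := by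
      refine Finset.sum_le_sum fun p _ => Finset.sum_le_sum fun q _ => ?_
      rw [adjMat_apply']; split_ifs <;> norm_num
    rw [sum_adjMat_eq] at h1
    simp only [Finset.sum_const, Finset.card_univ, nsmul_eq_mul, mul_one] at h1
    have h0 : (0 : ℝ) ≤ ecard H := Nat.cast_nonneg _
    nlinarith [Nat.cast_nonneg (α := ℝ) (Fintype.card γ)]
  have he' : (ecard H : ℝ) + 1 ≤ ecard H' := by exact_mod_cast hlt
  set e : ℝ := (ecard H : ℝ)
  have he0 : 0 ≤ e := Nat.cast_nonneg _
  have h4 : (e + 1) * (l * l) ≤ e * (w * w) := by nlinarith [mul_pos hl0 hl0]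
  have h5 : (e + 1) * (ρ - N) ^ 2 ≤ e * ρ ^ 2 := by
    have hlρ : l * ρ = σ := div_mul_cancel₀ _ hρpos.ne'
    have hwρ : w * (ρ - N) = σ := div_mul_cancel₀ _ hρN.ne'
    have h6 := mul_le_mul_of_nonneg_right h4 (mul_self_nonneg (ρ * (ρ - N)))
    have h7 : (e + 1) * (l * l) * (ρ * (ρ - N) * (ρ * (ρ - N)))
        = (e + 1) * (ρ - N) ^ 2 * σ ^ 2 := by rw [← hlρ]; ring
    have h8 : e * (w * w) * (ρ * (ρ - N) * (ρ * (ρ - N))) = e * ρ ^ 2 * σ ^ 2 := by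
      rw [← hwρ]; ring
    rw [h7, h8] at h6
    exact le_of_mul_le_mul_right h6 (by positivity)
  have h9 : ρ * ρ ≤ 2 * N * (e + 1) * ρ := by
    nlinarith [mul_nonneg (add_nonneg he0 zero_le_one) (sq_nonneg (N : ℝ))]
  have h10 := le_of_mul_le_mul_right h9 hρpos
  have h11 : 2 * (N : ℝ) * (e + 1) ≤ 2 * N * (N ^ 2 + 1) := by gcongr
  linarith

/-- Lemma 2.4 (local edge maximality). -/
theorem local_edge_maximality (s t N : ℕ) (hs : 2 ≤ s) (hst : s ≤ t) :
    ∃ n₀ : ℕ, ∀ n : ℕ, n₀ ≤ n →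
    ∀ (G : SimpleGraph (Fin n)) (K : Finset (Fin n)),
      ¬ MinorOf (completeBipartiteGraph (Fin s) (Fin t)) G →
      (∀ G' : SimpleGraph (Fin n),
        ¬ MinorOf (completeBipartiteGraph (Fin s) (Fin t)) G' → specRad G' ≤ specRad G) →
      K.card = s - 1 → G.IsClique (↑K : Set (Fin n)) →
      (∀ v : Fin n, v ∉ K → ∀ u ∈ K, G.Adj u v) →
      ∀ S : Set {v : Fin n // v ∉ K},
        (∀ u v : {v : Fin n // v ∉ K},
          (G.comap (Subtype.val : {v : Fin n // v ∉ K} → Fin n)).Reachable u v →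
            (u ∈ S ↔ v ∈ S)) →
        S.ncard ≤ N →
        ∀ H' : SimpleGraph ↥S, HasSTProp s t H' →
          ecard H' ≤ ecard ((G.comap (Subtype.val : {v : Fin n // v ∉ K} → Fin n)).induce S) := by
  classical
  refine ⟨(2 * N * (N ^ 2 + 1) + N + 1) ^ 2 + 2, ?_⟩
  intro n hn G K hG hmax hK hcl hdom S hS hSN H' hH'
  let f : ↥S → Fin n := fun p => p.1.1
  have hf : Function.Injective f := Subtype.val_injective.comp Subtype.val_injective
  have hfK : ∀ p, f p ∉ K := fun p => p.1.2
  have hclosed : ∀ p v, G.Adj (f p) v → v ∉ K → v ∈ Set.range f := by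
    intro p v hpv hv
    have hr : (G.comap (Subtype.val : {v : Fin n // v ∉ K} → Fin n)).Reachable p.1 ⟨v, hv⟩ :=
      SimpleGraph.Adj.reachable (by exact hpv)
    exact ⟨⟨⟨v, hv⟩, (hS _ _ hr).1 p.2⟩, rfl⟩
  let G' : SimpleGraph (Fin n) :=
    { Adj := fun u v => (G.Adj u v ∧ ¬ (u ∈ Set.range f ∧ v ∈ Set.range f)) ∨
        ∃ p q, H'.Adj p q ∧ f p = u ∧ f q = v
      symm := ⟨by
        rintro u v (⟨h, h'⟩ | ⟨p, q, h, hp, hq⟩)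
        · exact Or.inl ⟨h.symm, fun h'' => h' h''.symm⟩
        · exact Or.inr ⟨q, p, h.symm, hq, hp⟩⟩
      loopless := ⟨by
        rintro u (⟨h, h'⟩ | ⟨p, q, h, hp, hq⟩)
        · exact G.irrefl h
        · exact h.ne (hf (hp.trans hq.symm))⟩ }
  have hHG' : ∀ p q, G'.Adj (f p) (f q) ↔ H'.Adj p q := by
    intro p q
    constructor
    · rintro (⟨_, h⟩ | ⟨p', q', h, hp, hq⟩)
      · exact absurd ⟨⟨p, rfl⟩, ⟨q, rfl⟩⟩ h
      · rwa [← hf hp, ← hf hq]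
    · intro h
      exact Or.inr ⟨p, q, h, rfl, rfl⟩
  have hout : ∀ u v, ¬ (u ∈ Set.range f ∧ v ∈ Set.range f) → (G'.Adj u v ↔ G.Adj u v) := by
    intro u v huv
    constructor
    · rintro (⟨h, _⟩ | ⟨p, q, _, hp, hq⟩)
      · exact h
      · exact absurd ⟨⟨p, hp⟩, ⟨q, hq⟩⟩ huv
    · intro h
      exact Or.inl ⟨h, huv⟩
  have hG' : ¬ MinorOf (completeBipartiteGraph (Fin s) (Fin t)) G' := by
    refine minor_part hst f hf G G' H' K (by omega) hcl hdom ?_ (fun p q => (hHG' p q).1) ?_ hG hH'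
    · intro u v h hu _
      exact (hout u v fun h' => hu h'.1).1 h
    · rintro u v h ⟨p, rfl⟩ hv
      by_contra hvf
      exact hvf (hclosed p v ((hout _ _ fun h' => hvf h'.2).1 h) hv)
  refine spectral_part N f hf G G' _ H' K (Finset.card_pos.1 (by omega)) (by simpa using hn)
    hcl hdom hfK hclosed (fun p q => Iff.rfl) hHG' hout ?_ (hmax G' hG')
  rw [← Nat.card_eq_fintype_card]
  exact hSN
end
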